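/- arXiv:0901.3245 — 5 statements merged into one kernel-verified Lean document; each statement's English description precedes it below -/
import Mathlib

section
/- There exists σ₀ > 0 such that the map σ ↦ λ_max(S_n(σ)), assigning to σ the largest eigenvalue of S_n(σ), is real-analytic on (−σ₀, σ₀), and as σ → 0 it admits the expansion λ_max(S_n(σ)) = κ² + 2κρ₁·σ + (Σ_{j=2}^p ρ_j² + β₁₁)·σ² + O(σ³). -/
open MeasureTheory Filter Topology Asymptotics

/-- The largest eigenvalue of a (symmetric) real matrix, as the supremum of its real
spectrum. -/
noncomputable def maxEig {m : ℕ} (M : Matrix (Fin m) (Fin m) ℝ) : ℝ :=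
  sSup (spectrum ℝ M)

/-- The sample covariance matrix `(1/n) ∑_ν x^ν (x^ν)ᵀ` of the samples `x 0, …, x (n-1)`. -/
noncomputable def sampleCov (n p : ℕ) (x : Fin n → Fin p → ℝ) :
    Matrix (Fin p) (Fin p) ℝ :=
  (n : ℝ)⁻¹ • ∑ ν : Fin n, Matrix.vecMulVec (x ν) (x ν)


open scoped ContDiff

lemma maxEig_mem {m : ℕ} [NeZero m] (M : Matrix (Fin m) (Fin m) ℝ) (hM : M.IsHermitian) :
    maxEig M ∈ spectrum ℝ M ∧ ∀ i, M i i ≤ maxEig M := by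
  have hfin : (spectrum ℝ M).Finite := by
    rw [hM.spectrum_real_eq_range_eigenvalues]; exact Set.finite_range _
  have hne : (spectrum ℝ M).Nonempty := by
    rw [hM.spectrum_real_eq_range_eigenvalues]; exact Set.range_nonempty _
  refine ⟨hne.csSup_mem hfin, ?_⟩
  have hH : (algebraMap ℝ (Matrix (Fin m) (Fin m) ℝ) (maxEig M) - M).IsHermitian := by
    refine Matrix.IsHermitian.sub ?_ hM
    rw [Matrix.algebraMap_eq_diagonal]
    exact Matrix.isHermitian_diagonal _
  have hP : (algebraMap ℝ (Matrix (Fin m) (Fin m) ℝ) (maxEig M) - M).PosSemidef := by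
    rw [hH.posSemidef_iff_eigenvalues_nonneg]
    intro i
    have h := hH.eigenvalues_mem_spectrum_real i
    rw [← spectrum.singleton_sub_eq] at h
    obtain ⟨x, hx, y, hy, hxy⟩ := Set.mem_sub.1 h
    rw [Set.mem_singleton_iff] at hx
    have : y ≤ maxEig M := le_csSup hfin.bddAbove hy
    simp only [Pi.zero_apply]
    linarith
  intro i
  have := hP.diag_nonneg (i := i)
  simp [Matrix.algebraMap_eq_diagonal] at this
  exact this

lemma exists_eigvec {m : ℕ} (M : Matrix (Fin m) (Fin m) ℝ) (l : ℝ) (h : l ∈ spectrum ℝ M) :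
    ∃ x : Fin m → ℝ, x ≠ 0 ∧ ∀ i, ∑ j, M i j * x j = l * x i := by
  rw [← Matrix.spectrum_toLin', ← Module.End.hasEigenvalue_iff_mem_spectrum] at h
  obtain ⟨x, hx⟩ := h.exists_hasEigenvector
  refine ⟨x, hx.2, fun i => ?_⟩
  have := congrFun hx.apply_eq_smul i
  simpa [Matrix.toLin'_apply, Matrix.mulVec, dotProduct] using this

lemma hasFDerivAt_mul_zero {E : Type*} [NormedAddCommGroup E] [NormedSpace ℝ E]
    {f g : E → ℝ} {x : E} (hf : DifferentiableAt ℝ f x) (hg : DifferentiableAt ℝ g x)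
    (hf0 : f x = 0) (hg0 : g x = 0) :
    HasFDerivAt (fun z => f z * g z) (0 : E →L[ℝ] ℝ) x := by
  have := hf.hasFDerivAt.mul hg.hasFDerivAt
  have h2 : HasFDerivAt (f * g) (0 : E →L[ℝ] ℝ) x := by simpa [hf0, hg0] using this
  exact h2

/-- The linear equivalence `(s, h) ↦ (s, s b - k h)`. -/
noncomputable def linEq {q : ℕ} (k : ℝ) (hk : 0 < k) (b : Fin q → ℝ) :
    (ℝ × (Fin q → ℝ)) ≃L[ℝ] (ℝ × (Fin q → ℝ)) :=
  ContinuousLinearEquiv.equivOfInverse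
    ((ContinuousLinearMap.fst ℝ ℝ (Fin q → ℝ)).prod
      (ContinuousLinearMap.pi fun j => b j • ContinuousLinearMap.fst ℝ ℝ (Fin q → ℝ)
        - k • (ContinuousLinearMap.proj j).comp (ContinuousLinearMap.snd ℝ ℝ (Fin q → ℝ))))
    ((ContinuousLinearMap.fst ℝ ℝ (Fin q → ℝ)).prod
      (ContinuousLinearMap.pi fun j => (b j / k) • ContinuousLinearMap.fst ℝ ℝ (Fin q → ℝ)
        - (1 / k) • (ContinuousLinearMap.proj j).comp (ContinuousLinearMap.snd ℝ ℝ (Fin q → ℝ))))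
    (by
      rintro ⟨s, h⟩
      ext j
      · simp
      · simp; field_simp; ring)
    (by
      rintro ⟨s, h⟩
      ext j
      · simp
      · simp; field_simp; ring)

/-- the map for the implicit function theorem -/
lemma ift {q : ℕ} (k : ℝ) (hk : 0 < k) (a1 a2 : ℝ) (b1 b2 : Fin q → ℝ) (d : Fin q → Fin q → ℝ) :
    ∃ ψ : ℝ → Fin q → ℝ, AnalyticAt ℝ ψ 0 ∧ ψ 0 = 0 ∧
      ∀ᶠ z : ℝ × (Fin q → ℝ) in 𝓝 0,
        (∀ j, z.1 * b1 j + z.1 ^ 2 * b2 j + ∑ l, z.1 ^ 2 * d j l * z.2 l =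
          (k + a1 * z.1 + a2 * z.1 ^ 2 + ∑ l, (z.1 * b1 l + z.1 ^ 2 * b2 l) * z.2 l) * z.2 j) →
        z.2 = ψ z.1 := by
  let Φ : ℝ × (Fin q → ℝ) → ℝ × (Fin q → ℝ) := fun z => (z.1, fun j =>
    z.1 * b1 j + z.1 ^ 2 * b2 j + ∑ l, z.1 ^ 2 * d j l * z.2 l -
          (k + a1 * z.1 + a2 * z.1 ^ 2 + ∑ l, (z.1 * b1 l + z.1 ^ 2 * b2 l) * z.2 l) * z.2 j)
  have hΦ : ContDiffAt ℝ ω Φ 0 := by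
    have : ContDiff ℝ ω Φ := by
      unfold Φ
      fun_prop
    exact this.contDiffAt
  have hΦ0 : Φ 0 = 0 := by
    ext j <;> simp [Φ]
  have hd : HasFDerivAt Φ (linEq k hk b1 : (ℝ × (Fin q → ℝ)) →L[ℝ] (ℝ × (Fin q → ℝ))) 0 := by
    refine HasFDerivAt.prodMk (hasFDerivAt_fst) ?_
    rw [hasFDerivAt_pi]
    intro j
    have h1 : HasFDerivAt (fun z : ℝ × (Fin q → ℝ) =>
        z.1 * (z.1 * b2 j + ∑ l, z.1 * d j l * z.2 l)) 0 0 :=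
      hasFDerivAt_mul_zero (by fun_prop) (by fun_prop) (by simp) (by simp)
    have h2 : HasFDerivAt (fun z : ℝ × (Fin q → ℝ) =>
        (a1 * z.1 + a2 * z.1 ^ 2 + ∑ l, (z.1 * b1 l + z.1 ^ 2 * b2 l) * z.2 l) * z.2 j) 0 0 :=
      hasFDerivAt_mul_zero (by fun_prop) (by fun_prop) (by simp) (by simp)
    have h3 := (b1 j • ContinuousLinearMap.fst ℝ ℝ (Fin q → ℝ)
        - k • (ContinuousLinearMap.proj j).comp
          (ContinuousLinearMap.snd ℝ ℝ (Fin q → ℝ))).hasFDerivAt (x := 0)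
    have h4 := (h3.add h1).sub h2
    simp only [add_zero, sub_zero] at h4
    refine h4.congr_of_eventuallyEq (Eventually.of_forall fun z => ?_)
    have e : ∑ l, z.1 ^ 2 * d j l * z.2 l = z.1 * ∑ l, z.1 * d j l * z.2 l := by
      rw [Finset.mul_sum]; exact Finset.sum_congr rfl fun l _ => by ring
    simp
    rw [e]
    ring
  have hn : (ω : WithTop ℕ∞) ≠ 0 := by simp
  let g := hΦ.localInverse hd hn
  have hg : ContDiffAt ℝ ω g 0 := by
    have := hΦ.to_localInverse hd hn
    rwa [hΦ0] at this
  have hg0 : g 0 = 0 := by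
    have := hΦ.localInverse_apply_image hd hn
    rwa [hΦ0] at this
  refine ⟨fun s => (g (s, 0)).2, ?_, ?_, ?_⟩
  · apply ContDiffAt.analyticAt
    have : ContDiffAt ℝ ω (fun s : ℝ => g (s, 0)) 0 :=
      ContDiffAt.comp (g := g) (f := fun s : ℝ => (s, (0 : Fin q → ℝ))) (0 : ℝ) hg (by fun_prop)
    exact this.snd
  · change (g 0).2 = 0
    rw [hg0]; rfl
  · have := (hΦ.hasStrictFDerivAt' hd hn).eventually_left_inverse
    filter_upwards [this] with z hz hz2
    have e : Φ z = (z.1, 0) := by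
      ext j
      · rfl
      · simp only [Φ, Pi.zero_apply]
        rw [hz2 j, sub_self]
    have hz' : g (Φ z) = z := hz
    rw [e] at hz'
    simp [hz']

lemma key {q : ℕ} (k : ℝ) (hk : 0 < k) (a1 a2 : ℝ) (b1 b2 : Fin q → ℝ) (d : Fin q → Fin q → ℝ)
    (M : ℝ → Matrix (Fin (q + 1)) (Fin (q + 1)) ℝ) (hM : ∀ σ, (M σ).IsHermitian)
    (h00 : ∀ σ, M σ 0 0 = k + a1 * σ + a2 * σ ^ 2)
    (h0s : ∀ σ j, M σ 0 (Fin.succ j) = σ * b1 j + σ ^ 2 * b2 j)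
    (hs0 : ∀ σ j, M σ (Fin.succ j) 0 = σ * b1 j + σ ^ 2 * b2 j)
    (hss : ∀ σ i j, M σ (Fin.succ i) (Fin.succ j) = σ ^ 2 * d i j) :
    ∃ w : ℝ → Fin q → ℝ, AnalyticAt ℝ w 0 ∧ w 0 = 0 ∧
      ∀ᶠ σ in 𝓝 (0 : ℝ),
        maxEig (M σ) = k + a1 * σ + a2 * σ ^ 2 + ∑ l, (σ * b1 l + σ ^ 2 * b2 l) * w σ l ∧
        ∀ j, σ * b1 j + σ ^ 2 * b2 j + ∑ l, σ ^ 2 * d j l * w σ l =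
          maxEig (M σ) * w σ j := by
  obtain ⟨ψ, hψ, hψ0, hu⟩ := ift k hk a1 a2 b1 b2 d
  refine ⟨ψ, hψ, hψ0, ?_⟩
  -- bounds
  set B : ℝ := ∑ j, (|b1 j| + |b2 j|) with hB
  set C : ℝ := ∑ i, ∑ j, |d i j| with hC
  have hB0 : 0 ≤ B := Finset.sum_nonneg fun _ _ => by positivity
  have hC0 : 0 ≤ C := Finset.sum_nonneg fun _ _ => Finset.sum_nonneg fun _ _ => abs_nonneg _
  obtain ⟨ε, hε, hball⟩ := Metric.eventually_nhds_iff.1 hu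
  have e1 : ∀ᶠ σ in 𝓝 (0 : ℝ), k / 2 < k + a1 * σ + a2 * σ ^ 2 := by
    have : Tendsto (fun σ : ℝ => k + a1 * σ + a2 * σ ^ 2) (𝓝 0) (𝓝 (k + a1 * 0 + a2 * 0 ^ 2)) :=
      Continuous.tendsto (by fun_prop) 0
    exact this.eventually_const_lt (by simp; linarith)
  have e2 : ∀ᶠ σ in 𝓝 (0 : ℝ), C * σ ^ 2 < k / 4 := by
    have : Tendsto (fun σ : ℝ => C * σ ^ 2) (𝓝 0) (𝓝 (C * 0 ^ 2)) :=
      Continuous.tendsto (by fun_prop) 0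
    exact this.eventually_lt_const (by simp; linarith)
  have e3 : ∀ᶠ σ in 𝓝 (0 : ℝ), (|σ| + σ ^ 2) * B < k / 4 * ε := by
    have : Tendsto (fun σ : ℝ => (|σ| + σ ^ 2) * B) (𝓝 0) (𝓝 ((|0| + 0 ^ 2) * B)) :=
      Continuous.tendsto (by fun_prop) 0
    exact this.eventually_lt_const (by simp; positivity)
  have e4 : ∀ᶠ σ in 𝓝 (0 : ℝ), |σ| < ε := by
    have : Tendsto (fun σ : ℝ => |σ|) (𝓝 0) (𝓝 |0|) :=
      Continuous.tendsto (by fun_prop) 0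
    exact this.eventually_lt_const (by simpa using hε)
  filter_upwards [e1, e2, e3, e4] with σ h1 h2 h3 h4
  obtain ⟨hmem, hdiag⟩ := maxEig_mem (M σ) (hM σ)
  obtain ⟨x, hx0, hx⟩ := exists_eigvec _ _ hmem
  have hl : k / 2 < maxEig (M σ) := by
    have := hdiag 0
    rw [h00] at this
    linarith
  set L := maxEig (M σ) with hL
  have hxz : L * x 0 = (k + a1 * σ + a2 * σ ^ 2) * x 0
      + ∑ j, (σ * b1 j + σ ^ 2 * b2 j) * x (Fin.succ j) := by
    rw [← hx 0, Fin.sum_univ_succ, h00]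
    simp [h0s]
  have hxs : ∀ i : Fin q, L * x i.succ = (σ * b1 i + σ ^ 2 * b2 i) * x 0
      + ∑ j, σ ^ 2 * d i j * x (Fin.succ j) := by
    intro i
    rw [← hx i.succ, Fin.sum_univ_succ, hs0]
    simp [hss]
  -- bound on tail
  have hbound : k / 4 * ‖fun j : Fin q => x j.succ‖ ≤ (|σ| + σ ^ 2) * B * |x 0| := by
    set N := ‖fun j : Fin q => x j.succ‖ with hN
    have hN0 : 0 ≤ N := norm_nonneg _
    have hi : ∀ i : Fin q, k / 2 * |x i.succ| ≤ (|σ| + σ ^ 2) * B * |x 0| + C * σ ^ 2 * N := by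
      intro i
      have a1' : |σ * b1 i + σ ^ 2 * b2 i| ≤ (|σ| + σ ^ 2) * B := by
        have hBi : |b1 i| + |b2 i| ≤ B :=
          Finset.single_le_sum (f := fun j => |b1 j| + |b2 j|)
            (fun _ _ => by positivity) (Finset.mem_univ i)
        calc |σ * b1 i + σ ^ 2 * b2 i| ≤ |σ * b1 i| + |σ ^ 2 * b2 i| := abs_add_le _ _
          _ = |σ| * |b1 i| + σ ^ 2 * |b2 i| := by
            rw [abs_mul, abs_mul, abs_of_nonneg (sq_nonneg σ)]
          _ ≤ (|σ| + σ ^ 2) * (|b1 i| + |b2 i|) := by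
            have := abs_nonneg σ
            have := abs_nonneg (b1 i)
            have := abs_nonneg (b2 i)
            nlinarith [mul_nonneg (abs_nonneg σ) (abs_nonneg (b2 i)),
              mul_nonneg (sq_nonneg σ) (abs_nonneg (b1 i))]
          _ ≤ _ := by gcongr
      have a2' : |∑ j, σ ^ 2 * d i j * x (Fin.succ j)| ≤ C * σ ^ 2 * N := by
        calc |∑ j, σ ^ 2 * d i j * x (Fin.succ j)|
            ≤ ∑ j, |σ ^ 2 * d i j * x (Fin.succ j)| := Finset.abs_sum_le_sum_abs _ _
          _ ≤ ∑ j, σ ^ 2 * |d i j| * N := by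
            refine Finset.sum_le_sum fun j _ => ?_
            rw [abs_mul, abs_mul, abs_of_nonneg (sq_nonneg σ)]
            gcongr
            exact norm_le_pi_norm (fun j : Fin q => x j.succ) j
          _ = (∑ j, |d i j|) * σ ^ 2 * N := by
            rw [Finset.sum_mul, Finset.sum_mul]
            exact Finset.sum_congr rfl fun _ _ => by ring
          _ ≤ C * σ ^ 2 * N := by
            gcongr
            exact Finset.single_le_sum (f := fun i => ∑ j, |d i j|)
              (fun _ _ => Finset.sum_nonneg fun _ _ => abs_nonneg _) (Finset.mem_univ i)
      calc k / 2 * |x i.succ| ≤ L * |x i.succ| := by gcongr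
        _ = |L * x i.succ| := by rw [abs_mul, abs_of_pos (by linarith : 0 < L)]
        _ ≤ |σ * b1 i + σ ^ 2 * b2 i| * |x 0| + |∑ j, σ ^ 2 * d i j * x (Fin.succ j)| := by
          rw [hxs i, ← abs_mul]; exact abs_add_le _ _
        _ ≤ _ := by gcongr
    have : N ≤ ((|σ| + σ ^ 2) * B * |x 0| + C * σ ^ 2 * N) / (k / 2) := by
      rw [hN, pi_norm_le_iff_of_nonneg (by positivity)]
      intro i
      rw [le_div_iff₀ (by positivity), Real.norm_eq_abs]
      linarith [hi i]
    rw [le_div_iff₀ (by positivity)] at this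
    nlinarith [mul_le_mul_of_nonneg_right h2.le hN0]
  have hx00 : x 0 ≠ 0 := by
    intro h0
    apply hx0
    rw [h0] at hbound
    have hz : ‖fun j : Fin q => x j.succ‖ = 0 := by
      have := norm_nonneg (fun j : Fin q => x j.succ)
      simp only [abs_zero, mul_zero] at hbound
      nlinarith
    have hz' := norm_eq_zero.1 hz
    ext i
    refine Fin.cases h0 (fun j => ?_) i
    exact congrFun hz' j
  let w : Fin q → ℝ := fun j => x j.succ / x 0
  have hwn : ‖w‖ < ε := by
    have hw : w = (x 0)⁻¹ • (fun j : Fin q => x j.succ) := by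
      ext j; simp [w]; field_simp
    have hp : 0 < |x 0| := abs_pos.2 hx00
    rw [hw, norm_smul, norm_inv, Real.norm_eq_abs, inv_mul_lt_iff₀ hp]
    have : (|σ| + σ ^ 2) * B * |x 0| < k / 4 * ε * |x 0| := by gcongr
    nlinarith
  have hLw : L = k + a1 * σ + a2 * σ ^ 2 + ∑ l, (σ * b1 l + σ ^ 2 * b2 l) * w l := by
    apply mul_right_cancel₀ hx00
    rw [hxz, add_mul _ (∑ l, _) (x 0), Finset.sum_mul]
    congr 1
    refine Finset.sum_congr rfl fun j _ => ?_
    simp only [w]; field_simp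
  have hLs : ∀ j, σ * b1 j + σ ^ 2 * b2 j + ∑ l, σ ^ 2 * d j l * w l = L * w j := by
    intro j
    apply mul_right_cancel₀ hx00
    have e : L * w j * x 0 = L * x j.succ := by simp only [w]; field_simp
    rw [e, hxs, add_mul, Finset.sum_mul]
    congr 1
    refine Finset.sum_congr rfl fun j _ => ?_
    simp only [w]; field_simp
  have hwψ : w = ψ σ := by
    refine hball (y := (σ, w)) ?_ ?_
    · rw [dist_zero_right, Prod.norm_def]
      exact max_lt (by simpa using h4) hwn
    · intro j
      rw [← hLw]
      exact hLs j
  rw [← hwψ]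
  exact ⟨hLw, hLs⟩

lemma taylor {q : ℕ} (k : ℝ) (hk : 0 < k) (a1 a2 : ℝ) (b1 b2 : Fin q → ℝ) (d : Fin q → Fin q → ℝ)
    (f : ℝ → ℝ) (w : ℝ → Fin q → ℝ) (hw : AnalyticAt ℝ w 0) (hw0 : w 0 = 0)
    (h : ∀ᶠ σ in 𝓝 (0 : ℝ),
        f σ = k + a1 * σ + a2 * σ ^ 2 + ∑ l, (σ * b1 l + σ ^ 2 * b2 l) * w σ l ∧
        ∀ j, σ * b1 j + σ ^ 2 * b2 j + ∑ l, σ ^ 2 * d j l * w σ l = f σ * w σ j) :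
    AnalyticAt ℝ f 0 ∧
    (fun σ => f σ - (k + a1 * σ + ((∑ j, b1 j ^ 2 / k) + a2) * σ ^ 2)) =O[𝓝 0]
      (fun σ : ℝ => σ ^ 3) := by
  have hwa : ∀ j, AnalyticAt ℝ (fun σ => w σ j) 0 := fun j => by
    exact (analyticAt_pi_iff.1 hw) j
  have hfa : AnalyticAt ℝ f 0 := by
    have : AnalyticAt ℝ (fun σ => k + a1 * σ + a2 * σ ^ 2
        + ∑ l, (σ * b1 l + σ ^ 2 * b2 l) * w σ l) 0 := by
      have h2 : AnalyticAt ℝ (fun σ => ∑ l, (σ * b1 l + σ ^ 2 * b2 l) * w σ l) 0 := by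
        refine Finset.analyticAt_fun_sum _ fun l _ => ?_
        have := hwa l
        fun_prop
      fun_prop
    exact this.congr (h.mono fun σ hσ => hσ.1.symm)
  refine ⟨hfa, ?_⟩
  have hf0 : f 0 = k := by
    have := h.self_of_nhds.1
    simpa using this
  have hid : (fun σ : ℝ => σ) =O[𝓝 0] (fun σ : ℝ => σ) := isBigO_refl _ _
  have hid2 : (fun σ : ℝ => σ ^ 2) =O[𝓝 0] (fun σ : ℝ => σ ^ 2) := isBigO_refl _ _
  have hwO : ∀ j, (fun σ => w σ j) =O[𝓝 0] (fun σ : ℝ => σ) := fun j => by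
    have := (hwa j).differentiableAt.isBigO_sub
    simpa [hw0] using this
  have hfO : (fun σ => f σ - k) =O[𝓝 0] (fun σ : ℝ => σ) := by
    have := hfa.differentiableAt.isBigO_sub
    simpa [hf0] using this
  have hw2 : ∀ j, (fun σ => w σ j - σ * (b1 j / k)) =O[𝓝 0] (fun σ : ℝ => σ ^ 2) := by
    intro j
    have e : (fun σ => w σ j - σ * (b1 j / k)) =ᶠ[𝓝 0]
        (fun σ => k⁻¹ * (b2 j * σ ^ 2 + σ * (∑ l, d j l * σ * w σ l) - (f σ - k) * w σ j)) := by
      filter_upwards [h] with σ hσ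
      have h2 := hσ.2 j
      have e2 : ∑ l, σ ^ 2 * d j l * w σ l = σ * ∑ l, d j l * σ * w σ l := by
        rw [Finset.mul_sum]; exact Finset.sum_congr rfl fun _ _ => by ring
      rw [e2] at h2
      generalize (∑ l, d j l * σ * w σ l) = T at h2 ⊢
      field_simp
      linarith
    refine e.trans_isBigO (IsBigO.const_mul_left ?_ _)
    refine (IsBigO.add (hid2.const_mul_left _) ?_).sub ?_
    · have h1 : (fun σ => ∑ l, d j l * σ * w σ l) =O[𝓝 0] (fun σ : ℝ => σ) := by
        refine IsBigO.fun_sum fun l _ => ?_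
        have c : (fun σ : ℝ => d j l * σ) =O[𝓝 0] (fun _ : ℝ => (1 : ℝ)) :=
          (Continuous.tendsto (by fun_prop) 0).isBigO_one ℝ
        simpa using c.mul (hwO l)
      simpa [sq] using hid.mul h1
    · simpa [sq] using hfO.mul (hwO j)
  have e : (fun σ => f σ - (k + a1 * σ + ((∑ j, b1 j ^ 2 / k) + a2) * σ ^ 2)) =ᶠ[𝓝 0]
      (fun σ => ∑ j, (b1 j * (σ * (w σ j - σ * (b1 j / k))) + b2 j * (σ ^ 2 * w σ j))) := by
    filter_upwards [h] with σ hσ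
    rw [hσ.1]
    have : ∑ j, (b1 j * (σ * (w σ j - σ * (b1 j / k))) + b2 j * (σ ^ 2 * w σ j))
      = ∑ l, (σ * b1 l + σ ^ 2 * b2 l) * w σ l - (∑ j, b1 j ^ 2 / k) * σ ^ 2 := by
      rw [Finset.sum_mul, ← Finset.sum_sub_distrib]
      exact Finset.sum_congr rfl fun _ _ => by ring
    rw [this]; ring
  refine e.trans_isBigO (IsBigO.fun_sum fun j _ => ?_)
  refine IsBigO.add (IsBigO.const_mul_left ?_ _) (IsBigO.const_mul_left ?_ _)
  · refine (hid.mul (hw2 j)).congr_right fun σ => by ring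
  · refine (hid2.mul (hwO j)).congr_right fun σ => by ring

/-- **Theorem 2.2 (eigenvalue part)**: for fixed `p, n` and fixed realizations
`u¹, …, uⁿ` and `ξ¹, …, ξⁿ`, there is `σ₀ > 0` such that the largest eigenvalue of the
sample covariance matrix `S_n(σ)` of the samples `x^ν(σ) = u^ν v + σ ξ^ν` is a
real-analytic function of `σ` on `(-σ₀, σ₀)`, with Taylor expansion
`λ_max(S_n(σ)) = κ² + 2κρ₁ σ + (∑_{j=2}^p ρ_j² + β₁₁) σ² + O(σ³)` as `σ → 0`. -/
theorem pca_top_eigenvalue_analytic_taylor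
    (n p : ℕ) (hn : 1 ≤ n) (hp : 2 ≤ p)
    (V : ℝ) (hV : 0 < V)
    (u : Fin n → ℝ) (ξ : Fin n → Fin p → ℝ)
    (su : ℝ) (hsu : su = Real.sqrt ((n : ℝ)⁻¹ * ∑ ν, (u ν) ^ 2)) (hsupos : 0 < su)
    (κ : ℝ) (hκ : κ = V * su)
    (ρ : Fin p → ℝ) (hρ : ∀ j, ρ j = (1 / (n * su)) * ∑ ν, u ν * ξ ν j)
    (β11 : ℝ) (hβ11 : β11 = (n : ℝ)⁻¹ * ∑ ν, (ξ ν ⟨0, by omega⟩) ^ 2) :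
    ∃ σ₀ > (0 : ℝ),
      AnalyticOnNhd ℝ
        (fun σ : ℝ => maxEig (sampleCov n p
          (fun ν i => u ν * (if (i : ℕ) = 0 then V else 0) + σ * ξ ν i)))
        (Set.Ioo (-σ₀) σ₀) ∧
      (fun σ : ℝ => maxEig (sampleCov n p
          (fun ν i => u ν * (if (i : ℕ) = 0 then V else 0) + σ * ξ ν i))
        - (κ ^ 2 + 2 * κ * ρ ⟨0, by omega⟩ * σ
            + ((∑ j ∈ Finset.univ \ {⟨0, by omega⟩}, (ρ j) ^ 2) + β11) * σ ^ 2))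
        =O[𝓝 0] (fun σ : ℝ => σ ^ 3) := by
  obtain ⟨q, rfl⟩ : ∃ q, p = q + 1 := ⟨p - 1, by omega⟩
  have hz : (⟨0, by omega⟩ : Fin (q + 1)) = 0 := rfl
  simp only [hz] at hβ11 ⊢
  have hn0 : (n : ℝ) ≠ 0 := by
    have : 0 < n := hn
    positivity
  have hκpos : 0 < κ := by rw [hκ]; positivity
  have hsq : su ^ 2 = (n : ℝ)⁻¹ * ∑ ν, (u ν) ^ 2 := by
    rw [hsu]
    exact Real.sq_sqrt (mul_nonneg (by positivity) (Finset.sum_nonneg fun _ _ => sq_nonneg _))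
  have hκρ : ∀ j, κ * ρ j = (n : ℝ)⁻¹ * (V * ∑ ν, u ν * ξ ν j) := by
    intro j
    rw [hκ, hρ]
    field_simp
  set M : ℝ → Matrix (Fin (q + 1)) (Fin (q + 1)) ℝ := fun σ => sampleCov n (q + 1)
          (fun ν i => u ν * (if (i : ℕ) = 0 then V else 0) + σ * ξ ν i) with hMdef
  have hMij : ∀ σ i j, M σ i j = (n : ℝ)⁻¹ * ∑ ν,
      (u ν * (if (i : ℕ) = 0 then V else 0) + σ * ξ ν i) *
      (u ν * (if (j : ℕ) = 0 then V else 0) + σ * ξ ν j) := by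
    intro σ i j
    simp [hMdef, sampleCov, Matrix.sum_apply, Matrix.vecMulVec_apply]
  have hM : ∀ σ, (M σ).IsHermitian := by
    intro σ
    ext i j
    simp only [Matrix.conjTranspose_apply, star_trivial, hMij]
    congr 1
    exact Finset.sum_congr rfl fun _ _ => by ring
  have h00 : ∀ σ, M σ 0 0 = κ ^ 2 + (2 * κ * ρ 0) * σ + β11 * σ ^ 2 := by
    intro σ
    have e : κ ^ 2 + (2 * κ * ρ 0) * σ + β11 * σ ^ 2
        = V ^ 2 * su ^ 2 + 2 * σ * (κ * ρ 0) + β11 * σ ^ 2 := by rw [hκ]; ring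
    rw [hMij, e, hsq, hκρ, hβ11]
    have : ∑ ν, (u ν * (if ((0 : Fin (q + 1)) : ℕ) = 0 then V else 0) + σ * ξ ν 0) *
      (u ν * (if ((0 : Fin (q + 1)) : ℕ) = 0 then V else 0) + σ * ξ ν 0)
      = V ^ 2 * ∑ ν, u ν ^ 2 + 2 * σ * (V * ∑ ν, u ν * ξ ν 0) + σ ^ 2 * ∑ ν, ξ ν 0 ^ 2 := by
      simp only [Finset.mul_sum, ← Finset.sum_add_distrib]
      refine Finset.sum_congr rfl fun ν _ => ?_
      simp
      ring
    rw [this]; ring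
  have h0s : ∀ σ (j : Fin q), M σ 0 j.succ =
      σ * (κ * ρ j.succ) + σ ^ 2 * ((n : ℝ)⁻¹ * ∑ ν, ξ ν 0 * ξ ν j.succ) := by
    intro σ j
    rw [hMij, hκρ]
    simp only [Finset.mul_sum, ← Finset.sum_add_distrib]
    refine Finset.sum_congr rfl fun ν _ => ?_
    simp
    ring
  have hs0 : ∀ σ (j : Fin q), M σ j.succ 0 =
      σ * (κ * ρ j.succ) + σ ^ 2 * ((n : ℝ)⁻¹ * ∑ ν, ξ ν 0 * ξ ν j.succ) := by
    intro σ j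
    rw [← h0s, ← (hM σ).apply]
    rfl
  have hss : ∀ σ (i j : Fin q), M σ i.succ j.succ =
      σ ^ 2 * ((n : ℝ)⁻¹ * ∑ ν, ξ ν i.succ * ξ ν j.succ) := by
    intro σ i j
    rw [hMij]
    simp only [Finset.mul_sum]
    refine Finset.sum_congr rfl fun ν _ => ?_
    simp
    ring
  obtain ⟨w, hw, hw0, hev⟩ := key (κ ^ 2) (by positivity) (2 * κ * ρ 0) β11
    (fun j => κ * ρ j.succ) (fun j => (n : ℝ)⁻¹ * ∑ ν, ξ ν 0 * ξ ν j.succ)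
    (fun i j => (n : ℝ)⁻¹ * ∑ ν, ξ ν i.succ * ξ ν j.succ) M hM h00 h0s hs0 hss
  obtain ⟨hA, hO⟩ := taylor (κ ^ 2) (by positivity) (2 * κ * ρ 0) β11
    (fun j => κ * ρ j.succ) (fun j => (n : ℝ)⁻¹ * ∑ ν, ξ ν 0 * ξ ν j.succ)
    (fun i j => (n : ℝ)⁻¹ * ∑ ν, ξ ν i.succ * ξ ν j.succ) (fun σ => maxEig (M σ)) w hw hw0 hev
  obtain ⟨ε, hε, hball⟩ := Metric.eventually_nhds_iff.1 hA.eventually_analyticAt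
  refine ⟨ε, hε, ?_, ?_⟩
  · intro σ hσ
    refine hball ?_
    rw [Real.dist_eq, sub_zero, abs_lt]
    exact hσ
  · have hsum : ∑ j ∈ Finset.univ \ {(0 : Fin (q + 1))}, (ρ j) ^ 2
        = ∑ j : Fin q, (κ * ρ j.succ) ^ 2 / κ ^ 2 := by
      have h1 : ∑ j ∈ Finset.univ \ {(0 : Fin (q + 1))}, (ρ j) ^ 2
          = ∑ j : Fin q, ρ j.succ ^ 2 := by
        have := Finset.sum_sdiff_eq_sub (f := fun j => ρ j ^ 2)
          (Finset.subset_univ {(0 : Fin (q + 1))})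
        rw [this, Fin.sum_univ_succ]
        simp
      rw [h1]
      refine Finset.sum_congr rfl fun j _ => ?_
      field_simp
    rw [hsum]
    exact hO
end

section
/- There exist σ₀ > 0 and a real-analytic map w : (−σ₀, σ₀) → ℝ^p such that for every σ ∈ (−σ₀, σ₀), w(σ) is an eigenvector of S_n(σ) for its largest eigenvalue, w(0) = e₁, and as σ → 0, w(σ) = e₁ + (σ/κ)·(0, ρ₂, …, ρ_p)ᵀ + O(σ²). -/
open MeasureTheory Filter Topology Asymptotics

open scoped ContDiff in
/-- Analytic perturbation of a simple eigenvector via the implicit function theorem. -/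
theorem eigvec_perturb {ι : Type*} [Fintype ι] [DecidableEq ι] (o : ι)
    (S : ℝ → Matrix ι ι ℝ) (hS : ∀ i j, ContDiff ℝ ω (fun σ => S σ i j))
    (c : ℝ) (hc : c ≠ 0) (hS0 : ∀ i j, S 0 i j = if i = o ∧ j = o then c else 0)
    (b : ι → ℝ) (hb : ∀ i, i ≠ o → HasDerivAt (fun σ => S σ i o) (b i) 0) :
    ∃ w : ℝ → ι → ℝ, AnalyticAt ℝ w 0 ∧ w 0 = (fun i => if i = o then 1 else 0) ∧
      HasDerivAt w (fun i => if i = o then 0 else b i / c) 0 ∧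
      ∀ᶠ σ in 𝓝 0, w σ o = 1 ∧ ∀ i, (S σ).mulVec (w σ) i = (S σ).mulVec (w σ) o * w σ i := by
  classical
  let e : ι → ℝ := fun i => if i = o then 1 else 0
  let f : ℝ × (ι → ℝ) → (ι → ℝ) := fun x i =>
    if i = o then x.2 o else (∑ k, S x.1 i k * x.2 k) - (∑ k, S x.1 o k * x.2 k) * x.2 i
  have hf : ContDiff ℝ ω f := by
    rw [contDiff_pi]
    intro i
    have h2 : ∀ k, ContDiff ℝ ω (fun x : ℝ × (ι → ℝ) => x.2 k) := fun k => by fun_prop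
    have h1 : ∀ i k, ContDiff ℝ ω (fun x : ℝ × (ι → ℝ) => S x.1 i k) :=
      fun i k => (hS i k).comp contDiff_fst
    by_cases hi : i = o
    · simp only [f, hi, if_true]; exact h2 o
    · simp only [f, hi, if_false]
      exact (ContDiff.sum fun k _ => (h1 i k).mul (h2 k)).sub
        ((ContDiff.sum fun k _ => (h1 o k).mul (h2 k)).mul (h2 i))
  have hfa : ContDiffAt ℝ ω f (0, e) := hf.contDiffAt
  have hn : (ω : WithTop ℕ∞) ≠ 0 := by simp
  have hfd : HasFDerivAt f (fderiv ℝ f (0, e)) (0, e) :=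
    (hfa.differentiableAt hn).hasFDerivAt
  -- the derivative along a line
  have hval : ∀ (τ : ℝ) (h : ι → ℝ) (i : ι),
      fderiv ℝ f (0, e) (τ, h) i = if i = o then h o else τ * b i - c * h i := by
    intro τ h i
    have hl : HasDerivAt (fun t : ℝ => ((t * τ, fun k => e k + t * h k) : ℝ × (ι → ℝ)))
        (τ, h) 0 := by
      refine HasDerivAt.prodMk ?_ ?_
      · simpa using (hasDerivAt_id (0:ℝ)).mul_const τ
      · rw [hasDerivAt_pi]
        intro k
        simpa using ((hasDerivAt_id (0:ℝ)).mul_const (h k)).const_add (e k)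
    have h0 : ((fun t : ℝ => ((t * τ, fun k => e k + t * h k) : ℝ × (ι → ℝ))) 0) = (0, e) := by
      simp
    have hA : HasDerivAt (fun t : ℝ => f (t * τ, fun k => e k + t * h k))
        (fderiv ℝ f (0, e) (τ, h)) 0 := by
      have := (h0.symm ▸ hfd : HasFDerivAt f (fderiv ℝ f (0, e)) _).comp_hasDerivAt (0:ℝ) hl
      exact this
    have hAi := (hasDerivAt_pi.1 hA) i
    refine hAi.unique ?_
    have he : ∀ k, HasDerivAt (fun t : ℝ => e k + t * h k) (h k) 0 := fun k => by
      simpa using ((hasDerivAt_id (0:ℝ)).mul_const (h k)).const_add (e k)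
    by_cases hi : i = o
    · simp only [f, hi, if_true]; exact he o
    · simp only [f, hi, if_false]
      have hSd : ∀ i k, HasDerivAt (fun t : ℝ => S (t * τ) i k)
          (deriv (fun σ => S σ i k) 0 * τ) 0 := by
        intro i k
        have h1 : HasDerivAt (fun σ => S σ i k) (deriv (fun σ => S σ i k) 0) ((0:ℝ) * τ) := by
          rw [zero_mul]
          exact ((hS i k).differentiable hn).differentiableAt.hasDerivAt
        have h2 : HasDerivAt (fun t : ℝ => t * τ) τ 0 := by
          simpa using (hasDerivAt_id (0:ℝ)).mul_const τ
        exact h1.comp (0:ℝ) h2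
      have hsum : ∀ i, HasDerivAt (fun t : ℝ => ∑ k, S (t * τ) i k * (e k + t * h k))
          (∑ k, (deriv (fun σ => S σ i k) 0 * τ * e k + S 0 i k * h k)) 0 := by
        intro i
        refine HasDerivAt.fun_sum fun k _ => ?_
        have := (hSd i k).mul (he k)
        simp only [zero_mul, add_zero] at this
        exact this
      have := (hsum i).sub ((hsum o).mul (he i))
      refine this.congr_deriv ?_
      simp [hS0, e, hi, Finset.sum_add_distrib, (hb i hi).deriv]
      ring
  have hinv : (fderiv ℝ f (0, e) ∘L .inr ℝ ℝ (ι → ℝ)).IsInvertible := by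
    set D := fderiv ℝ f (0, e) ∘L .inr ℝ ℝ (ι → ℝ) with hD
    have hDv : ∀ h i, D h i = if i = o then h o else - (c * h i) := by
      intro h i
      have := hval 0 h i
      simpa [hD] using this
    have hinj : Function.Injective (D : (ι → ℝ) →ₗ[ℝ] (ι → ℝ)) := by
      rw [← LinearMap.ker_eq_bot, LinearMap.ker_eq_bot']
      intro h hh
      funext i
      have h1 := congrFun hh i
      have h2 := hDv h i
      simp only [ContinuousLinearMap.coe_coe] at h1
      rw [h1] at h2
      by_cases hi : i = o
      · subst hi; simpa using h2.symm
      · simpa [hi, hc] using h2.symm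
    refine ⟨(LinearEquiv.ofInjectiveEndo _ hinj).toContinuousLinearEquiv, ?_⟩
    ext h i
    rfl
  refine ⟨hfa.implicitFunction hn hinv, ?_, ?_, ?_, ?_⟩
  · exact (hfa.contDiffAt_implicitFunction hn hinv).analyticAt
  · exact hfa.implicitFunction_apply_self hn hinv
  · have h1 := (hfa.contDiffAt_implicitFunction hn hinv).differentiableAt hn
    have h0 := hfa.implicitFunction_apply_self hn hinv
    have hev := hfa.eventually_apply_implicitFunction hn hinv
    generalize hfa.implicitFunction hn hinv = w at h1 h0 hev
    simp only at h1 h0 hev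
    have hw := h1.hasDerivAt
    generalize deriv w 0 = w' at hw
    have hcomp : HasDerivAt (fun σ => f (σ, w σ)) (fderiv ℝ f (0, e) (1, w')) 0 := by
      have hl : HasDerivAt (fun σ => (σ, w σ)) (1, w') (0:ℝ) := (hasDerivAt_id (0:ℝ)).prodMk hw
      have h2 : HasFDerivAt f (fderiv ℝ f (0, e)) ((fun σ => (σ, w σ)) (0:ℝ)) := by
        simpa only [h0] using hfd
      exact h2.comp_hasDerivAt (0:ℝ) hl
    have hz : fderiv ℝ f (0, e) (1, w') = 0 :=
      hcomp.unique ((hasDerivAt_const (0:ℝ) (f (0, e))).congr_of_eventuallyEq hev)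
    refine hw.congr_deriv ?_
    funext i
    have := hval 1 w' i
    rw [hz] at this
    by_cases hi : i = o
    · subst hi; simpa using this.symm
    · simp only [hi, if_false, Pi.zero_apply, one_mul] at this ⊢
      field_simp
      linarith
  · have hev := hfa.eventually_apply_implicitFunction hn hinv
    filter_upwards [hev] with σ hσ
    have ho : hfa.implicitFunction hn hinv σ o = 1 := by
      have := congrFun hσ o
      simpa [f, e] using this
    refine ⟨ho, fun i => ?_⟩
    by_cases hi : i = o
    · subst hi; rw [ho, mul_one]
    · have := congrFun hσ i
      simp [f, e, hi, hS0] at this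
      simp only [Matrix.mulVec, dotProduct]
      linarith

/-- An eigenvalue of a positive semidefinite matrix exceeding half the trace is the largest. -/
theorem maxEig_eq_of_trace {m : ℕ} (M : Matrix (Fin m) (Fin m) ℝ) (hM : M.PosSemidef)
    (w : Fin m → ℝ) (hw : w ≠ 0) (l : ℝ) (h : M.mulVec w = l • w) (hl : M.trace < 2 * l) :
    maxEig M = l := by
  have hs := hM.1.spectrum_real_eq_range_eigenvalues
  have hmem : l ∈ spectrum ℝ M := by
    rw [← Matrix.spectrum_toLin']
    refine Module.End.HasEigenvalue.mem_spectrum ?_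
    exact Module.End.hasEigenvalue_of_hasEigenvector
      ⟨Module.End.mem_eigenspace_iff.2 (by simpa using h), hw⟩
  refine IsGreatest.csSup_eq ⟨hmem, ?_⟩
  rw [hs] at hmem
  obtain ⟨j, hj⟩ := hmem
  rintro x hx
  rw [hs] at hx
  obtain ⟨i, rfl⟩ := hx
  by_cases hij : i = j
  · subst hij; exact hj.le
  have ht : M.trace = ∑ i, hM.1.eigenvalues i := by
    simpa using hM.1.trace_eq_sum_eigenvalues
  have h2 : hM.1.eigenvalues i + hM.1.eigenvalues j ≤ ∑ i, hM.1.eigenvalues i := by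
    rw [← Finset.sum_pair hij]
    exact Finset.sum_le_univ_sum_of_nonneg (fun k => hM.eigenvalues_nonneg k)
  linarith

theorem analytic_taylor_two {E : Type*} [NormedAddCommGroup E] [NormedSpace ℝ E]
    (w : ℝ → E) (w' : E) (hw : AnalyticAt ℝ w 0) (hd : HasDerivAt w w' 0) :
    (fun σ : ℝ => w σ - (w 0 + σ • w')) =O[𝓝 0] (fun σ : ℝ => σ ^ 2) := by
  obtain ⟨q, hq⟩ := hw
  have h1 : q 1 (fun _ => 1) = w' := hq.hasDerivAt.unique hd
  have h0 : q 0 (fun _ => 0) = w 0 := hq.coeff_zero _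
  have := hq.isBigO_sub_partialSum_pow 2
  have h3 : ∀ y : ℝ, q.partialSum 2 y = w 0 + y • w' := by
    intro y
    rw [FormalMultilinearSeries.partialSum]
    rw [Finset.sum_range_succ, Finset.sum_range_one, hq.coeff_zero, ← h1]
    congr 1
    have := (q 1).map_smul_univ (fun _ => y) (fun _ => 1)
    simpa using this
  simp only [zero_add, h3] at this
  refine this.trans (IsBigO.of_bound 1 (Eventually.of_forall fun y => ?_))
  simp

theorem sampleCov_posSemidef (n p : ℕ) (x : Fin n → Fin p → ℝ) :
    (sampleCov n p x).PosSemidef := by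
  unfold sampleCov
  refine Matrix.PosSemidef.smul (Matrix.posSemidef_sum _ fun ν _ => ?_) (by positivity)
  simpa using Matrix.posSemidef_vecMulVec_self_star (x ν)

theorem sampleCov_apply (n p : ℕ) (x : Fin n → Fin p → ℝ) (i j : Fin p) :
    sampleCov n p x i j = (n : ℝ)⁻¹ * ∑ ν, x ν i * x ν j := by
  simp [sampleCov, Matrix.sum_apply, Matrix.vecMulVec_apply]

/-- **Theorem 2.2 (eigenvector part)**: for fixed `p, n` and fixed realizations
`u¹, …, uⁿ` and `ξ¹, …, ξⁿ`, there are `σ₀ > 0` and a real-analytic map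
`w : (-σ₀, σ₀) → ℝ^p` such that for every `σ ∈ (-σ₀, σ₀)`, `w σ` is an eigenvector of
the sample covariance matrix `S_n(σ)` for its largest eigenvalue, `w 0 = e₁`, and
`w σ = e₁ + (σ/κ)(0, ρ₂, …, ρ_p)ᵀ + O(σ²)` as `σ → 0`. -/
theorem pca_top_eigenvector_analytic_taylor
    (n p : ℕ) (hn : 1 ≤ n) (hp : 2 ≤ p)
    (V : ℝ) (hV : 0 < V)
    (u : Fin n → ℝ) (ξ : Fin n → Fin p → ℝ)
    (su : ℝ) (hsu : su = Real.sqrt ((n : ℝ)⁻¹ * ∑ ν, (u ν) ^ 2)) (hsupos : 0 < su)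
    (κ : ℝ) (hκ : κ = V * su)
    (ρ : Fin p → ℝ) (hρ : ∀ j, ρ j = (1 / (n * su)) * ∑ ν, u ν * ξ ν j) :
    ∃ σ₀ > (0 : ℝ), ∃ w : ℝ → (Fin p → ℝ),
      AnalyticOnNhd ℝ w (Set.Ioo (-σ₀) σ₀) ∧
      (∀ σ ∈ Set.Ioo (-σ₀) σ₀, w σ ≠ 0 ∧
        Matrix.mulVec (sampleCov n p
            (fun ν i => u ν * (if (i : ℕ) = 0 then V else 0) + σ * ξ ν i)) (w σ)
          = maxEig (sampleCov n p
              (fun ν i => u ν * (if (i : ℕ) = 0 then V else 0) + σ * ξ ν i)) • w σ) ∧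
      w 0 = (fun i : Fin p => if (i : ℕ) = 0 then (1 : ℝ) else 0) ∧
      (fun σ : ℝ => w σ - ((fun i : Fin p => if (i : ℕ) = 0 then (1 : ℝ) else 0)
          + (σ / κ) • (fun i : Fin p => if (i : ℕ) = 0 then (0 : ℝ) else ρ i)))
        =O[𝓝 0] (fun σ : ℝ => σ ^ 2) := by
  obtain ⟨m, rfl⟩ : ∃ m, p = m + 1 := ⟨p - 1, by omega⟩
  have hn0 : (0:ℝ) < n := by exact_mod_cast hn
  have hκpos : 0 < κ := by rw [hκ]; positivity
  have hsu2 : su ^ 2 = (n : ℝ)⁻¹ * ∑ ν, (u ν) ^ 2 := by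
    rw [hsu, Real.sq_sqrt]; positivity
  simp only [Fin.val_eq_zero_iff]
  set S : ℝ → Matrix (Fin (m+1)) (Fin (m+1)) ℝ := fun σ => sampleCov n (m+1)
    (fun ν i => u ν * (if i = 0 then V else 0) + σ * ξ ν i) with hSdef
  have hSap : ∀ σ i j, S σ i j = (n : ℝ)⁻¹ * ∑ ν,
      (u ν * (if i = 0 then V else 0) + σ * ξ ν i) *
      (u ν * (if j = 0 then V else 0) + σ * ξ ν j) := fun σ i j => sampleCov_apply _ _ _ i j
  have hScd : ∀ i j, ContDiff ℝ ⊤ (fun σ => S σ i j) := by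
    intro i j
    simp only [hSap]
    fun_prop
  have hS0 : ∀ i j, S 0 i j = if i = 0 ∧ j = 0 then κ ^ 2 else 0 := by
    intro i j
    rw [hSap]
    by_cases hi : i = 0 <;> by_cases hj : j = 0 <;> simp [hi, hj]
    rw [hκ, mul_pow, hsu2, Finset.mul_sum, Finset.mul_sum, Finset.mul_sum]
    exact Finset.sum_congr rfl fun ν _ => by ring
  have hb : ∀ i, i ≠ 0 → HasDerivAt (fun σ => S σ i 0) (κ * ρ i) 0 := by
    intro i hi
    simp only [hSap, hi, if_false, if_true, mul_zero, zero_add]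
    have h1 : HasDerivAt (fun σ : ℝ => (n : ℝ)⁻¹ * ∑ ν, (σ * ξ ν i) * (u ν * V + σ * ξ ν 0))
        ((n : ℝ)⁻¹ * ∑ ν, (ξ ν i) * (u ν * V)) 0 := by
      refine HasDerivAt.const_mul _ (HasDerivAt.fun_sum fun ν _ => ?_)
      have ha : ∀ k, HasDerivAt (fun σ : ℝ => σ * ξ ν k) (ξ ν k) 0 := fun k => by
        simpa using (hasDerivAt_id (0:ℝ)).mul_const (ξ ν k)
      have := (ha i).mul ((ha 0).const_add (u ν * V))
      simp only [zero_mul, add_zero] at this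
      exact this
    refine h1.congr_deriv ?_
    rw [hρ, hκ]
    have : ∑ ν, ξ ν i * (u ν * V) = V * ∑ ν, u ν * ξ ν i := by
      rw [Finset.mul_sum]; exact Finset.sum_congr rfl fun ν _ => by ring
    rw [this]
    field_simp
  obtain ⟨w, hwa, hw0, hwd, hev⟩ := eigvec_perturb (0 : Fin (m+1)) S hScd (κ ^ 2)
    (by positivity) hS0 (fun i => κ * ρ i) hb
  have hScont : ∀ i j, Continuous (fun σ => S σ i j) := fun i j => (hScd i j).continuous
  have hlt : ∀ᶠ σ in 𝓝 (0:ℝ), (S σ).trace < 2 * (S σ).mulVec (w σ) 0 := by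
    have hwc : ∀ k, ContinuousAt (fun σ => w σ k) 0 := fun k =>
      (continuous_apply k).continuousAt.comp hwa.continuousAt
    have hc1 : ContinuousAt (fun σ => (S σ).trace) 0 := by
      simp only [Matrix.trace, Matrix.diag]
      exact (continuous_finsetSum _ fun i _ => hScont i i).continuousAt
    have hc2 : ContinuousAt (fun σ => 2 * (S σ).mulVec (w σ) 0) 0 := by
      simp only [Matrix.mulVec, dotProduct]
      refine continuousAt_const.mul ?_
      exact tendsto_finsetSum _ fun k _ => ((hScont 0 k).continuousAt.mul (hwc k))
    refine hc1.eventually_lt hc2 ?_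
    have : 0 < κ ^ 2 := by positivity
    simp [Matrix.trace, Matrix.mulVec, dotProduct, hS0, hw0]
    linarith
  have hall := hev.and (hlt.and hwa.eventually_analyticAt)
  obtain ⟨r, hr, hball⟩ := Metric.eventually_nhds_iff_ball.1 hall
  have hmem : ∀ σ ∈ Set.Ioo (-r) r, σ ∈ Metric.ball (0:ℝ) r := by
    intro σ hσ
    simpa [abs_lt] using hσ
  refine ⟨r, hr, w, fun σ hσ => (hball σ (hmem σ hσ)).2.2, ?_, hw0, ?_⟩
  · intro σ hσ
    obtain ⟨⟨h1, h2⟩, h3, -⟩ := hball σ (hmem σ hσ)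
    have hne : w σ ≠ 0 := fun h => by simp [h] at h1
    have heq : (S σ).mulVec (w σ) = (S σ).mulVec (w σ) 0 • w σ := by
      funext i; simpa using h2 i
    refine ⟨hne, ?_⟩
    change (S σ).mulVec (w σ) = maxEig (S σ) • w σ
    rw [maxEig_eq_of_trace (S σ) (sampleCov_posSemidef _ _ _) (w σ) hne _ heq h3]
    exact heq
  · have := analytic_taylor_two w _ hwa hwd
    rw [hw0] at this
    refine this.congr_left fun σ => ?_
    congr 2
    funext i
    by_cases hi : i = 0
    · simp [hi]
    · simp [hi]; field_simp
end

section
/- Let A and B be p × p Hermitian matrices. Let λ₁ > λ₂ ≥ … ≥ λ_p be the eigenvalues of A (so λ₁ has multiplicity one), let v₁ be a unit eigenvector of A for λ₁, and let P₁ denote the orthogonal projection onto the orthogonal complement of v₁, i.e. P₁x = x − ⟨x, v₁⟩v₁. If the spectral norm satisfies ‖B‖ < λ₁ + ⟨v₁, B v₁⟩ − λ₂, then the largest eigenvalue of A + B satisfies ⟨v₁, B v₁⟩ ≤ λ₁(A + B) − λ₁ ≤ ⟨v₁, B v₁⟩ + ‖P₁ B v₁‖. -/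
open Matrix

/-- The Euclidean (`L²`) norm of a complex vector. -/
noncomputable def cNorm {p : ℕ} (w : Fin p → ℂ) : ℝ :=
  Real.sqrt (∑ i, Complex.normSq (w i))


theorem aux_dot_self {p : ℕ} (w : Fin p → ℂ) :
    star w ⬝ᵥ w = ((∑ i, Complex.normSq (w i) : ℝ) : ℂ) := by
  simp [dotProduct, Complex.normSq_eq_conj_mul_self]

theorem aux_star_dot {p : ℕ} (x y : Fin p → ℂ) : star x ⬝ᵥ y = star (star y ⬝ᵥ x) := by
  rw [star_dotProduct]

theorem aux_herm {p : ℕ} {M : Matrix (Fin p) (Fin p) ℂ} (hM : M.IsHermitian)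
    (x y : Fin p → ℂ) : star x ⬝ᵥ M *ᵥ y = star (M *ᵥ x) ⬝ᵥ y := by
  rw [star_mulVec, hM.eq, dotProduct_mulVec]

theorem aux_cs {p : ℕ} (x y : Fin p → ℂ) : ‖star x ⬝ᵥ y‖ ≤ cNorm x * cNorm y := by
  unfold cNorm dotProduct
  refine (norm_sum_le _ _).trans ?_
  have := Real.sum_mul_le_sqrt_mul_sqrt Finset.univ (fun i => ‖x i‖) (fun i => ‖y i‖)
  simpa [Complex.normSq_eq_norm_sq] using this

theorem aux_spec {p : ℕ} {M : Matrix (Fin p) (Fin p) ℂ} (hM : M.IsHermitian) :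
    ∃ U : Matrix (Fin p) (Fin p) ℂ, Uᴴ * U = 1 ∧ U * Uᴴ = 1 ∧
      M = U * diagonal (fun i => (hM.eigenvalues i : ℂ)) * Uᴴ := by
  refine ⟨hM.eigenvectorUnitary, ?_, ?_, ?_⟩
  · exact Unitary.coe_star_mul_self hM.eigenvectorUnitary
  · exact Unitary.coe_mul_star_self hM.eigenvectorUnitary
  · exact hM.spectral_theorem

theorem aux_dot_unit {p : ℕ} {U : Matrix (Fin p) (Fin p) ℂ} (hU : U * Uᴴ = 1)
    (x y : Fin p → ℂ) : star (Uᴴ *ᵥ x) ⬝ᵥ (Uᴴ *ᵥ y) = star x ⬝ᵥ y := by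
  rw [star_mulVec, conjTranspose_conjTranspose, ← dotProduct_mulVec, mulVec_mulVec, hU, one_mulVec]

theorem aux_quad {p : ℕ} (d : Fin p → ℝ) {U : Matrix (Fin p) (Fin p) ℂ}
    (x : Fin p → ℂ) :
    (star x ⬝ᵥ (U * diagonal (fun i => (d i : ℂ)) * Uᴴ) *ᵥ x).re
      = ∑ i, d i * Complex.normSq ((Uᴴ *ᵥ x) i) := by
  have : star x ⬝ᵥ (U * diagonal (fun i => (d i : ℂ)) * Uᴴ) *ᵥ x
      = star (Uᴴ *ᵥ x) ⬝ᵥ (diagonal (fun i => (d i : ℂ)) *ᵥ (Uᴴ *ᵥ x)) := by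
    rw [star_mulVec, conjTranspose_conjTranspose, ← dotProduct_mulVec, mulVec_mulVec,
      mulVec_mulVec, Matrix.mul_assoc]
  rw [this]
  simp only [dotProduct, mulVec_diagonal, Complex.re_sum, Pi.star_apply]
  refine Finset.sum_congr rfl fun i _ => ?_
  simp [Complex.normSq_apply]
  ring

theorem aux_norm_unit {p : ℕ} {U : Matrix (Fin p) (Fin p) ℂ} (hU : U * Uᴴ = 1)
    (x : Fin p → ℂ) :
    ∑ i, Complex.normSq ((Uᴴ *ᵥ x) i) = ∑ i, Complex.normSq (x i) := by
  have := aux_dot_unit hU x x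
  rw [aux_dot_self, aux_dot_self] at this
  exact_mod_cast this

theorem aux_rayleigh {p : ℕ} {M : Matrix (Fin p) (Fin p) ℂ} (hM : M.IsHermitian) (c : ℝ)
    (hc : ∀ i, hM.eigenvalues i ≤ c) (x : Fin p → ℂ) :
    (star x ⬝ᵥ M *ᵥ x).re ≤ c * ∑ i, Complex.normSq (x i) := by
  obtain ⟨U, -, h2, h3⟩ := aux_spec hM
  have h := aux_quad hM.eigenvalues (U := U) x
  rw [← h3] at h
  rw [h, ← aux_norm_unit h2, Finset.mul_sum]
  exact Finset.sum_le_sum fun i _ => mul_le_mul_of_nonneg_right (hc i) (Complex.normSq_nonneg _)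

theorem aux_rayleigh_perp {p : ℕ} {M : Matrix (Fin p) (Fin p) ℂ} (hM : M.IsHermitian) (c l : ℝ)
    (k : Fin p) (hc : ∀ i, i ≠ k → hM.eigenvalues i ≤ c) (hcl : c < l) (v : Fin p → ℂ)
    (hv : M *ᵥ v = (l : ℂ) • v) (hv1 : ∑ i, Complex.normSq (v i) = 1) (x : Fin p → ℂ)
    (hx : star v ⬝ᵥ x = 0) :
    (star x ⬝ᵥ M *ᵥ x).re ≤ c * ∑ i, Complex.normSq (x i) := by
  obtain ⟨U, h1, h2, h3⟩ := aux_spec hM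
  have hz : ∀ i, i ≠ k → (Uᴴ *ᵥ v) i = 0 := by
    intro i hi
    have e : diagonal (fun i => (hM.eigenvalues i : ℂ)) *ᵥ (Uᴴ *ᵥ v) = (l : ℂ) • (Uᴴ *ᵥ v) := by
      rw [← mulVec_smul, ← hv]
      conv_rhs => rw [h3]
      rw [mulVec_mulVec, mulVec_mulVec, Matrix.mul_assoc, ← Matrix.mul_assoc Uᴴ, h1,
        Matrix.one_mul]
    have e' := congrFun e i
    rw [mulVec_diagonal, Pi.smul_apply, smul_eq_mul] at e'
    have hne : (hM.eigenvalues i : ℂ) ≠ l := by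
      have := hc i hi
      exact_mod_cast (by linarith : hM.eigenvalues i < l).ne
    by_contra h0
    exact hne (mul_right_cancel₀ h0 e')
  have hk : (Uᴴ *ᵥ v) k ≠ 0 := by
    intro h0
    have := aux_norm_unit h2 v
    rw [hv1, Finset.sum_eq_zero] at this
    · norm_num at this
    · intro i _
      by_cases hi : i = k
      · rw [hi, h0, map_zero]
      · rw [hz i hi, map_zero]
  have hxk : (Uᴴ *ᵥ x) k = 0 := by
    have := aux_dot_unit h2 v x
    rw [hx, dotProduct, Finset.sum_eq_single k] at this
    · simpa [hk] using this
    · intro i _ hi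
      simp [hz i hi]
    · simp
  have h := aux_quad hM.eigenvalues (U := U) x
  rw [← h3] at h
  rw [h, ← aux_norm_unit h2, Finset.mul_sum]
  refine Finset.sum_le_sum fun i _ => ?_
  by_cases hi : i = k
  · rw [hi, hxk]; simp
  · exact mul_le_mul_of_nonneg_right (hc i hi) (Complex.normSq_nonneg _)

theorem aux_top {p : ℕ} {M : Matrix (Fin p) (Fin p) ℂ} (hM : M.IsHermitian) (c : ℝ)
    (hc : ∀ x : Fin p → ℂ, (star x ⬝ᵥ M *ᵥ x).re ≤ c * ∑ i, Complex.normSq (x i)) (i : Fin p) :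
    hM.eigenvalues i ≤ c := by
  have h1 : ∑ j, Complex.normSq ((hM.eigenvectorBasis i) j) = 1 := by
    have := hM.eigenvectorBasis.norm_eq_one i
    rw [EuclideanSpace.norm_eq, Real.sqrt_eq_one] at this
    simpa [Complex.normSq_eq_norm_sq] using this
  have h2 := hc (hM.eigenvectorBasis i)
  rw [hM.mulVec_eigenvectorBasis, h1, dotProduct_smul, aux_dot_self, h1] at h2
  simpa using h2

/-- **Lemma 1**: let `A, B` be `p × p` Hermitian matrices, let
`λ₁ > λ₂ ≥ … ≥ λ_p` be the eigenvalues of `A` (so the largest one is simple) with `v₁` a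
unit eigenvector for `λ₁`, and let `P₁` be the orthogonal projection onto the orthogonal
complement of `v₁`. If `‖B‖ < λ₁ + ⟨v₁, B v₁⟩ - λ₂` (spectral norm), then the largest
eigenvalue of `A + B` satisfies
`⟨v₁, B v₁⟩ ≤ λ₁(A + B) - λ₁ ≤ ⟨v₁, B v₁⟩ + ‖P₁ B v₁‖`. -/
theorem top_eigenvalue_perturbation_bounds
    (p : ℕ) (hp : 2 ≤ p)
    (A B : Matrix (Fin p) (Fin p) ℂ)
    (hA : A.IsHermitian) (hB : B.IsHermitian)
    (lam : Fin p → ℝ) (hanti : Antitone lam)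
    (hgap : lam ⟨1, by omega⟩ < lam ⟨0, by omega⟩)
    (henum : ∃ e : Equiv.Perm (Fin p), ∀ i, lam i = hA.eigenvalues (e i))
    (v₁ : Fin p → ℂ)
    (hv₁ : A.mulVec v₁ = ((lam ⟨0, by omega⟩ : ℝ) : ℂ) • v₁)
    (hv₁norm : cNorm v₁ = 1)
    (hBnorm : (⨆ i, |hB.eigenvalues i|)
      < lam ⟨0, by omega⟩ + (star v₁ ⬝ᵥ B.mulVec v₁).re - lam ⟨1, by omega⟩) :
    (star v₁ ⬝ᵥ B.mulVec v₁).re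
      ≤ (⨆ i, (hA.add hB).eigenvalues i) - lam ⟨0, by omega⟩ ∧
    (⨆ i, (hA.add hB).eigenvalues i) - lam ⟨0, by omega⟩
      ≤ (star v₁ ⬝ᵥ B.mulVec v₁).re
        + cNorm (B.mulVec v₁ - (star v₁ ⬝ᵥ B.mulVec v₁) • v₁) := by
  obtain ⟨e, he⟩ := henum
  have h0 : (0 : ℕ) < p := by omega
  have : Nonempty (Fin p) := ⟨⟨0, h0⟩⟩
  set l1 := lam ⟨0, by omega⟩ with hl1
  set l2 := lam ⟨1, by omega⟩ with hl2
  have hN : ∑ i, Complex.normSq (v₁ i) = 1 := by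
    unfold cNorm at hv₁norm
    rwa [Real.sqrt_eq_one] at hv₁norm
  have hvv : star v₁ ⬝ᵥ v₁ = 1 := by rw [aux_dot_self, hN]; simp
  have hbim : star (star v₁ ⬝ᵥ B *ᵥ v₁) = star v₁ ⬝ᵥ B *ᵥ v₁ := by
    conv_rhs => rw [aux_herm hB, aux_star_dot]
  set bc := star v₁ ⬝ᵥ B *ᵥ v₁ with hbc
  set r := B *ᵥ v₁ - bc • v₁ with hr
  have hAv : (star v₁ ⬝ᵥ (A + B) *ᵥ v₁) = l1 + bc := by
    rw [add_mulVec, dotProduct_add, hv₁, dotProduct_smul, hvv]; simp [hbc]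
  constructor
  · have := aux_rayleigh (hA.add hB) _
      (fun i => le_ciSup (Set.finite_range _).bddAbove i) v₁
    rw [hAv, hN] at this
    simp at this
    linarith
  · rw [sub_le_iff_le_add]
    refine ciSup_le (aux_top (hA.add hB) _ fun x => ?_)
    set a := star v₁ ⬝ᵥ x with ha
    obtain ⟨w, hw⟩ : ∃ w, w = x - a • v₁ := ⟨_, rfl⟩
    have hx : x = a • v₁ + w := by rw [hw]; abel
    have hvw : star v₁ ⬝ᵥ w = 0 := by
      rw [hw, dotProduct_sub, dotProduct_smul, hvv, ← ha]; simp
    have hwv : star w ⬝ᵥ v₁ = 0 := by rw [aux_star_dot, hvw, star_zero]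
    clear_value a
    have hNx : ∑ i, Complex.normSq (x i) = Complex.normSq a + ∑ i, Complex.normSq (w i) := by
      have : star x ⬝ᵥ x = Complex.normSq a + ((∑ i, Complex.normSq (w i) : ℝ) : ℂ) := by
        rw [← aux_dot_self, hx, star_add, star_smul]
        simp only [add_dotProduct, dotProduct_add, smul_dotProduct, dotProduct_smul, hvv, hvw, hwv,
          Complex.normSq_eq_conj_mul_self]
        simp
        try ring
      rw [aux_dot_self] at this
      exact_mod_cast this
    have hC : star v₁ ⬝ᵥ (A + B) *ᵥ w = star r ⬝ᵥ w := by
      rw [aux_herm (hA.add hB), add_mulVec, hv₁, hr]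
      simp [star_add, star_sub, star_smul, add_dotProduct, sub_dotProduct, smul_dotProduct, hvw]
    have hC' : star w ⬝ᵥ (A + B) *ᵥ v₁ = star (star r ⬝ᵥ w) := by
      rw [← hC, aux_herm (hA.add hB), aux_star_dot]
    have hWA : (star w ⬝ᵥ A *ᵥ w).re ≤ l2 * ∑ i, Complex.normSq (w i) := by
      refine aux_rayleigh_perp hA l2 l1 (e ⟨0, h0⟩) ?_ hgap v₁ hv₁ hN w hvw
      intro i hi
      have := he (e.symm i)
      rw [Equiv.apply_symm_apply] at this
      rw [← this]
      apply hanti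
      rw [Fin.le_def]
      have : e.symm i ≠ ⟨0, h0⟩ := fun h => hi (by rw [← h, Equiv.apply_symm_apply])
      rw [Ne, Fin.ext_iff] at this
      simp at this ⊢
      omega
    have hWB := aux_rayleigh hB (⨆ i, |hB.eigenvalues i|) (fun i => (le_abs_self _).trans
      (le_ciSup (f := fun i => |hB.eigenvalues i|) (Set.finite_range _).bddAbove i)) w
    have hcs := aux_cs r w
    have hq : (star x ⬝ᵥ (A + B) *ᵥ x).re = Complex.normSq a * (l1 + bc.re)
        + 2 * (star a * (star r ⬝ᵥ w)).re + ((star w ⬝ᵥ A *ᵥ w).re + (star w ⬝ᵥ B *ᵥ w).re) := by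
      have : star x ⬝ᵥ (A + B) *ᵥ x = Complex.normSq a * (l1 + bc)
          + (star a * (star r ⬝ᵥ w) + star (star a * (star r ⬝ᵥ w)))
          + (star w ⬝ᵥ A *ᵥ w + star w ⬝ᵥ B *ᵥ w) := by
        rw [hx, star_add, star_smul, mulVec_add, mulVec_smul]
        simp only [add_dotProduct, dotProduct_add, smul_dotProduct, dotProduct_smul, hAv, hC, hC',
          Complex.normSq_eq_conj_mul_self, smul_eq_mul, star_mul', star_star]
        rw [add_mulVec, dotProduct_add]
        simp only [Complex.star_def]
        ring
      rw [this]
      simp only [Complex.add_re, Complex.star_def, Complex.conj_re, Complex.re_ofReal_mul,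
        Complex.ofReal_re]
      ring
    have hcross : (star a * (star r ⬝ᵥ w)).re ≤ ‖a‖ * (cNorm r * cNorm w) := by
      refine (Complex.re_le_norm _).trans ?_
      rw [norm_mul, norm_star]
      exact mul_le_mul_of_nonneg_left hcs (norm_nonneg _)
    have hNw : ∑ i, Complex.normSq (w i) = cNorm w ^ 2 := by
      unfold cNorm
      rw [Real.sq_sqrt (Finset.sum_nonneg fun i _ => Complex.normSq_nonneg _)]
    have hr0 : 0 ≤ cNorm r := Real.sqrt_nonneg _
    rw [hq, hNx, hNw]
    rw [hNw] at hWA hWB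
    rw [Complex.normSq_eq_norm_sq]
    have k1 := mul_le_mul_of_nonneg_right hBnorm.le (sq_nonneg (cNorm w))
    have k2 := mul_nonneg hr0 (sq_nonneg (‖a‖ - cNorm w))
    nlinarith
end

section
/- Let n ≤ p and let X be an n × p random matrix whose np entries are i.i.d. N(0,1) random variables. Let W = (1/n)·XᵀX. Then the probability that the spectral norm of W exceeds (1 + √(p/n))² + p/n is at most exp(−p/(2(√5 + 2)²)). -/
open MeasureTheory ProbabilityTheory Matrix

/-- The spectral norm of a (symmetric) real matrix: the largest absolute value of an
element of its real spectrum. For the positive semidefinite matrix `W = (1/n)XᵀX`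
this is the largest eigenvalue of `W`. -/
noncomputable def specNorm {m : ℕ} (M : Matrix (Fin m) (Fin m) ℝ) : ℝ :=
  sSup ((fun x => |x|) '' spectrum ℝ M)


/-- Standard Gaussian product measure. -/
noncomputable abbrev gpi (ι : Type) [Fintype ι] : Measure (ι → ℝ) :=
  Measure.pi fun _ : ι => (gaussianReal 0 1 : Measure ℝ)

lemma gpi_update {ι : Type} [Fintype ι] [DecidableEq ι] (k : ι) :
    MeasurePreserving (fun q : (ι → ℝ) × ℝ => Function.update q.1 k q.2)
      ((gpi ι).prod (gaussianReal 0 1)) (gpi ι) := by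
  have hm : Measurable (fun q : (ι → ℝ) × ℝ => Function.update q.1 k q.2) := by
    rw [measurable_pi_iff]
    intro i
    by_cases h : i = k
    · subst h; simpa using measurable_snd
    · simp only [Function.update_of_ne h]; fun_prop
  refine ⟨hm, ?_⟩
  symm
  apply Measure.pi_eq
  intro s hs
  rw [Measure.map_apply hm (MeasurableSet.univ_pi hs)]
  have : (fun q : (ι → ℝ) × ℝ => Function.update q.1 k q.2) ⁻¹' (Set.univ.pi s)
      = (Set.univ.pi (Function.update s k Set.univ)) ×ˢ (s k) := by
    ext ⟨w, x⟩
    simp only [Set.mem_preimage, Set.mem_pi, Set.mem_univ, true_implies, Set.mem_prod]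
    constructor
    · intro h
      refine ⟨fun i => ?_, by simpa using h k⟩
      by_cases hi : i = k
      · subst hi; simp
      · simpa [Function.update_of_ne hi] using h i
    · rintro ⟨h1, h2⟩ i
      by_cases hi : i = k
      · subst hi; simpa using h2
      · simpa [Function.update_of_ne hi] using h1 i
  rw [this, Measure.prod_prod, Measure.pi_pi, ← Finset.mul_prod_erase _ _ (Finset.mem_univ k),
    ← Finset.mul_prod_erase Finset.univ (fun i => gaussianReal 0 1 (s i)) (Finset.mem_univ k)]
  simp only [Function.update_self, measure_univ, one_mul]
  rw [mul_comm]
  congr 1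
  apply Finset.prod_congr rfl
  intro i hi
  rw [Function.update_of_ne (Finset.ne_of_mem_erase hi)]

lemma stein_one (g g' : ℝ → ℝ) (C : ℝ) (hg : ∀ x, HasDerivAt g (g' x) x)
    (hC : ∀ x, |g x| ≤ C) (hC' : ∀ x, |g' x| ≤ C) :
    ∫ x, x * g x ∂(gaussianReal 0 1) = ∫ x, g' x ∂(gaussianReal 0 1) := by
  have hgm : Measurable g := (continuous_iff_continuousAt.2 fun x => (hg x).continuousAt).measurable
  have hgm' : Measurable g' := by
    have : g' = deriv g := funext fun x => ((hg x).deriv).symm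
    rw [this]; exact measurable_deriv g
  have hv : (1 : NNReal) ≠ 0 := one_ne_zero
  have hid : Integrable (fun x : ℝ => x) (gaussianReal 0 1) :=
    (memLp_id_gaussianReal 1).integrable (by norm_num)
  have i1 : Integrable (fun x => x * g x) (gaussianReal 0 1) := by
    refine Integrable.mul_bdd (c := C) hid hgm.aestronglyMeasurable
      (Filter.Eventually.of_forall fun x => ?_)
    exact hC x
  have i2 : Integrable g' (gaussianReal 0 1) :=
    Integrable.of_bound hgm'.aestronglyMeasurable C (Filter.Eventually.of_forall hC')
  have i3 : Integrable g (gaussianReal 0 1) :=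
    Integrable.of_bound hgm.aestronglyMeasurable C (Filter.Eventually.of_forall hC)
  have key : ∀ f : ℝ → ℝ, Integrable f (gaussianReal 0 1) →
      Integrable (fun x => gaussianPDFReal 0 1 x * f x) := by
    intro f hf
    rw [gaussianReal_of_var_ne_zero _ hv] at hf
    rw [integrable_withDensity_iff_integrable_smul' (measurable_gaussianPDF 0 1)
      (Filter.Eventually.of_forall fun x => gaussianPDF_lt_top)] at hf
    simpa [toReal_gaussianPDF] using hf
  have hd : ∀ x, HasDerivAt (gaussianPDFReal 0 1) (-x * gaussianPDFReal 0 1 x) x := by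
    intro x
    have : HasDerivAt (fun x : ℝ => (√(2 * Real.pi))⁻¹ * Real.exp (-x^2/2))
       ((√(2 * Real.pi))⁻¹ * (Real.exp (-x^2/2) * (-(2*x)/2))) x := by
      apply HasDerivAt.const_mul
      apply HasDerivAt.exp
      apply HasDerivAt.div_const
      apply HasDerivAt.neg
      simpa using hasDerivAt_pow 2 x
    convert! this using 1
    · funext y; simp [gaussianPDFReal]
    · simp [gaussianPDFReal]; ring
  have h0 := integral_eq_zero_of_hasDerivAt_of_integrable
    (f := fun x => gaussianPDFReal 0 1 x * g x)
    (f' := fun x => gaussianPDFReal 0 1 x * g' x - gaussianPDFReal 0 1 x * (x * g x))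
    (fun x => by
      convert! (hd x).mul (hg x) using 1
      ring)
    ((key _ i2).sub (key _ i1)) (key _ i3)
  rw [integral_sub (key _ i2) (key _ i1)] at h0
  rw [integral_gaussianReal_eq_integral_smul hv, integral_gaussianReal_eq_integral_smul hv]
  simp only [smul_eq_mul]
  linarith

lemma gpi_eval_integrable {ι : Type} [Fintype ι] (k : ι) :
    Integrable (fun w : ι → ℝ => w k) (gpi ι) := by
  have hid : Integrable (fun x : ℝ => x) (gaussianReal 0 1) :=
    (memLp_id_gaussianReal 1).integrable (by norm_num)
  exact (measurePreserving_eval (fun _ : ι => (gaussianReal 0 1 : Measure ℝ)) k).integrable_comp_of_integrable hid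

lemma stein_pi {ι : Type} [Fintype ι] [DecidableEq ι] (k : ι) (f f' : (ι → ℝ) → ℝ) (C : ℝ)
    (hf : ∀ w, ∀ x, HasDerivAt (fun s => f (Function.update w k s)) (f' (Function.update w k x)) x)
    (hm : Measurable f) (hm' : Measurable f')
    (hC : ∀ x, |f x| ≤ C) (hC' : ∀ x, |f' x| ≤ C) :
    ∫ w, w k * f w ∂(gpi ι) = ∫ w, f' w ∂(gpi ι) := by
  have mp := gpi_update k
  have i1 : Integrable (fun w => w k * f w) (gpi ι) :=
    Integrable.mul_bdd (c := C) (gpi_eval_integrable k) hm.aestronglyMeasurable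
      (Filter.Eventually.of_forall fun x => hC x)
  have i2 : Integrable f' (gpi ι) :=
    Integrable.of_bound hm'.aestronglyMeasurable C (Filter.Eventually.of_forall hC')
  have e : ∀ g : (ι → ℝ) → ℝ, Integrable g (gpi ι) → ∫ w, g w ∂(gpi ι) =
      ∫ w, ∫ x, g (Function.update w k x) ∂(gaussianReal 0 1) ∂(gpi ι) := by
    intro g hg
    have h1 := integral_map (μ := (gpi ι).prod (gaussianReal 0 1)) mp.measurable.aemeasurable
      (f := g) (by rw [mp.map_eq]; exact hg.aestronglyMeasurable)
    rw [mp.map_eq] at h1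
    rw [h1]
    exact integral_prod _ (mp.integrable_comp_of_integrable hg)
  rw [e _ i1, e _ i2]
  congr 1
  funext w
  simp only [Function.update_self]
  exact stein_one _ (fun x => f' (Function.update w k x)) C (hf w) (fun x => hC _) (fun x => hC' _)

lemma exists_cutoff (s δ : ℝ) (hδ : 0 < δ) : ∃ (φ φ' φ'' : ℝ → ℝ) (C : ℝ),
    (∀ x, HasDerivAt φ (φ' x) x) ∧ (∀ x, HasDerivAt φ' (φ'' x) x) ∧ (Continuous φ'') ∧
    (∀ x, 0 ≤ φ x) ∧ (∀ x, φ x ≤ 1) ∧ (∀ x, φ' x ≤ 0) ∧ (∀ x, |φ' x| ≤ C) ∧ (∀ x, |φ'' x| ≤ C) ∧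
    (∀ x, s ≤ x → φ x = 0) ∧ (∀ x, x ≤ s - δ → φ x = 1) := by
  set φ : ℝ → ℝ := fun x => Real.smoothTransition ((s - x) / δ) with hφ
  have hc : ContDiff ℝ 2 φ := by
    have : ContDiff ℝ 2 Real.smoothTransition := Real.smoothTransition.contDiff (n := 2)
    apply this.comp
    fun_prop
  have h1 : ContDiff ℝ 1 (deriv φ) := by
    have : ContDiff ℝ (1+1) φ := by norm_num; exact hc
    exact (contDiff_succ_iff_deriv.1 this).2.2
  have h2 : Continuous (deriv (deriv φ)) := h1.continuous_deriv le_rfl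
  have hz : ∀ x, s ≤ x → φ x = 0 := fun x hx =>
    Real.smoothTransition.zero_of_nonpos (div_nonpos_of_nonpos_of_nonneg (by linarith) hδ.le)
  have ho : ∀ x, x ≤ s - δ → φ x = 1 := fun x hx =>
    Real.smoothTransition.one_of_one_le (by rw [le_div_iff₀ hδ]; linarith)
  have hz1 : ∀ x, x ∉ Set.Icc (s - δ) s → deriv φ x = 0 := by
    intro x hx
    by_cases h : x < s - δ
    · have : φ =ᶠ[nhds x] fun _ => 1 := by
        filter_upwards [Iio_mem_nhds h] with y hy using ho y (le_of_lt hy)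
      rw [this.deriv_eq]; simp
    · have h' : s < x := by
        by_contra h''; exact hx ⟨not_lt.1 h, not_lt.1 h''⟩
      have : φ =ᶠ[nhds x] fun _ => 0 := by
        filter_upwards [Ioi_mem_nhds h'] with y hy using hz y (le_of_lt hy)
      rw [this.deriv_eq]; simp
  have hz2 : ∀ x, x ∉ Set.Icc (s - δ) s → deriv (deriv φ) x = 0 := by
    intro x hx
    have : deriv φ =ᶠ[nhds x] fun _ => 0 := by
      filter_upwards [isClosed_Icc.isOpen_compl.mem_nhds hx] with y hy using hz1 y hy
    rw [this.deriv_eq]; simp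
  obtain ⟨C1, hC1⟩ := (isCompact_Icc (a := s - δ) (b := s)).exists_bound_of_continuousOn
    h1.continuous.continuousOn
  obtain ⟨C2, hC2⟩ := (isCompact_Icc (a := s - δ) (b := s)).exists_bound_of_continuousOn
    h2.continuousOn
  have hanti : Antitone φ := by
    intro x y hxy
    apply Real.smoothTransition.monotone
    gcongr
  refine ⟨φ, deriv φ, deriv (deriv φ), max 0 (max C1 C2), fun x => ?_, fun x => ?_, h2,
    fun x => Real.smoothTransition.nonneg _, fun x => Real.smoothTransition.le_one _,
    fun x => hanti.deriv_nonpos, ?_, ?_, hz, ho⟩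
  · exact (hc.differentiable (by norm_num) x).hasDerivAt
  · exact (h1.differentiable (by norm_num) x).hasDerivAt
  · intro x
    by_cases h : x ∈ Set.Icc (s - δ) s
    · exact (hC1 x h).trans ((le_max_left _ _).trans (le_max_right _ _))
    · rw [hz1 x h]; simp
  · intro x
    by_cases h : x ∈ Set.Icc (s - δ) s
    · exact (hC2 x h).trans ((le_max_right _ _).trans (le_max_right _ _))
    · rw [hz2 x h]; simp

lemma prod_bdd {I : Type} (S : Finset I) (φ : ℝ → ℝ) (h0 : ∀ x, 0 ≤ φ x) (h1 : ∀ x, φ x ≤ 1)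
    (z : I → ℝ) : |∏ j ∈ S, φ (z j)| ≤ 1 := by
  rw [abs_of_nonneg (Finset.prod_nonneg fun i _ => h0 _)]
  exact Finset.prod_le_one (fun i _ => h0 _) (fun i _ => h1 _)

/-- The linear form with coefficients `c`. -/
def lform {ι : Type} [Fintype ι] (c : ι → ℝ) (w : ι → ℝ) : ℝ := ∑ k, c k * w k

lemma lform_meas {ι : Type} [Fintype ι] (c : ι → ℝ) : Continuous (lform c) := by
  unfold lform; fun_prop

lemma lform_update {ι : Type} [Fintype ι] [DecidableEq ι] (c w : ι → ℝ) (k : ι) (x : ℝ) :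
    HasDerivAt (fun s => lform c (Function.update w k s)) (c k) x := by
  have : (fun s => lform c (Function.update w k s)) =
      fun s => c k * s + ∑ l ∈ Finset.univ.erase k, c l * w l := by
    funext s
    unfold lform
    rw [← Finset.add_sum_erase _ _ (Finset.mem_univ k)]
    simp only [Function.update_self]
    congr 1
    apply Finset.sum_congr rfl
    intro l hl
    rw [Function.update_of_ne (Finset.ne_of_mem_erase hl)]
  rw [this]
  exact (by simpa using (hasDerivAt_id' x).const_mul (c k) :
    HasDerivAt (fun s => c k * s) (c k) x).add_const _

lemma stein_cutoff {ι I : Type} [Fintype ι] [DecidableEq ι] [Fintype I] [DecidableEq I]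
    (φ φ' φ'' : ℝ → ℝ) (C : ℝ)
    (hφ : ∀ x, HasDerivAt φ (φ' x) x) (hφ' : ∀ x, HasDerivAt φ' (φ'' x) x) (hc : Continuous φ'')
    (h0 : ∀ x, 0 ≤ φ x) (h1 : ∀ x, φ x ≤ 1) 
    (hb1 : ∀ x, |φ' x| ≤ C) (hb2 : ∀ x, |φ'' x| ≤ C) (c : I → ι → ℝ) (i : I) (k : ι) :
    ∫ w, w k * (φ' (lform (c i) w) * ∏ j ∈ Finset.univ.erase i, φ (lform (c j) w)) ∂(gpi ι) =
    c i k * ∫ w, (φ'' (lform (c i) w) * ∏ j ∈ Finset.univ.erase i, φ (lform (c j) w)) ∂(gpi ι) +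
    ∑ j ∈ Finset.univ.erase i, c j k * ∫ w, (φ' (lform (c i) w) * (φ' (lform (c j) w) *
      ∏ l ∈ (Finset.univ.erase i).erase j, φ (lform (c l) w))) ∂(gpi ι) := by
  have C0 : 0 ≤ C := (abs_nonneg _).trans (hb1 0)
  have cφ : Continuous φ := continuous_iff_continuousAt.2 fun x => (hφ x).continuousAt
  have cφ' : Continuous φ' := continuous_iff_continuousAt.2 fun x => (hφ' x).continuousAt
  have cl : ∀ j, Continuous (lform (c j)) := fun j => lform_meas _
  have b1 : ∀ w, |φ' (lform (c i) w) * ∏ j ∈ Finset.univ.erase i, φ (lform (c j) w)| ≤ C := by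
    intro w
    rw [abs_mul]
    exact (mul_le_mul (hb1 _) (prod_bdd _ φ h0 h1 _) (abs_nonneg _) C0).trans (by simp)
  have b2 : ∀ w, |φ'' (lform (c i) w) * ∏ j ∈ Finset.univ.erase i, φ (lform (c j) w)| ≤ C := by
    intro w
    rw [abs_mul]
    exact (mul_le_mul (hb2 _) (prod_bdd _ φ h0 h1 _) (abs_nonneg _) C0).trans (by simp)
  have b3 : ∀ j, ∀ w, |φ' (lform (c i) w) * (φ' (lform (c j) w) *
      ∏ l ∈ (Finset.univ.erase i).erase j, φ (lform (c l) w))| ≤ C * C := by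
    intro j w
    rw [abs_mul, abs_mul]
    refine mul_le_mul (hb1 _) ?_ (by positivity) C0
    exact (mul_le_mul (hb1 _) (prod_bdd _ φ h0 h1 _) (abs_nonneg _) C0).trans (by simp)
  set D := C + (|c i k| * C + ∑ j ∈ Finset.univ.erase i, |c j k| * (C * C)) with hD
  have hS : 0 ≤ ∑ j ∈ Finset.univ.erase i, |c j k| * (C * C) :=
    Finset.sum_nonneg fun j _ => by positivity
  have hS' : 0 ≤ |c i k| * C := by positivity
  rw [stein_pi k (fun w => φ' (lform (c i) w) * ∏ j ∈ Finset.univ.erase i, φ (lform (c j) w))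
    (fun w => c i k * (φ'' (lform (c i) w) * ∏ j ∈ Finset.univ.erase i, φ (lform (c j) w)) +
      ∑ j ∈ Finset.univ.erase i, c j k * (φ' (lform (c i) w) * (φ' (lform (c j) w) *
      ∏ l ∈ (Finset.univ.erase i).erase j, φ (lform (c l) w)))) D ?_ ?_ ?_ ?_ ?_]
  · rw [integral_add, integral_const_mul, integral_finsetSum]
    · congr 1
      apply Finset.sum_congr rfl
      intro j _
      rw [integral_const_mul]
    · intro j _
      apply Integrable.const_mul
      exact Integrable.of_bound (by fun_prop) (C * C) (Filter.Eventually.of_forall (b3 j))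
    · apply Integrable.const_mul
      exact Integrable.of_bound (by fun_prop) C (Filter.Eventually.of_forall b2)
    · apply integrable_finsetSum
      intro j _
      apply Integrable.const_mul
      exact Integrable.of_bound (by fun_prop) (C * C) (Filter.Eventually.of_forall (b3 j))
  · intro w x
    have d1 : HasDerivAt (fun s => φ' (lform (c i) (Function.update w k s)))
        (φ'' (lform (c i) (Function.update w k x)) * c i k) x :=
      (hφ' _).comp x (lform_update (c i) w k x)
    have d2 : HasDerivAt (fun s => ∏ j ∈ Finset.univ.erase i, φ (lform (c j) (Function.update w k s)))
        (∑ j ∈ Finset.univ.erase i, (∏ l ∈ (Finset.univ.erase i).erase j,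
          φ (lform (c l) (Function.update w k x))) • 
          (φ' (lform (c j) (Function.update w k x)) * c j k)) x :=
      HasDerivAt.fun_finsetProd fun j _ => (hφ _).comp x (lform_update (c j) w k x)
    convert! d1.mul d2 using 1
    rw [Finset.mul_sum]
    congr 1
    · ring
    · apply Finset.sum_congr rfl
      intro j _
      simp only [smul_eq_mul]
      ring
  · exact Continuous.measurable (by fun_prop)
  · exact Continuous.measurable (by fun_prop)
  · intro w
    refine (b1 w).trans ?_
    linarith
  · intro w
    refine (abs_add_le _ _).trans ?_
    have e1 : |c i k * (φ'' (lform (c i) w) * ∏ j ∈ Finset.univ.erase i, φ (lform (c j) w))|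
        ≤ |c i k| * C := by
      rw [abs_mul]; exact mul_le_mul_of_nonneg_left (b2 w) (abs_nonneg _)
    have e2 : |∑ j ∈ Finset.univ.erase i, c j k * (φ' (lform (c i) w) * (φ' (lform (c j) w) *
      ∏ l ∈ (Finset.univ.erase i).erase j, φ (lform (c l) w)))| ≤
      ∑ j ∈ Finset.univ.erase i, |c j k| * (C * C) := by
      refine (Finset.abs_sum_le_sum_abs _ _).trans (Finset.sum_le_sum fun j _ => ?_)
      rw [abs_mul]; exact mul_le_mul_of_nonneg_left (b3 j w) (abs_nonneg _)
    linarith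

lemma slepian_smooth {ι I : Type} [Fintype ι] [DecidableEq ι] [Fintype I] [DecidableEq I]
    (φ φ' φ'' : ℝ → ℝ) (C : ℝ)
    (hφ : ∀ x, HasDerivAt φ (φ' x) x) (hφ' : ∀ x, HasDerivAt φ' (φ'' x) x) (hc : Continuous φ'')
    (h0 : ∀ x, 0 ≤ φ x) (h1 : ∀ x, φ x ≤ 1) (hneg : ∀ x, φ' x ≤ 0)
    (hb1 : ∀ x, |φ' x| ≤ C) (hb2 : ∀ x, |φ'' x| ≤ C) (a b : I → ι → ℝ)
    (hab : ∀ i j, ∑ k, a i k * b j k = 0)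
    (hdiag : ∀ i, ∑ k, a i k * a i k = ∑ k, b i k * b i k)
    (hoff : ∀ i j, ∑ k, b i k * b j k ≤ ∑ k, a i k * a j k) :
    ∫ w, ∏ i, φ (lform (b i) w) ∂(gpi ι) ≤ ∫ w, ∏ i, φ (lform (a i) w) ∂(gpi ι) := by
  have C0 : 0 ≤ C := (abs_nonneg _).trans (hb1 0)
  have cφ : Continuous φ := continuous_iff_continuousAt.2 fun x => (hφ x).continuousAt
  have cφ' : Continuous φ' := continuous_iff_continuousAt.2 fun x => (hφ' x).continuousAt
  set c : ℝ → I → ι → ℝ := fun t i k => Real.cos t * a i k + Real.sin t * b i k with hcdef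
  set d : ℝ → I → ι → ℝ := fun t i k => -Real.sin t * a i k + Real.cos t * b i k with hddef
  have cl : ∀ t j, Continuous (lform (c t j)) := fun t j => lform_meas _
  have cl' : ∀ t j, Continuous (lform (d t j)) := fun t j => lform_meas _
  set P : ℝ → ℝ := fun t => ∫ w, ∏ i, φ (lform (c t i) w) ∂(gpi ι) with hP
  set Q : ℝ → (ι → ℝ) → ℝ := fun t w => ∑ i, (∏ j ∈ Finset.univ.erase i, φ (lform (c t j) w)) •
      (φ' (lform (c t i) w) * lform (d t i) w) with hQ
  have hl : ∀ w t i, HasDerivAt (fun t => lform (c t i) w) (lform (d t i) w) t := by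
    intro w t i
    unfold lform
    apply HasDerivAt.fun_sum
    intro k _
    apply HasDerivAt.mul_const
    exact ((Real.hasDerivAt_cos t).mul_const _).add ((Real.hasDerivAt_sin t).mul_const _)
  have hder : ∀ t, HasDerivAt P (∫ w, Q t w ∂(gpi ι)) t := by
    intro t
    refine (hasDerivAt_integral_of_dominated_loc_of_deriv_le (s := Set.univ) Filter.univ_mem
      (bound := fun w => ∑ i, C * ∑ k, (|a i k| + |b i k|) * |w k|) ?_ ?_ ?_ ?_ ?_ ?_).2
    · exact Filter.Eventually.of_forall fun t => Continuous.aestronglyMeasurable (by fun_prop)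
    · exact Integrable.of_bound (Continuous.aestronglyMeasurable (by fun_prop)) 1
        (Filter.Eventually.of_forall fun w => prod_bdd _ φ h0 h1 _)
    · exact Continuous.aestronglyMeasurable (by fun_prop)
    · refine Filter.Eventually.of_forall fun w t _ => ?_
      rw [hQ]
      refine (norm_sum_le _ _).trans (Finset.sum_le_sum fun i _ => ?_)
      rw [smul_eq_mul, norm_mul, norm_mul]
      have e1 : ‖∏ j ∈ Finset.univ.erase i, φ (lform (c t j) w)‖ ≤ 1 := prod_bdd _ φ h0 h1 _
      have e2 : ‖φ' (lform (c t i) w)‖ ≤ C := hb1 _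
      have e3 : ‖lform (d t i) w‖ ≤ ∑ k, (|a i k| + |b i k|) * |w k| := by
        unfold lform
        refine (norm_sum_le _ _).trans (Finset.sum_le_sum fun k _ => ?_)
        rw [norm_mul]
        refine mul_le_mul_of_nonneg_right ?_ (norm_nonneg _)
        refine (norm_add_le _ _).trans ?_
        rw [norm_mul, norm_mul, norm_neg]
        have := Real.abs_sin_le_one t
        have := Real.abs_cos_le_one t
        simp only [Real.norm_eq_abs]
        nlinarith [abs_nonneg (a i k), abs_nonneg (b i k)]
      calc _ ≤ 1 * (C * ∑ k, (|a i k| + |b i k|) * |w k|) := by gcongr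
        _ = _ := one_mul _
    · apply integrable_finsetSum
      intro i _
      apply Integrable.const_mul
      apply integrable_finsetSum
      intro k _
      apply Integrable.const_mul
      exact (gpi_eval_integrable k).abs
    · refine Filter.Eventually.of_forall fun w t _ => ?_
      exact HasDerivAt.fun_finsetProd fun j _ => (hφ _).comp t (hl w t j)
  have hdc : ∀ t i j, ∑ k, d t i k * c t j k =
      Real.sin t * Real.cos t * (∑ k, b i k * b j k - ∑ k, a i k * a j k) := by
    intro t i j
    have : ∀ k, d t i k * c t j k = Real.sin t * Real.cos t * (b i k * b j k - a i k * a j k)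
        - Real.sin t ^ 2 * (a i k * b j k) + Real.cos t ^ 2 * (a j k * b i k) := by
      intro k; simp only [hcdef, hddef]; ring
    simp only [this]
    rw [Finset.sum_add_distrib, Finset.sum_sub_distrib, ← Finset.mul_sum, ← Finset.mul_sum,
      ← Finset.mul_sum, hab, hab, Finset.sum_sub_distrib]
    ring
  have hval : ∀ t, ∫ w, Q t w ∂(gpi ι) = ∑ i, ∑ j ∈ Finset.univ.erase i,
      (∑ k, d t i k * c t j k) * ∫ w, (φ' (lform (c t i) w) * (φ' (lform (c t j) w) *
      ∏ l ∈ (Finset.univ.erase i).erase j, φ (lform (c t l) w))) ∂(gpi ι) := by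
    intro t
    have hint : ∀ i k, Integrable (fun w => w k * (φ' (lform (c t i) w) *
        ∏ j ∈ Finset.univ.erase i, φ (lform (c t j) w))) (gpi ι) := by
      intro i k
      refine Integrable.mul_bdd (c := C) (gpi_eval_integrable k)
        (Continuous.aestronglyMeasurable (by fun_prop)) (Filter.Eventually.of_forall fun w => ?_)
      rw [norm_mul]
      exact (mul_le_mul (hb1 _) (prod_bdd _ φ h0 h1 _) (abs_nonneg _) C0).trans (by simp)
    have e : Q t = fun w => ∑ i, ∑ k, d t i k * (w k * (φ' (lform (c t i) w) *
        ∏ j ∈ Finset.univ.erase i, φ (lform (c t j) w))) := by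
      funext w
      simp only [hQ]
      apply Finset.sum_congr rfl
      intro i _
      have hd : lform (d t i) w = ∑ k, d t i k * w k := rfl
      rw [hd, smul_eq_mul, Finset.mul_sum, Finset.mul_sum]
      apply Finset.sum_congr rfl
      intro k _
      ring
    rw [e, integral_finsetSum _ (fun i _ => integrable_finsetSum _ fun k _ =>
      (hint i k).const_mul _)]
    apply Finset.sum_congr rfl
    intro i _
    rw [integral_finsetSum _ (fun k _ => (hint i k).const_mul _)]
    simp only [integral_const_mul, stein_cutoff φ φ' φ'' C hφ hφ' hc h0 h1 hb1 hb2 (c t) i]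
    simp only [mul_add, Finset.sum_add_distrib, ← mul_assoc, ← Finset.sum_mul, Finset.mul_sum]
    rw [hdc, ← hdiag i, sub_self, mul_zero, zero_mul, zero_add, Finset.sum_comm]
    simp only [← Finset.sum_mul]
  have hanti : AntitoneOn P (Set.Icc 0 (Real.pi / 2)) := by
    apply antitoneOn_of_deriv_nonpos (convex_Icc _ _)
    · exact fun t _ => (hder t).continuousAt.continuousWithinAt
    · exact fun t _ => (hder t).differentiableAt.differentiableWithinAt
    · intro t ht
      rw [interior_Icc] at ht
      rw [(hder t).deriv, hval]
      apply Finset.sum_nonpos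
      intro i _
      apply Finset.sum_nonpos
      intro j _
      apply mul_nonpos_of_nonpos_of_nonneg
      · rw [hdc]
        apply mul_nonpos_of_nonneg_of_nonpos
        · apply mul_nonneg
          · exact Real.sin_nonneg_of_nonneg_of_le_pi ht.1.le (by linarith [ht.2, Real.pi_pos])
          · exact Real.cos_nonneg_of_neg_pi_div_two_le_of_le (by linarith [ht.1, Real.pi_pos]) ht.2.le
        · linarith [hoff i j]
      · apply integral_nonneg
        intro w
        have : 0 ≤ ∏ l ∈ (Finset.univ.erase i).erase j, φ (lform (c t l) w) :=
          Finset.prod_nonneg fun l _ => h0 _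
        exact mul_nonneg_of_nonpos_of_nonpos (hneg _)
          (mul_nonpos_of_nonpos_of_nonneg (hneg _) this)
  have hp := Real.pi_pos
  have := hanti (a := 0) (b := Real.pi / 2) ⟨le_rfl, by linarith⟩ ⟨by linarith, le_rfl⟩ (by linarith)
  simpa [hP, hcdef] using this

lemma slepian {ι I : Type} [Fintype ι] [DecidableEq ι] [Fintype I] [DecidableEq I]
    (a b : I → ι → ℝ)
    (hab : ∀ i j, ∑ k, a i k * b j k = 0)
    (hdiag : ∀ i, ∑ k, a i k * a i k = ∑ k, b i k * b i k)
    (hoff : ∀ i j, ∑ k, b i k * b j k ≤ ∑ k, a i k * a j k) (s r : ℝ) (hr : r < s) :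
    gpi ι {w | ∃ i, s ≤ lform (a i) w} ≤ gpi ι {w | ∃ i, r < lform (b i) w} := by
  obtain ⟨φ, φ', φ'', C, hφ, hφ', hc, h0, h1, hneg, hb1, hb2, hz, ho⟩ :=
    exists_cutoff s (s - r) (by linarith)
  have key := slepian_smooth φ φ' φ'' C hφ hφ' hc h0 h1 hneg hb1 hb2 a b hab hdiag hoff
  have cφ : Continuous φ := continuous_iff_continuousAt.2 fun x => (hφ x).continuousAt
  have cl : ∀ j, Continuous (lform (a j)) := fun j => lform_meas _
  have cl' : ∀ j, Continuous (lform (b j)) := fun j => lform_meas _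
  have mA : MeasurableSet {w | ∃ i, s ≤ lform (a i) w} := by
    rw [Set.ofPred_exists]
    exact MeasurableSet.iUnion fun i => measurableSet_le measurable_const (cl i).measurable
  have mB : MeasurableSet {w | ∃ i, r < lform (b i) w} := by
    rw [Set.ofPred_exists]
    exact MeasurableSet.iUnion fun i => measurableSet_lt measurable_const (cl' i).measurable
  have k1 : (gpi ι).real {w | ∃ i, r < lform (b i) w}ᶜ ≤ ∫ w, ∏ i, φ (lform (b i) w) ∂(gpi ι) := by
    rw [← integral_indicator_one mB.compl]
    apply integral_mono
    · exact (integrable_const (1 : ℝ)).indicator mB.compl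
    · exact Integrable.of_bound (Continuous.aestronglyMeasurable (by fun_prop)) 1
        (Filter.Eventually.of_forall fun w => prod_bdd _ φ h0 h1 _)
    · intro w
      by_cases hw : w ∈ {w | ∃ i, r < lform (b i) w}ᶜ
      · rw [Set.indicator_of_mem hw]
        simp only [Set.mem_compl_iff, Set.mem_ofPred_eq, not_exists, not_lt] at hw
        simp only
        rw [Finset.prod_eq_one]
        · simp
        · intro i _
          exact ho _ (by linarith [hw i])
      · rw [Set.indicator_of_notMem hw]
        exact Finset.prod_nonneg fun l _ => h0 _
  have k2 : ∫ w, ∏ i, φ (lform (a i) w) ∂(gpi ι) ≤ (gpi ι).real {w | ∃ i, s ≤ lform (a i) w}ᶜ := by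
    rw [← integral_indicator_one mA.compl]
    apply integral_mono
    · exact Integrable.of_bound (Continuous.aestronglyMeasurable (by fun_prop)) 1
        (Filter.Eventually.of_forall fun w => prod_bdd _ φ h0 h1 _)
    · exact (integrable_const (1 : ℝ)).indicator mA.compl
    · intro w
      by_cases hw : w ∈ {w | ∃ i, s ≤ lform (a i) w}ᶜ
      · rw [Set.indicator_of_mem hw]
        exact (le_abs_self _).trans (prod_bdd _ φ h0 h1 _)
      · rw [Set.indicator_of_notMem hw]
        simp only [Set.mem_compl_iff, Set.mem_ofPred_eq, not_not] at hw
        obtain ⟨i, hi⟩ := hw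
        exact (Finset.prod_eq_zero (Finset.mem_univ i) (hz _ hi)).le
  rw [probReal_compl_eq_one_sub mB] at k1
  rw [probReal_compl_eq_one_sub mA] at k2
  have : (gpi ι).real {w | ∃ i, s ≤ lform (a i) w} ≤ (gpi ι).real {w | ∃ i, r < lform (b i) w} := by
    linarith
  exact (ENNReal.toReal_le_toReal (measure_ne_top _ _) (measure_ne_top _ _)).1 this

lemma gauss_sq_mgf (y : ℝ) (hy : 1 ≤ y) :
    ∫⁻ x, ENNReal.ofReal (Real.exp ((1 - 1 / y ^ 2) / 2 * x ^ 2)) ∂(gaussianReal 0 1)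
      = ENNReal.ofReal y := by
  have hy0 : 0 < y := by linarith
  rw [gaussianReal_of_var_ne_zero _ one_ne_zero,
    lintegral_withDensity_eq_lintegral_mul _ (measurable_gaussianPDF 0 1) (by fun_prop)]
  set v : NNReal := ⟨y ^ 2, by positivity⟩ with hv
  have hv0 : v ≠ 0 := by
    intro h
    have : y ^ 2 = 0 := congrArg NNReal.toReal h
    exact (pow_pos hy0 2).ne' this
  have e : ∀ x, (gaussianPDF 0 1 * fun x => ENNReal.ofReal (Real.exp ((1 - 1 / y ^ 2) / 2 * x ^ 2))) x
      = ENNReal.ofReal y * gaussianPDF 0 v x := by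
    intro x
    simp only [Pi.mul_apply, gaussianPDF]
    rw [← ENNReal.ofReal_mul (gaussianPDFReal_nonneg _ _ _), ← ENNReal.ofReal_mul hy0.le]
    congr 1
    simp only [gaussianPDFReal]
    have hvv : (v : ℝ) = y ^ 2 := rfl
    rw [hvv, Real.sqrt_mul (by positivity) (y ^ 2), Real.sqrt_sq hy0.le, mul_assoc, ← Real.exp_add]
    simp only [NNReal.coe_one, mul_one, sub_zero]
    have : -x ^ 2 / 2 + (1 - 1 / y ^ 2) / 2 * x ^ 2 = -x ^ 2 / (2 * y ^ 2) := by
      field_simp; ring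
    rw [this]
    field_simp
  simp only [e]
  rw [lintegral_const_mul _ (measurable_gaussianPDF 0 v), lintegral_gaussianPDF_eq_one _ hv0, mul_one]

lemma chi_mgf (n : ℕ) (hn : 0 < n) (l : ℝ) (hl : 0 < l) :
    ∫⁻ g, ENNReal.ofReal (Real.exp (l * √(∑ k, g k ^ 2))) ∂(gpi (Fin n))
      ≤ ENNReal.ofReal (Real.exp (l * √n + l ^ 2 / 2)) := by
  have hn' : (0 : ℝ) < n := by exact_mod_cast hn
  obtain ⟨q, hq⟩ : ∃ q, q = √(n : ℝ) := ⟨_, rfl⟩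
  have hq0 : 0 < q := by rw [hq]; positivity
  have hqq : q ^ 2 = n := by rw [hq]; exact Real.sq_sqrt hn'.le
  obtain ⟨y, hy1, hly⟩ : ∃ y : ℝ, 1 ≤ y ∧ l = q * (y - 1 / y) := by
    have h4 : √(l ^ 2 + 4 * n) ^ 2 = l ^ 2 + 4 * n := Real.sq_sqrt (by positivity)
    have h5 : 2 * q ≤ √(l ^ 2 + 4 * n) := by
      apply Real.le_sqrt_of_sq_le
      nlinarith
    refine ⟨(l + √(l ^ 2 + 4 * n)) / (2 * q), ?_, ?_⟩
    · rw [le_div_iff₀ (by positivity)]; linarith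
    · have : 0 < l + √(l ^ 2 + 4 * n) := by linarith
      field_simp
      nlinarith
  have hy0 : 0 < y := by linarith
  rw [← hq]
  calc ∫⁻ g, ENNReal.ofReal (Real.exp (l * √(∑ k, g k ^ 2))) ∂(gpi (Fin n))
      ≤ ∫⁻ g, ENNReal.ofReal (Real.exp (l * (q * y) / 2)) *
        ∏ k, ENNReal.ofReal (Real.exp ((1 - 1 / y ^ 2) / 2 * g k ^ 2)) ∂(gpi (Fin n)) := by
        apply lintegral_mono
        intro g
        simp only
        rw [← ENNReal.ofReal_prod_of_nonneg (fun _ _ => (Real.exp_pos _).le),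
          ← ENNReal.ofReal_mul (Real.exp_pos _).le, ← Real.exp_sum, ← Real.exp_add,
          ← Finset.mul_sum]
        apply ENNReal.ofReal_le_ofReal
        apply Real.exp_le_exp.2
        have hs : 0 ≤ ∑ k, g k ^ 2 := Finset.sum_nonneg fun k _ => sq_nonneg _
        have h2 := Real.sq_sqrt hs
        set r := √(∑ k, g k ^ 2)
        rw [← h2, hly]
        have : q * (y - 1 / y) * (q * y) / 2 + (1 - 1 / y ^ 2) / 2 * r ^ 2 - q * (y - 1 / y) * r
          = (1 - 1 / y ^ 2) / 2 * (r - q * y) ^ 2 := by field_simp; ring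
        have h3 : 0 ≤ (1 - 1 / y ^ 2) / 2 := by
          have : 1 / y ^ 2 ≤ 1 := by rw [div_le_one (by positivity)]; nlinarith
          linarith
        nlinarith [mul_nonneg h3 (sq_nonneg (r - q * y))]
    _ = ENNReal.ofReal (Real.exp (l * (q * y) / 2)) * ENNReal.ofReal y ^ n := by
        rw [lintegral_const_mul _ (by fun_prop)]
        congr 1
        have hind : iIndepFun (fun (k : Fin n) (g : Fin n → ℝ) =>
            ENNReal.ofReal (Real.exp ((1 - 1 / y ^ 2) / 2 * g k ^ 2))) (gpi (Fin n)) :=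
          iIndepFun_pi (X := fun (_ : Fin n) (x : ℝ) =>
            ENNReal.ofReal (Real.exp ((1 - 1 / y ^ 2) / 2 * x ^ 2)))
            (fun k => Measurable.aemeasurable (by fun_prop))
        rw [lintegral_prod_eq_prod_lintegral_of_indepFun Finset.univ _ hind (fun k => by fun_prop)]
        have : ∀ k : Fin n, ∫⁻ g, ENNReal.ofReal (Real.exp ((1 - 1 / y ^ 2) / 2 * g k ^ 2)) ∂(gpi (Fin n))
            = ENNReal.ofReal y := by
          intro k
          rw [← gauss_sq_mgf y hy1]
          exact (measurePreserving_eval (fun _ : Fin n => (gaussianReal 0 1 : Measure ℝ)) k).lintegral_comp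
            (f := fun x => ENNReal.ofReal (Real.exp ((1 - 1 / y ^ 2) / 2 * x ^ 2))) (by fun_prop)
        simp only [this, Finset.prod_const, Finset.card_univ, Fintype.card_fin]
    _ ≤ ENNReal.ofReal (Real.exp (l * q + l ^ 2 / 2)) := by
        rw [← ENNReal.ofReal_pow hy0.le, ← ENNReal.ofReal_mul (Real.exp_pos _).le]
        apply ENNReal.ofReal_le_ofReal
        have h1 : y ^ n ≤ Real.exp (n * (y - 1)) := by
          rw [Real.exp_nat_mul]
          apply pow_le_pow_left₀ hy0.le
          linarith [Real.add_one_le_exp (y - 1)]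
        refine (mul_le_mul_of_nonneg_left h1 (Real.exp_pos _).le).trans ?_
        rw [← Real.exp_add]
        apply Real.exp_le_exp.2
        rw [← hqq, hly]
        have : q * (y - 1 / y) * q + (q * (y - 1 / y)) ^ 2 / 2 -
          (q * (y - 1 / y) * (q * y) / 2 + q ^ 2 * (y - 1)) = q ^ 2 * (1 - 1 / y) ^ 2 / 2 := by
          field_simp; ring
        have h3 : 0 ≤ q ^ 2 * (1 - 1 / y) ^ 2 / 2 := by positivity
        linarith

/-- index type for all the Gaussian variables -/
abbrev Idx (n p : ℕ) : Type := (Fin n × Fin p ⊕ Unit) ⊕ (Fin n ⊕ Fin p)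

/-- the four-fold product space -/
abbrev Four (n p : ℕ) : Type := (Fin n → Fin p → ℝ) × ℝ × (Fin n → ℝ) × (Fin p → ℝ)

/-- the law of the matrix -/
noncomputable abbrev matLaw (n p : ℕ) : Measure (Fin n → Fin p → ℝ) :=
  Measure.pi fun _ : Fin n => Measure.pi fun _ : Fin p => (gaussianReal 0 1 : Measure ℝ)

/-- the product law -/
noncomputable abbrev fourLaw (n p : ℕ) : Measure (Four n p) :=
  (matLaw n p).prod ((gaussianReal 0 1 : Measure ℝ).prod ((gpi (Fin n)).prod (gpi (Fin p))))

/-- gluing map -/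
def glue (n p : ℕ) (q : Four n p) : Idx n p → ℝ :=
  Sum.elim (Sum.elim (fun ab => q.1 ab.1 ab.2) (fun _ => q.2.1)) (Sum.elim q.2.2.1 q.2.2.2)

lemma glue_mp (n p : ℕ) : MeasurePreserving (glue n p) (fourLaw n p) (gpi (Idx n p)) := by
  have hm : Measurable (glue n p) := by
    rw [measurable_pi_iff]
    rintro ((⟨a, b⟩ | _) | (a | b)) <;> simp only [glue, Sum.elim_inl, Sum.elim_inr] <;> fun_prop
  refine ⟨hm, ?_⟩
  symm
  apply Measure.pi_eq
  intro s hs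
  rw [Measure.map_apply hm (MeasurableSet.univ_pi hs)]
  have : glue n p ⁻¹' (Set.univ.pi s) =
      (Set.univ.pi fun a => Set.univ.pi fun b => s (Sum.inl (Sum.inl (a, b)))) ×ˢ
      ((s (Sum.inl (Sum.inr ()))) ×ˢ ((Set.univ.pi fun a => s (Sum.inr (Sum.inl a))) ×ˢ
        (Set.univ.pi fun b => s (Sum.inr (Sum.inr b))))) := by
    ext ⟨X, c, g, h⟩
    simp only [glue, Set.mem_pi, Sum.forall, Set.mem_preimage, Set.mem_univ, true_implies,
      Sum.elim_inl, Sum.elim_inr, Set.mem_prod, Prod.forall]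
    exact ⟨fun h => ⟨h.1.1, h.1.2 (), h.2.1, h.2.2⟩, fun h => ⟨⟨h.1, fun _ => h.2.1⟩, h.2.2.1, h.2.2.2⟩⟩
  rw [this, Measure.prod_prod, Measure.prod_prod, Measure.prod_prod, Measure.pi_pi, Measure.pi_pi,
    Measure.pi_pi]
  simp only [Measure.pi_pi, Fintype.prod_sum_type, Fintype.prod_prod_type, Finset.univ_unique,
    Finset.prod_singleton]
  simp only [mul_assoc]

/-- the bilinear form -/
def bil {n p : ℕ} (u : Fin n → ℝ) (v : Fin p → ℝ) (X : Fin n → Fin p → ℝ) : ℝ :=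
  ∑ a, ∑ b, u a * v b * X a b

lemma cs_unit {m : ℕ} (u v : Fin m → ℝ) (hu : ∑ a, u a ^ 2 = 1) :
    ∑ a, u a * v a ≤ √(∑ a, v a ^ 2) := by
  have := Real.sum_mul_le_sqrt_mul_sqrt Finset.univ u v
  rwa [hu, Real.sqrt_one, one_mul] at this

lemma compare_fin {n p : ℕ} {I : Type} [Fintype I] [DecidableEq I] (u : I → Fin n → ℝ)
    (v : I → Fin p → ℝ) (hu : ∀ i, ∑ a, u i a ^ 2 = 1) (hv : ∀ i, ∑ a, v i a ^ 2 = 1)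
    (s r : ℝ) (hr : r < s) :
    fourLaw n p {q | ∃ i, s ≤ bil (u i) (v i) q.1 + q.2.1} ≤
      fourLaw n p {q | r < √(∑ a, q.2.2.1 a ^ 2) + √(∑ b, q.2.2.2 b ^ 2)} := by
  set A : I → Idx n p → ℝ := fun i =>
    Sum.elim (Sum.elim (fun ab => u i ab.1 * v i ab.2) (fun _ => 1)) (fun _ => 0) with hA
  set B : I → Idx n p → ℝ := fun i => Sum.elim (fun _ => 0) (Sum.elim (u i) (v i)) with hB
  have hAA : ∀ i j, ∑ k, A i k * A j k = (∑ a, u i a * u j a) * (∑ b, v i b * v j b) + 1 := by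
    intro i j
    simp only [hA, Fintype.sum_sum_type, Sum.elim_inl, Sum.elim_inr, Fintype.sum_prod_type,
      Finset.sum_mul_sum]
    simp
    apply Finset.sum_congr rfl
    intro a _
    apply Finset.sum_congr rfl
    intro b _
    ring
  have hBB : ∀ i j, ∑ k, B i k * B j k = (∑ a, u i a * u j a) + (∑ b, v i b * v j b) := by
    intro i j
    simp [hB, Fintype.sum_sum_type]
  have key := slepian A B (by intro i j; simp [hA, hB, Fintype.sum_sum_type])
    (by
      intro i
      rw [hAA, hBB]
      simp only [← pow_two, hu, hv]; norm_num)
    (by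
      intro i j
      rw [hAA, hBB]
      have h1 := cs_unit (u i) (u j) (hu i)
      have h2 := cs_unit (v i) (v j) (hv i)
      rw [hu, Real.sqrt_one] at h1
      rw [hv, Real.sqrt_one] at h2
      nlinarith) s r hr
  have mA : MeasurableSet {w | ∃ i, s ≤ lform (A i) w} := by
    rw [Set.ofPred_exists]
    exact MeasurableSet.iUnion fun i => measurableSet_le measurable_const (lform_meas _).measurable
  have mB : MeasurableSet {w | ∃ i, r < lform (B i) w} := by
    rw [Set.ofPred_exists]
    exact MeasurableSet.iUnion fun i => measurableSet_lt measurable_const (lform_meas _).measurable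
  rw [← (glue_mp n p).measure_preimage mA.nullMeasurableSet,
    ← (glue_mp n p).measure_preimage mB.nullMeasurableSet] at key
  refine le_trans (le_trans (measure_mono ?_) key) (measure_mono ?_)
  · rintro q ⟨i, hi⟩
    refine ⟨i, hi.trans (le_of_eq ?_)⟩
    simp [lform, bil, glue, hA, Fintype.sum_sum_type, Fintype.sum_prod_type]
  · rintro q ⟨i, hi⟩
    refine lt_of_lt_of_le hi ?_
    have : lform (B i) (glue n p q) = ∑ a, u i a * q.2.2.1 a + ∑ b, v i b * q.2.2.2 b := by
      simp [lform, glue, hB, Fintype.sum_sum_type]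
    rw [this]
    exact add_le_add (cs_unit _ _ (hu i)) (cs_unit _ _ (hv i))

lemma compare_seq {n p : ℕ} (u : ℕ → Fin n → ℝ)
    (v : ℕ → Fin p → ℝ) (hu : ∀ i, ∑ a, u i a ^ 2 = 1) (hv : ∀ i, ∑ a, v i a ^ 2 = 1) (s : ℝ) :
    fourLaw n p {q | ∃ i, s < bil (u i) (v i) q.1 + q.2.1} ≤
      fourLaw n p {q | s < √(∑ a, q.2.2.1 a ^ 2) + √(∑ b, q.2.2.2 b ^ 2)} := by
  set T : ℕ → Set (Four n p) := fun N =>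
    {q | ∃ i : Fin N, s + 1 / ((N : ℝ) + 1) ≤ bil (u i) (v i) q.1 + q.2.1} with hT
  have hmono : Monotone T := by
    intro N M hNM q hq
    obtain ⟨i, hi⟩ := hq
    refine ⟨⟨i, i.2.trans_le hNM⟩, le_trans ?_ hi⟩
    have : (N : ℝ) ≤ M := by exact_mod_cast hNM
    gcongr
  have hsub : {q : Four n p | ∃ i, s < bil (u i) (v i) q.1 + q.2.1} ⊆ ⋃ N, T N := by
    rintro q ⟨i, hi⟩
    obtain ⟨M, hM⟩ := exists_nat_one_div_lt (sub_pos.2 hi)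
    refine Set.mem_iUnion.2 ⟨max M (i + 1), ⟨i, by omega⟩, ?_⟩
    have : (M : ℝ) ≤ (max M (i + 1) : ℕ) := by exact_mod_cast le_max_left _ _
    have h2 : 1 / (((max M (i + 1) : ℕ) : ℝ) + 1) ≤ 1 / ((M : ℝ) + 1) := by gcongr
    simp only
    linarith
  refine (measure_mono hsub).trans ?_
  rw [hmono.measure_iUnion]
  apply iSup_le
  intro N
  exact compare_fin (fun i : Fin N => u i) (fun i : Fin N => v i) (fun i => hu i) (fun i => hv i) _ _
    (lt_add_of_pos_right _ (by positivity))

lemma bil_cont {n p : ℕ} (u : Fin n → ℝ) (v : Fin p → ℝ) : Continuous (bil u v) := by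
  unfold bil; fun_prop

lemma four_mul {n p : ℕ} (f₁ : (Fin n → Fin p → ℝ) → ENNReal) (f₂ : ℝ → ENNReal)
    (f₃ : (Fin n → ℝ) → ENNReal) (f₄ : (Fin p → ℝ) → ENNReal) (h₁ : Measurable f₁)
    (h₂ : Measurable f₂) (h₃ : Measurable f₃) (h₄ : Measurable f₄) :
    ∫⁻ q, f₁ q.1 * (f₂ q.2.1 * (f₃ q.2.2.1 * f₄ q.2.2.2)) ∂(fourLaw n p) =
      (∫⁻ x, f₁ x ∂(matLaw n p)) * ((∫⁻ x, f₂ x ∂(gaussianReal 0 1)) *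
        ((∫⁻ x, f₃ x ∂(gpi (Fin n))) * (∫⁻ x, f₄ x ∂(gpi (Fin p))))) := by
  have e1 := lintegral_prod_mul (μ := gpi (Fin n)) (ν := gpi (Fin p)) h₃.aemeasurable h₄.aemeasurable
  have m1 : Measurable fun z : (Fin n → ℝ) × (Fin p → ℝ) => f₃ z.1 * f₄ z.2 := by fun_prop
  have e2 := lintegral_prod_mul (μ := (gaussianReal 0 1 : Measure ℝ))
    (ν := (gpi (Fin n)).prod (gpi (Fin p))) h₂.aemeasurable m1.aemeasurable
  have m2 : Measurable fun z : ℝ × (Fin n → ℝ) × (Fin p → ℝ) => f₂ z.1 * (f₃ z.2.1 * f₄ z.2.2) := by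
    fun_prop
  have e3 := lintegral_prod_mul (μ := matLaw n p) (ν := (gaussianReal 0 1 : Measure ℝ).prod
    ((gpi (Fin n)).prod (gpi (Fin p)))) h₁.aemeasurable m2.aemeasurable
  rw [e2, e1] at e3
  exact e3

lemma seq_tail {n p : ℕ} (hn : 0 < n) (hp : 0 < p) (u : ℕ → Fin n → ℝ)
    (v : ℕ → Fin p → ℝ) (hu : ∀ i, ∑ a, u i a ^ 2 = 1) (hv : ∀ i, ∑ a, v i a ^ 2 = 1) (t : ℝ)
    (ht : 0 < t) :
    matLaw n p {X | ∃ i, √n + √p + t < bil (u i) (v i) X} ≤ ENNReal.ofReal (Real.exp (-(t ^ 2 / 2))) := by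
  set s0 := √(n : ℝ) + √(p : ℝ) + t with hs0
  set E : Set (Fin n → Fin p → ℝ) := {X | ∃ i, s0 < bil (u i) (v i) X} with hE
  have mE : MeasurableSet E := by
    rw [hE, Set.ofPred_exists]
    exact MeasurableSet.iUnion fun i => measurableSet_lt measurable_const (bil_cont _ _).measurable
  set f1 : Four n p → ℝ := fun q => E.indicator (fun _ => 1) q.1 * Real.exp (t * (s0 + q.2.1)) with hf1
  set f2 : Four n p → ℝ := fun q =>
    Real.exp (t * (√(∑ a, q.2.2.1 a ^ 2) + √(∑ b, q.2.2.2 b ^ 2))) with hf2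
  have mind : Measurable (E.indicator (fun _ => (1 : ℝ))) := measurable_const.indicator mE
  have m1 : Measurable f1 := by
    apply Measurable.mul
    · exact mind.comp measurable_fst
    · fun_prop
  have m2 : Measurable f2 := by fun_prop
  have n1 : ∀ q, 0 ≤ f1 q := fun q =>
    mul_nonneg (Set.indicator_nonneg (fun _ _ => zero_le_one) _) (Real.exp_pos _).le
  have n2 : ∀ q, 0 ≤ f2 q := fun q => (Real.exp_pos _).le
  have hle : ∫⁻ q, ENNReal.ofReal (f1 q) ∂(fourLaw n p) ≤ ∫⁻ q, ENNReal.ofReal (f2 q) ∂(fourLaw n p) := by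
    rw [lintegral_eq_lintegral_meas_lt _ (Filter.Eventually.of_forall n1) m1.aemeasurable,
      lintegral_eq_lintegral_meas_lt _ (Filter.Eventually.of_forall n2) m2.aemeasurable]
    apply setLIntegral_mono' measurableSet_Ioi
    intro x hx
    have hx : 0 < x := hx
    refine le_trans (measure_mono ?_) (le_trans (compare_seq u v hu hv (Real.log x / t)) (measure_mono ?_))
    · intro q hq
      have hq : x < f1 q := hq
      by_cases hqE : q.1 ∈ E
      · simp only [hf1, Set.indicator_of_mem hqE, one_mul] at hq
        obtain ⟨i, hi⟩ := hqE
        refine ⟨i, ?_⟩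
        rw [div_lt_iff₀ ht]
        have := (Real.log_lt_iff_lt_exp hx).2 hq
        nlinarith
      · simp only [hf1, Set.indicator_of_notMem hqE, zero_mul] at hq
        linarith
    · intro q hq
      have hq : Real.log x / t < √(∑ a, q.2.2.1 a ^ 2) + √(∑ b, q.2.2.2 b ^ 2) := hq
      rw [div_lt_iff₀ ht, Real.log_lt_iff_lt_exp hx, mul_comm] at hq
      exact hq
  have v1 : ∫⁻ q, ENNReal.ofReal (f1 q) ∂(fourLaw n p) =
      matLaw n p E * ENNReal.ofReal (Real.exp (t * s0 + t ^ 2 / 2)) := by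
    have : ∀ q, ENNReal.ofReal (f1 q) = E.indicator (fun _ => (1 : ENNReal)) q.1 *
        (ENNReal.ofReal (Real.exp (t * (s0 + q.2.1))) * (1 * 1)) := by
      intro q
      simp only [hf1, mul_one]
      by_cases hq : q.1 ∈ E
      · simp [Set.indicator_of_mem hq]
      · simp [Set.indicator_of_notMem hq]
    simp only [this]
    rw [four_mul (E.indicator (fun _ => (1 : ENNReal)))
      (fun x => ENNReal.ofReal (Real.exp (t * (s0 + x)))) (fun _ => 1) (fun _ => 1)
      (measurable_const.indicator mE) (by fun_prop) (by fun_prop) (by fun_prop)]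
    rw [lintegral_indicator_const mE, one_mul]
    congr 1
    simp only [lintegral_const, measure_univ, mul_one]
    have e : ∀ x, Real.exp (t * (s0 + x)) = Real.exp (t * s0) * Real.exp (t * x) := by
      intro x; rw [← Real.exp_add]; ring_nf
    simp only [e]
    have hi : Integrable (fun x => Real.exp (t * s0) * Real.exp (t * x)) (gaussianReal 0 1) :=
      (integrable_exp_mul_gaussianReal t).const_mul _
    rw [← ofReal_integral_eq_lintegral_ofReal hi (Filter.Eventually.of_forall fun x => by positivity),
      integral_const_mul]
    have := congrFun (mgf_id_gaussianReal (μ := 0) (v := 1)) t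
    simp only [mgf, id] at this
    rw [this, ← Real.exp_add]
    simp
  have v2 : ∫⁻ q, ENNReal.ofReal (f2 q) ∂(fourLaw n p) ≤
      ENNReal.ofReal (Real.exp (t * (√n + √p) + t ^ 2)) := by
    have : ∀ q, ENNReal.ofReal (f2 q) = 1 * (1 *
        (ENNReal.ofReal (Real.exp (t * √(∑ k, q.2.2.1 k ^ 2))) *
         ENNReal.ofReal (Real.exp (t * √(∑ k, q.2.2.2 k ^ 2))))) := by
      intro q
      simp only [hf2, one_mul]
      rw [← ENNReal.ofReal_mul (Real.exp_pos _).le, ← Real.exp_add, mul_add]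
    simp only [this]
    rw [four_mul (fun _ => 1) (fun _ => 1)
      (fun g : Fin n → ℝ => ENNReal.ofReal (Real.exp (t * √(∑ k, g k ^ 2))))
      (fun g : Fin p → ℝ => ENNReal.ofReal (Real.exp (t * √(∑ k, g k ^ 2))))
      (by fun_prop) (by fun_prop) (by fun_prop) (by fun_prop)]
    simp only [lintegral_const, measure_univ, mul_one, one_mul]
    refine (mul_le_mul' (chi_mgf n hn t ht) (chi_mgf p hp t ht)).trans ?_
    rw [← ENNReal.ofReal_mul (Real.exp_pos _).le, ← Real.exp_add]
    apply le_of_eq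
    ring_nf
  rw [v1] at hle
  have h3 := hle.trans v2
  rw [← ENNReal.le_div_iff_mul_le (Or.inl (by simp [Real.exp_pos])) (Or.inl ENNReal.ofReal_ne_top),
    ← ENNReal.ofReal_div_of_pos (Real.exp_pos _), ← Real.exp_sub] at h3
  refine h3.trans (le_of_eq ?_)
  congr 2
  rw [hs0]; ring

lemma exists_unit_pair {n p : ℕ} (hn : 0 < n) (X : Fin n → Fin p → ℝ) (τ s : ℝ) (hs : 0 < s)
    (hτ : s ^ 2 = n * τ)
    (h : τ < specNorm ((n : ℝ)⁻¹ • ((Matrix.of X)ᵀ * Matrix.of X))) :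
    ∃ (u : Fin n → ℝ) (v : Fin p → ℝ), ∑ a, u a ^ 2 = 1 ∧ ∑ b, v b ^ 2 = 1 ∧ s < bil u v X := by
  have hn' : (0 : ℝ) < n := by exact_mod_cast hn
  have τ0 : 0 < τ := by
    have : 0 < n * τ := by rw [← hτ]; positivity
    exact (mul_pos_iff_of_pos_left hn').mp this
  unfold specNorm at h
  have hne : ((fun x : ℝ => |x|) '' spectrum ℝ ((n : ℝ)⁻¹ • ((Matrix.of X)ᵀ * Matrix.of X))).Nonempty := by
    by_contra hcon
    rw [Set.not_nonempty_iff_eq_empty] at hcon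
    rw [hcon, Real.sSup_empty] at h
    linarith
  obtain ⟨_, ⟨μ, hμ, rfl⟩, hlt⟩ := exists_lt_of_lt_csSup hne h
  rw [← Matrix.spectrum_toLin', ← Module.End.hasEigenvalue_iff_mem_spectrum] at hμ
  obtain ⟨v, hv⟩ := hμ.exists_hasEigenvector
  have hv0 : v ≠ 0 := hv.2
  have hev := hv.apply_eq_smul
  rw [Matrix.toLin'_apply] at hev
  set w : Fin n → ℝ := Matrix.of X *ᵥ v with hw
  have hdot : (n : ℝ)⁻¹ * (∑ a, w a ^ 2) = μ * ∑ b, v b ^ 2 := by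
    have h1 := congrArg (fun z => v ⬝ᵥ z) hev
    simp only [Matrix.smul_mulVec, dotProduct_smul, ← Matrix.mulVec_mulVec, smul_eq_mul] at h1
    rw [Matrix.dotProduct_mulVec, Matrix.vecMul_transpose] at h1
    simp only [dotProduct, ← pow_two] at h1
    exact h1
  have hN : 0 < ∑ b, v b ^ 2 := by
    obtain ⟨b, hb⟩ := Function.ne_iff.1 hv0
    exact Finset.sum_pos' (fun b _ => sq_nonneg _) ⟨b, Finset.mem_univ _, by
      have : v b ≠ 0 := hb
      positivity⟩
  have hR0 : 0 ≤ ∑ a, w a ^ 2 := Finset.sum_nonneg fun b _ => sq_nonneg _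
  set N := ∑ b, v b ^ 2 with hNdef
  set R := ∑ a, w a ^ 2 with hRdef
  have hR : R = n * μ * N := by
    field_simp at hdot
    linarith
  have hμ0 : 0 ≤ μ := by
    by_contra hcon
    push Not at hcon
    have : (n : ℝ) * μ * N < 0 := mul_neg_of_neg_of_pos (mul_neg_of_pos_of_neg hn' hcon) hN
    linarith
  have hlt : τ < |μ| := hlt
  rw [abs_of_nonneg hμ0] at hlt
  have hbig : s ^ 2 * N < R := by
    rw [hR, hτ]; gcongr
  have hRpos : 0 < R := lt_of_le_of_lt (by positivity) hbig
  have sR := Real.sq_sqrt hRpos.le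
  have sN := Real.sq_sqrt hN.le
  have pR := Real.sqrt_pos.2 hRpos
  have pN := Real.sqrt_pos.2 hN
  refine ⟨fun a => w a / √R, fun b => v b / √N, ?_, ?_, ?_⟩
  · simp only [div_pow, ← Finset.sum_div]
    rw [sR, ← hRdef, div_self hRpos.ne']
  · simp only [div_pow, ← Finset.sum_div]
    rw [sN, ← hNdef, div_self hN.ne']
  · have hb : bil (fun a => w a / √R) (fun b => v b / √N) X = R / (√R * √N) := by
      unfold bil
      have : ∀ a, ∑ b, w a / √R * (v b / √N) * X a b = w a ^ 2 / (√R * √N) := by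
        intro a
        have hwa : w a = ∑ b, X a b * v b := rfl
        have : ∀ b, w a / √R * (v b / √N) * X a b = w a / (√R * √N) * (X a b * v b) := by
          intro b; field_simp
        simp only [this]
        rw [← Finset.mul_sum, ← hwa]
        ring
      simp only [this]
      rw [← Finset.sum_div]
    rw [hb, lt_div_iff₀ (by positivity)]
    have h2 : s * √N < √R := by
      apply Real.lt_sqrt_of_sq_lt
      rw [mul_pow, sN]; exact hbig
    nlinarith

theorem wishart_norm_tail_bound
    (n p : ℕ) (hn : 0 < n) (hnp : n ≤ p) :
    (Measure.pi fun _ : Fin n => Measure.pi fun _ : Fin p => (gaussianReal 0 1 : Measure ℝ))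
      {X : Fin n → Fin p → ℝ |
        (1 + Real.sqrt ((p : ℝ) / n)) ^ 2 + (p : ℝ) / n
          < specNorm ((n : ℝ)⁻¹ • ((Matrix.of X)ᵀ * Matrix.of X))}
      ≤ ENNReal.ofReal (Real.exp (-(p : ℝ) / (2 * (Real.sqrt 5 + 2) ^ 2))) := by
  have hp : 0 < p := lt_of_lt_of_le hn hnp
  have hn' : (0 : ℝ) < n := by exact_mod_cast hn
  have hp' : (0 : ℝ) < p := by exact_mod_cast hp
  have hnp' : (n : ℝ) ≤ p := by exact_mod_cast hnp
  have sn := Real.sq_sqrt hn'.le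
  have sp := Real.sq_sqrt hp'.le
  have pn := Real.sqrt_pos.2 hn'
  have pp := Real.sqrt_pos.2 hp'
  have hle : √(n : ℝ) ≤ √(p : ℝ) := Real.sqrt_le_sqrt hnp'
  set s := √((√(n : ℝ) + √(p : ℝ)) ^ 2 + p) with hs
  have hs2 : s ^ 2 = (√(n : ℝ) + √(p : ℝ)) ^ 2 + p := Real.sq_sqrt (by positivity)
  have hspos : 0 < s := Real.sqrt_pos.2 (by positivity)
  have hτ : s ^ 2 = n * ((1 + Real.sqrt ((p : ℝ) / n)) ^ 2 + (p : ℝ) / n) := by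
    rw [hs2, Real.sqrt_div hp'.le]
    have e : (n : ℝ) * ((1 + √(p : ℝ) / √(n : ℝ)) ^ 2 + (p : ℝ) / n)
        = √(n : ℝ) ^ 2 * (1 + √(p : ℝ) / √(n : ℝ)) ^ 2 + p := by
      rw [sn]; field_simp
    rw [e]
    field_simp
  obtain ⟨t, ht⟩ : ∃ t, t = s - √(n : ℝ) - √(p : ℝ) := ⟨_, rfl⟩
  have ht0 : 0 < t := by
    have : √(n : ℝ) + √(p : ℝ) < s := by
      apply Real.lt_sqrt_of_sq_lt
      linarith
    linarith
  have h5 : √(5 : ℝ) ^ 2 = 5 := Real.sq_sqrt (by norm_num)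
  have hs5 : s ≤ √5 * √(p : ℝ) := by
    apply Real.sqrt_le_iff.2
    refine ⟨by positivity, ?_⟩
    rw [mul_pow, h5, sp]
    nlinarith
  have htp : √(p : ℝ) ≤ t * (√5 + 2) := by
    have e1 : t * (s + √(n : ℝ) + √(p : ℝ)) = √(p : ℝ) ^ 2 := by
      rw [ht, sp]; linear_combination hs2
    have e2 : t * (s + √(n : ℝ) + √(p : ℝ)) ≤ t * ((√5 + 2) * √(p : ℝ)) :=
      mul_le_mul_of_nonneg_left (by linarith) ht0.le
    have e3 : √(p : ℝ) * √(p : ℝ) ≤ t * (√5 + 2) * √(p : ℝ) := by nlinarith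
    exact le_of_mul_le_mul_right e3 pp
  -- a dense sequence of pairs of unit vectors
  let K : Type := {k : (Fin n → ℝ) × (Fin p → ℝ) // ∑ a, k.1 a ^ 2 = 1 ∧ ∑ b, k.2 b ^ 2 = 1}
  have : Nonempty K := by
    refine ⟨⟨(Pi.single ⟨0, hn⟩ 1, Pi.single ⟨0, hp⟩ 1), ?_, ?_⟩⟩ <;>
    simp [Pi.single_apply, ite_pow]
  have hmain := seq_tail hn hp (fun i => (TopologicalSpace.denseSeq K i).1.1)
    (fun i => (TopologicalSpace.denseSeq K i).1.2)
    (fun i => (TopologicalSpace.denseSeq K i).2.1) (fun i => (TopologicalSpace.denseSeq K i).2.2) t ht0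
  refine (measure_mono ?_).trans (hmain.trans ?_)
  · intro X hX
    obtain ⟨u, v, hu, hv, huv⟩ := exists_unit_pair hn X _ s hspos hτ hX
    have hopen : IsOpen {k : K | s < bil k.1.1 k.1.2 X} := by
      apply isOpen_lt continuous_const
      unfold bil
      fun_prop
    obtain ⟨i, hi⟩ := (TopologicalSpace.denseRange_denseSeq K).exists_mem_open hopen
      ⟨⟨(u, v), hu, hv⟩, huv⟩
    refine ⟨i, ?_⟩
    have : √(n : ℝ) + √(p : ℝ) + t = s := by rw [ht]; ring
    rw [this]
    exact hi
  · apply ENNReal.ofReal_le_ofReal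
    apply Real.exp_le_exp.2
    have h1 : (p : ℝ) ≤ (t * (√5 + 2)) ^ 2 := by
      rw [← sp]; exact pow_le_pow_left₀ pp.le htp 2
    have h2 : (p : ℝ) / (2 * (√5 + 2) ^ 2) ≤ t ^ 2 / 2 := by
      rw [div_le_div_iff₀ (by positivity) (by norm_num)]
      nlinarith
    rw [neg_div]
    linarith
end

section
/- Let n ≤ p and let X be an n × p random matrix whose np entries are i.i.d. N(0,1) random variables. Let W = (1/n)·XᵀX. Then with probability at least 1 − exp(−p/(2(√5 + 2)²)), the spectral norm of W − I_p is at most 4p/n. -/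
open MeasureTheory ProbabilityTheory Matrix

namespace WB
open Real

lemma int_exp_abs (c : ℝ) : Integrable (fun x : ℝ => exp (c * |x|)) (gaussianReal 0 1) := by
  have h1 := integrable_exp_mul_gaussianReal (μ := 0) (v := 1) c
  have h2 := integrable_exp_mul_gaussianReal (μ := 0) (v := 1) (-c)
  refine (h1.add h2).mono' (by fun_prop) (Filter.Eventually.of_forall fun x => ?_)
  rw [Real.norm_eq_abs, abs_of_pos (exp_pos _)]
  simp only [Pi.add_apply]
  rcases abs_cases x with h | h <;> rw [h.1]
  · linarith [exp_pos (-c * x)]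
  · have : c * -x = -c * x := by ring
    rw [this]; linarith [exp_pos (c * x)]

noncomputable abbrev gam (κ : Type*) [Fintype κ] : Measure (κ → ℝ) :=
  Measure.pi (fun _ : κ => gaussianReal 0 1)

lemma int_exp_sum_abs {κ : Type*} [Fintype κ] (c : ℝ) :
    Integrable (fun z : κ → ℝ => exp (c * ∑ k, |z k|)) (gam κ) := by
  have := Integrable.fintype_prod (μ := fun _ : κ => gaussianReal 0 1)
    (f := fun _ x => exp (c * |x|)) (fun _ => int_exp_abs c)
  simpa only [← exp_sum, ← Finset.mul_sum] using this

lemma int_of_bound {κ : Type*} [Fintype κ] {F : (κ → ℝ) → ℝ} (hF : Continuous F) {K c : ℝ}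
    (hb : ∀ z, |F z| ≤ K * exp (c * ∑ k, |z k|)) : Integrable F (gam κ) :=
  ((int_exp_sum_abs c).const_mul K).mono' hF.aestronglyMeasurable
    (Filter.Eventually.of_forall fun z => by simpa using hb z)

lemma int_of_bound1 {F : ℝ → ℝ} (hF : Continuous F) {K c : ℝ}
    (hb : ∀ z, |F z| ≤ K * exp (c * |z|)) : Integrable F (gaussianReal 0 1) :=
  ((int_exp_abs c).const_mul K).mono' hF.aestronglyMeasurable
    (Filter.Eventually.of_forall fun z => by simpa using hb z)

lemma integrable_gauss_iff (F : ℝ → ℝ) :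
    Integrable F (gaussianReal 0 1) ↔ Integrable (fun x => gaussianPDFReal 0 1 x * F x) := by
  rw [gaussianReal_of_var_ne_zero _ one_ne_zero,
    integrable_withDensity_iff_integrable_smul' (measurable_gaussianPDF 0 1)
      (Filter.Eventually.of_forall fun x => gaussianPDF_lt_top)]
  simp [toReal_gaussianPDF]

lemma pdf_eq (x : ℝ) : gaussianPDFReal 0 1 x = (√(2 * π))⁻¹ * exp (-(x ^ 2) / 2) := by
  simp [gaussianPDFReal]

lemma pdf_deriv (x : ℝ) :
    HasDerivAt (gaussianPDFReal 0 1) (- x * gaussianPDFReal 0 1 x) x := by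
  have h : gaussianPDFReal 0 1 = fun x => (√(2 * π))⁻¹ * exp (-(x ^ 2) / 2) := funext pdf_eq
  rw [h]
  have := ((((hasDerivAt_id x).pow 2).neg.div_const 2).exp).const_mul (√(2 * π))⁻¹
  refine this.congr_deriv ?_
  simp only [id_eq, Pi.pow_apply, Pi.neg_apply]
  push_cast
  ring

lemma stein1 {g g' : ℝ → ℝ} (hg : Continuous g) (hg' : Continuous g')
    (hd : ∀ x, HasDerivAt g (g' x) x) {K c : ℝ}
    (hb : ∀ x, |g x| ≤ K * exp (c * |x|)) (hb' : ∀ x, |g' x| ≤ K * exp (c * |x|)) :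
    ∫ x, x * g x ∂(gaussianReal 0 1) = ∫ x, g' x ∂(gaussianReal 0 1) := by
  have i0 := (integrable_gauss_iff _).1 (int_of_bound1 hg hb)
  have i1 := (integrable_gauss_iff _).1 (int_of_bound1 hg' hb')
  have i2 : Integrable (fun x => x * g x) (gaussianReal 0 1) := by
    refine int_of_bound1 (K := K) (c := c + 1) (by fun_prop) fun x => ?_
    rw [abs_mul, add_mul, exp_add, one_mul]
    have h1 : |x| ≤ exp |x| := by linarith [add_one_le_exp |x|]
    calc |x| * |g x| ≤ exp |x| * (K * exp (c * |x|)) :=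
          mul_le_mul h1 (hb x) (abs_nonneg _) (exp_pos _).le
      _ = _ := by ring
  have i2' := (integrable_gauss_iff _).1 i2
  have hz := integral_eq_zero_of_hasDerivAt_of_integrable
    (f := fun x => gaussianPDFReal 0 1 x * g x)
    (f' := fun x => gaussianPDFReal 0 1 x * g' x - gaussianPDFReal 0 1 x * (x * g x))
    (fun x => by
      have := (pdf_deriv x).mul (hd x)
      refine this.congr_deriv ?_
      ring) (i1.sub i2') i0
  rw [integral_sub i1 i2'] at hz
  rw [integral_gaussianReal_eq_integral_smul one_ne_zero,
    integral_gaussianReal_eq_integral_smul one_ne_zero]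
  simp only [smul_eq_mul]
  linarith

lemma update_mp {κ : Type*} [Fintype κ] [DecidableEq κ] (k : κ) :
    MeasurePreserving (fun q : (κ → ℝ) × ℝ => Function.update q.1 k q.2)
      ((gam κ).prod (gaussianReal 0 1)) (gam κ) := by
  have hm : Measurable (fun q : (κ → ℝ) × ℝ => Function.update q.1 k q.2) := by
    refine measurable_pi_iff.2 fun j => ?_
    by_cases h : j = k
    · subst h; simpa using measurable_snd
    · simp only [Function.update_of_ne h]; fun_prop
  refine ⟨hm, ?_⟩
  symm
  refine Measure.pi_eq fun s hs => ?_
  rw [Measure.map_apply hm (MeasurableSet.univ_pi hs)]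
  have : (fun q : (κ → ℝ) × ℝ => Function.update q.1 k q.2) ⁻¹' (Set.univ.pi s)
      = (Set.univ.pi (Function.update s k Set.univ)) ×ˢ s k := by
    ext q
    simp only [Set.mem_preimage, Set.mem_pi, Set.mem_univ, true_imp_iff, Set.mem_prod]
    constructor
    · intro h
      refine ⟨fun j => ?_, by simpa using h k⟩
      by_cases hj : j = k
      · subst hj; simp
      · simpa [Function.update_of_ne hj] using h j
    · rintro ⟨h, h'⟩ j
      by_cases hj : j = k
      · subst hj; simpa using h'
      · simpa [Function.update_of_ne hj] using h j
  rw [this, Measure.prod_prod, Measure.pi_pi, ← Finset.mul_prod_erase _ _ (Finset.mem_univ k),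
    ← Finset.mul_prod_erase _ (fun i => (gaussianReal 0 1) (s i)) (Finset.mem_univ k)]
  simp only [Function.update_self, measure_univ, one_mul]
  rw [mul_comm]
  congr 1
  refine Finset.prod_congr rfl fun j hj => ?_
  rw [Function.update_of_ne (Finset.ne_of_mem_erase hj)]

lemma integral_update {κ : Type*} [Fintype κ] [DecidableEq κ] (k : κ) {F : (κ → ℝ) → ℝ}
    (hF : Integrable F (gam κ)) :
    ∫ z, F z ∂(gam κ) = ∫ z, ∫ x, F (Function.update z k x) ∂(gaussianReal 0 1) ∂(gam κ) := by
  have h := update_mp k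
  rw [← h.map_eq, integral_map h.measurable.aemeasurable (by rw [h.map_eq]; exact hF.1),
    integral_prod]
  · rw [h.map_eq]
  · exact (h.integrable_comp hF.1).2 hF

lemma sum_update {κ : Type*} [Fintype κ] [DecidableEq κ] (k : κ) (z : κ → ℝ) (x : ℝ) :
    ∑ j, |Function.update z k x j| ≤ |x| + ∑ j, |z j| := by
  rw [← Finset.add_sum_erase _ _ (Finset.mem_univ k),
    ← Finset.add_sum_erase _ (fun j => |z j|) (Finset.mem_univ k)]
  have : ∑ j ∈ Finset.univ.erase k, |Function.update z k x j|
      = ∑ j ∈ Finset.univ.erase k, |z j| :=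
    Finset.sum_congr rfl fun j hj => by
      rw [Function.update_of_ne (Finset.ne_of_mem_erase hj)]
  rw [this]; simp

lemma int_mul_coord {κ : Type*} [Fintype κ] (k : κ) {F : (κ → ℝ) → ℝ}
    (hF : Continuous F) {K c : ℝ} 
    (hb : ∀ z, |F z| ≤ K * exp (c * ∑ k, |z k|)) : Integrable (fun z => z k * F z) (gam κ) := by
  refine int_of_bound (K := K) (c := c + 1) (by fun_prop) fun z => ?_
  rw [abs_mul, add_mul, exp_add, one_mul]
  have h1 : |z k| ≤ exp (∑ k, |z k|) := by
    have := Finset.single_le_sum (f := fun k => |z k|) (fun i _ => abs_nonneg _)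
      (Finset.mem_univ k)
    linarith [add_one_le_exp (∑ k, |z k|)]
  calc |z k| * |F z| ≤ exp (∑ k, |z k|) * (K * exp (c * ∑ k, |z k|)) :=
        mul_le_mul h1 (hb z) (abs_nonneg _) (exp_pos _).le
    _ = _ := by ring

lemma stein {κ : Type*} [Fintype κ] [DecidableEq κ] (k : κ) {F F' : (κ → ℝ) → ℝ}
    (hF : Continuous F) (hF' : Continuous F')
    (hd : ∀ z x, HasDerivAt (fun x => F (Function.update z k x)) (F' (Function.update z k x)) x)
    {K c : ℝ} (hc : 0 ≤ c)
    (hb : ∀ z, |F z| ≤ K * exp (c * ∑ k, |z k|))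
    (hb' : ∀ z, |F' z| ≤ K * exp (c * ∑ k, |z k|)) :
    ∫ z, z k * F z ∂(gam κ) = ∫ z, F' z ∂(gam κ) := by
  have hK : 0 ≤ K := by
    have := (abs_nonneg _).trans (hb 0)
    exact nonneg_of_mul_nonneg_left this (exp_pos _)
  rw [integral_update k (int_mul_coord k hF hb), integral_update k (int_of_bound hF' hb')]
  congr 1
  ext z
  simp only [Function.update_self]
  have hu : Continuous fun x : ℝ => Function.update z k x := by fun_prop
  have key : ∀ x, K * exp (c * ∑ j, |Function.update z k x j|)
      ≤ (K * exp (c * ∑ j, |z j|)) * exp (c * |x|) := fun x => by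
    rw [mul_assoc, ← exp_add]
    gcongr
    have := mul_le_mul_of_nonneg_left (sum_update k z x) hc
    linarith
  exact stein1 (g := fun x => F (Function.update z k x)) (g' := fun x => F' (Function.update z k x))
    (hF.comp hu) (hF'.comp hu) (hd z)
    (fun x => (hb _).trans (key x)) (fun x => (hb' _).trans (key x))

lemma gauss_sq_integrable {c : ℝ} (hc : c < 1 / 2) :
    Integrable (fun x : ℝ => exp (c * x ^ 2)) (gaussianReal 0 1) := by
  rw [integrable_gauss_iff]
  have := (integrable_exp_neg_mul_sq (b := 1 / 2 - c) (by linarith)).const_mul (√(2 * π))⁻¹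
  refine this.congr (Filter.Eventually.of_forall fun x => ?_)
  simp only
  rw [pdf_eq, mul_assoc, ← exp_add]
  congr 2; ring

lemma gauss_sq {c : ℝ} (hc : c < 1 / 2) :
    ∫ x, exp (c * x ^ 2) ∂(gaussianReal 0 1) = √((1 - 2 * c)⁻¹) := by
  rw [integral_gaussianReal_eq_integral_smul one_ne_zero]
  have : ∀ x : ℝ, gaussianPDFReal 0 1 x • exp (c * x ^ 2)
      = (√(2 * π))⁻¹ * exp (-(1 / 2 - c) * x ^ 2) := fun x => by
    rw [pdf_eq, smul_eq_mul, mul_assoc, ← exp_add]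
    congr 2; ring
  simp_rw [this]
  rw [integral_const_mul, integral_gaussian, ← Real.sqrt_inv, ← Real.sqrt_mul (by positivity)]
  congr 1
  have : 1 / 2 - c ≠ 0 := by linarith
  have : 1 - 2 * c ≠ 0 := by linarith
  have := pi_ne_zero
  field_simp


section cmp
variable {ι : Type*} [Fintype ι]

noncomputable def S (b : ℝ) (x : ι → ℝ) : ℝ := ∑ i, exp (b * x i)
noncomputable def f0 (l b : ℝ) (x : ι → ℝ) : ℝ := S b x ^ (l / b)
noncomputable def f1 (l b : ℝ) (i : ι) (x : ι → ℝ) : ℝ :=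
  l * (S b x ^ (l / b - 1) * exp (b * x i))
noncomputable def f2 [DecidableEq ι] (l b : ℝ) (i j : ι) (x : ι → ℝ) : ℝ :=
  l * (((l / b - 1) * S b x ^ (l / b - 2) * (b * exp (b * x j))) * exp (b * x i)
    + if i = j then S b x ^ (l / b - 1) * (b * exp (b * x i)) else 0)

lemma S_pos [Nonempty ι] (b : ℝ) (x : ι → ℝ) : 0 < S b x :=
  Finset.sum_pos (fun _ _ => exp_pos _) Finset.univ_nonempty

lemma le_S (b : ℝ) (x : ι → ℝ) (i : ι) : exp (b * x i) ≤ S b x :=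
  Finset.single_le_sum (f := fun i => exp (b * x i)) (fun _ _ => (exp_pos _).le)
    (Finset.mem_univ i)

lemma S_cont (b : ℝ) : Continuous (S (ι := ι) b) := by
  unfold S; fun_prop

lemma f0_cont [Nonempty ι] (l b : ℝ) : Continuous (f0 (ι := ι) l b) := by
  unfold f0
  exact (S_cont b).rpow_const fun x => Or.inl (S_pos b x).ne'

lemma f1_cont [Nonempty ι] (l b : ℝ) (i : ι) : Continuous (f1 l b i) := by
  unfold f1
  have := (S_cont (ι := ι) b).rpow_const (p := l / b - 1) fun x => Or.inl (S_pos b x).ne'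
  fun_prop

lemma f2_cont [Nonempty ι] [DecidableEq ι] (l b : ℝ) (i j : ι) : Continuous (f2 l b i j) := by
  unfold f2
  have := (S_cont (ι := ι) b).rpow_const (p := l / b - 1) fun x => Or.inl (S_pos b x).ne'
  have := (S_cont (ι := ι) b).rpow_const (p := l / b - 2) fun x => Or.inl (S_pos b x).ne'
  split_ifs <;> fun_prop

lemma S_deriv (b : ℝ) {x : ℝ → ι → ℝ} {x' : ι → ℝ} {t : ℝ}
    (h : ∀ i, HasDerivAt (fun t => x t i) (x' i) t) :
    HasDerivAt (fun t => S b (x t)) (∑ i, b * exp (b * x t i) * x' i) t := by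
  unfold S
  refine (HasDerivAt.fun_sum fun i _ => ((h i).const_mul b).exp).congr_deriv ?_
  refine Finset.sum_congr rfl fun i _ => by ring

lemma f0_deriv [Nonempty ι] {l b : ℝ} (hb : 0 < b) {x : ℝ → ι → ℝ} {x' : ι → ℝ} {t : ℝ}
    (h : ∀ i, HasDerivAt (fun t => x t i) (x' i) t) :
    HasDerivAt (fun t => f0 l b (x t)) (∑ i, f1 l b i (x t) * x' i) t := by
  unfold f0 f1
  refine ((S_deriv b h).rpow_const (p := l / b) (Or.inl (S_pos b _).ne')).congr_deriv ?_
  rw [Finset.sum_mul, Finset.sum_mul]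
  refine Finset.sum_congr rfl fun i _ => ?_
  field_simp

lemma f1_deriv [Nonempty ι] [DecidableEq ι] {l b : ℝ} (i : ι)
    {x : ℝ → ι → ℝ} {x' : ι → ℝ} {t : ℝ}
    (h : ∀ i, HasDerivAt (fun t => x t i) (x' i) t) :
    HasDerivAt (fun t => f1 l b i (x t)) (∑ j, f2 l b i j (x t) * x' j) t := by
  unfold f1 f2
  refine ((((S_deriv b h).rpow_const (p := l / b - 1) (Or.inl (S_pos b _).ne')).mul
    ((h i).const_mul b).exp).const_mul l).congr_deriv ?_
  simp only [mul_add, add_mul, Finset.sum_add_distrib, mul_ite, ite_mul, mul_zero, zero_mul,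
    Finset.sum_ite_eq, Finset.mem_univ, if_true, Finset.sum_mul, Finset.mul_sum]
  have e : l / b - 1 - 1 = l / b - 2 := by ring
  rw [e]
  congr 1
  · refine Finset.sum_congr rfl fun i _ => ?_
    ring
  · ring

lemma f0_nonneg (l b : ℝ) (x : ι → ℝ) : 0 ≤ f0 l b x :=
  rpow_nonneg (Finset.sum_nonneg fun _ _ => (exp_pos _).le) _

lemma f1_bd [Nonempty ι] {l b : ℝ} (hl : 0 < l) (i : ι) (x : ι → ℝ) :
    |f1 l b i x| ≤ l * f0 l b x := by
  unfold f1 f0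
  have h := S_pos b x
  rw [abs_of_nonneg (by positivity)]
  gcongr
  calc S b x ^ (l / b - 1) * exp (b * x i) ≤ S b x ^ (l / b - 1) * S b x := by
        gcongr; exact le_S b x i
    _ = _ := by rw [rpow_sub_one h.ne']; field_simp

lemma f2_bd [Nonempty ι] [DecidableEq ι] {l b : ℝ} (hl : 0 < l) (hlb : l ≤ b) (i j : ι)
    (x : ι → ℝ) : |f2 l b i j x| ≤ 2 * l * b * f0 l b x := by
  unfold f2 f0
  have h := S_pos b x
  have hb : 0 < b := hl.trans_le hlb
  have ha : l / b ≤ 1 := (div_le_one hb).2 hlb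
  have ha0 : 0 < l / b := by positivity
  have hi := le_S b x i
  have hj := le_S b x j
  have e1 : S b x ^ (l / b - 1) * S b x = S b x ^ (l / b) := by
    rw [rpow_sub_one h.ne']; field_simp
  have e2 : S b x ^ (l / b - 2) * S b x * S b x = S b x ^ (l / b) := by
    rw [show l / b - 2 = l / b - 1 - 1 by ring, rpow_sub_one h.ne', rpow_sub_one h.ne']; field_simp
  have b1 : |((l / b - 1) * S b x ^ (l / b - 2) * (b * exp (b * x j))) * exp (b * x i)|
      ≤ b * S b x ^ (l / b) := by
    rw [abs_mul, abs_mul, abs_mul, abs_of_nonpos (sub_nonpos.2 ha),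
      abs_of_pos (by positivity : 0 < b * exp (b * x j)), abs_of_pos (exp_pos _),
      abs_of_pos (by positivity : 0 < S b x ^ (l / b - 2))]
    calc -(l / b - 1) * S b x ^ (l / b - 2) * (b * exp (b * x j)) * exp (b * x i)
        ≤ 1 * S b x ^ (l / b - 2) * (b * S b x) * S b x := by
          gcongr; linarith
      _ = b * (S b x ^ (l / b - 2) * S b x * S b x) := by ring
      _ = _ := by rw [e2]
  have b2 : |if i = j then S b x ^ (l / b - 1) * (b * exp (b * x i)) else 0|
      ≤ b * S b x ^ (l / b) := by
    split_ifs
    · rw [abs_of_pos (by positivity)]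
      calc S b x ^ (l / b - 1) * (b * exp (b * x i)) ≤ S b x ^ (l / b - 1) * (b * S b x) := by
            gcongr
        _ = b * (S b x ^ (l / b - 1) * S b x) := by ring
        _ = _ := by rw [e1]
    · rw [abs_zero]; positivity
  rw [abs_mul, abs_of_pos hl]
  calc _ ≤ l * (b * S b x ^ (l / b) + b * S b x ^ (l / b)) := by
        gcongr
        exact (abs_add_le _ _).trans (add_le_add b1 b2)
    _ = _ := by ring

lemma f0_bd [Nonempty ι] {l b : ℝ} (hl : 0 < l) (hlb : l ≤ b) {R : ℝ}
    {x : ι → ℝ} (hx : ∀ i, x i ≤ R) :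
    f0 l b x ≤ (Fintype.card ι : ℝ) ^ (l / b) * exp (l * R) := by
  have hb : 0 < b := hl.trans_le hlb
  unfold f0
  have : S b x ≤ Fintype.card ι * exp (b * R) := by
    unfold S
    calc _ ≤ ∑ i : ι, exp (b * R) := Finset.sum_le_sum fun i _ => by gcongr; exact hx i
      _ = _ := by simp
  calc _ ≤ (Fintype.card ι * exp (b * R)) ^ (l / b) :=
        rpow_le_rpow (S_pos b x).le this (by positivity)
    _ = _ := by
        rw [mul_rpow (by positivity) (exp_pos _).le, ← exp_mul]
        congr 2; field_simp

lemma f2_sum [Nonempty ι] [DecidableEq ι] {l b : ℝ} (hb : 0 < b) (x : ι → ℝ) :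
    ∑ i, ∑ j, f2 l b i j x = l ^ 2 * f0 l b x := by
  have h := S_pos b x
  unfold f2 f0
  simp only [mul_add, Finset.sum_add_distrib, mul_ite, mul_zero,
    Finset.sum_ite_eq, Finset.mem_univ, if_true]
  have e1 : S b x ^ (l / b - 1) * S b x = S b x ^ (l / b) := by
    rw [rpow_sub_one h.ne']; field_simp
  have e2 : S b x ^ (l / b - 2) * S b x * S b x = S b x ^ (l / b) := by
    rw [show l / b - 2 = l / b - 1 - 1 by ring, rpow_sub_one h.ne', rpow_sub_one h.ne']; field_simp
  have a1 : ∑ i, ∑ j, l * ((l / b - 1) * S b x ^ (l / b - 2) * (b * exp (b * x j)) * exp (b * x i))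
      = l * (l / b - 1) * b * (S b x ^ (l / b - 2) * S b x * S b x) := by
    conv_rhs => rw [show l * (l / b - 1) * b * (S b x ^ (l / b - 2) * S b x * S b x)
      = (l * (l / b - 1) * b * S b x ^ (l / b - 2)) * (S b x * S b x) by ring]
    generalize S b x ^ (l / b - 2) = q
    unfold S
    rw [Finset.sum_mul_sum, Finset.mul_sum]
    refine Finset.sum_congr rfl fun i _ => ?_
    rw [Finset.mul_sum]
    refine Finset.sum_congr rfl fun j _ => ?_
    ring
  have a2 : ∑ i, l * (S b x ^ (l / b - 1) * (b * exp (b * x i)))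
      = l * b * (S b x ^ (l / b - 1) * S b x) := by
    generalize S b x ^ (l / b - 1) = q
    unfold S
    rw [Finset.mul_sum, Finset.mul_sum]
    refine Finset.sum_congr rfl fun i _ => ?_
    ring
  rw [a1, a2, e1, e2]
  field_simp
  ring

lemma f2_offdiag [Nonempty ι] [DecidableEq ι] {l b : ℝ} (hl : 0 < l) (hlb : l ≤ b) {i j : ι}
    (hij : i ≠ j) (x : ι → ℝ) : f2 l b i j x ≤ 0 := by
  have h := S_pos b x
  have hb : 0 < b := hl.trans_le hlb
  have ha : l / b ≤ 1 := (div_le_one hb).2 hlb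
  unfold f2
  rw [if_neg hij, add_zero]
  have : 0 ≤ l * ((1 - l / b) * S b x ^ (l / b - 2) * (b * exp (b * x j)) * exp (b * x i)) := by
    have : 0 ≤ 1 - l / b := by linarith
    positivity
  linarith

lemma f2_ge [Nonempty ι] [DecidableEq ι] {l b : ℝ} (hl : 0 < l) (hlb : l ≤ b) (x : ι → ℝ)
    {D : ι → ι → ℝ} (hd : ∀ i, D i i = 1) (hD : ∀ i j, D i j ≤ 1) :
    l ^ 2 * f0 l b x ≤ ∑ i, ∑ j, D i j * f2 l b i j x := by
  rw [← f2_sum (hl.trans_le hlb)]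
  refine Finset.sum_le_sum fun i _ => Finset.sum_le_sum fun j _ => ?_
  by_cases h : i = j
  · subst h; rw [hd]; simp
  · nlinarith [f2_offdiag hl hlb h x, hD i j]

end cmp

section cmp2
set_option linter.unusedSectionVars false
variable {ι κ : Type*} [Fintype ι] [Fintype κ]

/-- matrix-vector product -/
noncomputable def mv (C : ι → κ → ℝ) (z : κ → ℝ) (i : ι) : ℝ := ∑ k, C i k * z k

lemma mv_cont (C : ι → κ → ℝ) : Continuous (mv C) := by
  unfold mv; fun_prop

lemma mv_bd {C : ι → κ → ℝ} {M : ℝ} (hC : ∀ i k, |C i k| ≤ M) (z : κ → ℝ) (i : ι) :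
    |mv C z i| ≤ M * ∑ k, |z k| := by
  unfold mv
  refine (Finset.abs_sum_le_sum_abs _ _).trans ?_
  rw [Finset.mul_sum]
  refine Finset.sum_le_sum fun k _ => ?_
  rw [abs_mul]
  exact mul_le_mul_of_nonneg_right (hC i k) (abs_nonneg _)

/-- a uniform growth constant -/
noncomputable def KK (ι : Type*) [Fintype ι] (l b : ℝ) : ℝ :=
  (1 + l + 2 * l * b) * (Fintype.card ι : ℝ) ^ (l / b)

lemma all_bd [Nonempty ι] [DecidableEq ι] {l b : ℝ} (hl : 0 < l) (hlb : l ≤ b)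
    {C : ι → κ → ℝ} (hC : ∀ i k, |C i k| ≤ 2) (z : κ → ℝ) :
    |f0 l b (mv C z)| ≤ KK ι l b * exp (2 * l * ∑ k, |z k|) ∧
    (∀ i, |f1 l b i (mv C z)| ≤ KK ι l b * exp (2 * l * ∑ k, |z k|)) ∧
    (∀ i j, |f2 l b i j (mv C z)| ≤ KK ι l b * exp (2 * l * ∑ k, |z k|)) := by
  have hb : 0 < b := hl.trans_le hlb
  have h := f0_bd hl hlb (x := mv C z) (R := 2 * ∑ k, |z k|)
    (fun i => (le_abs_self _).trans (mv_bd hC z i))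
  have e : l * (2 * ∑ k, |z k|) = 2 * l * ∑ k, |z k| := by ring
  rw [e] at h
  have h0 := f0_nonneg l b (mv C z)
  have hmul : ∀ c, 0 ≤ c → c ≤ 1 + l + 2 * l * b →
      c * f0 l b (mv C z) ≤ KK ι l b * exp (2 * l * ∑ k, |z k|) := fun c hc hc' => by
    unfold KK
    rw [mul_assoc]
    exact mul_le_mul hc' h h0 (hc.trans hc')
  have hlb' : 0 < l * b := by positivity
  refine ⟨?_, fun i => ?_, fun i j => ?_⟩
  · rw [abs_of_nonneg h0]
    have := hmul 1 zero_le_one (by nlinarith)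
    linarith
  · exact (f1_bd hl i _).trans (hmul l hl.le (by nlinarith))
  · exact (f2_bd hl hlb i j _).trans (hmul (2 * l * b) (by positivity) (by nlinarith))

lemma KK_nonneg {l b : ℝ} (hl : 0 < l) (hlb : l ≤ b) : 0 ≤ KK ι l b := by
  have hb : 0 < b := hl.trans_le hlb
  unfold KK; positivity

lemma ibp [Nonempty ι] [DecidableEq ι] [DecidableEq κ] {l b : ℝ} (hl : 0 < l) (hlb : l ≤ b)
    {C : ι → κ → ℝ} (hC : ∀ i k, |C i k| ≤ 2) (i : ι) (k : κ) :
    ∫ z, z k * f1 l b i (mv C z) ∂(gam κ)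
      = ∑ j, C j k * ∫ z, f2 l b i j (mv C z) ∂(gam κ) := by
  have hKK := KK_nonneg (ι := ι) hl hlb
  have hcard : (1 : ℝ) ≤ Fintype.card ι := by exact_mod_cast Fintype.card_pos
  have c2 : ∀ j, Continuous fun z => f2 l b i j (mv C z) :=
    fun j => (f2_cont l b i j).comp (mv_cont C)
  rw [stein k (F := fun z => f1 l b i (mv C z))
    (F' := fun z => ∑ j, f2 l b i j (mv C z) * C j k)
    ((f1_cont l b i).comp (mv_cont C)) (by fun_prop) ?_ (K := Fintype.card ι * (2 * KK ι l b))
    (c := 2 * l) (by positivity) ?_ ?_]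
  · rw [integral_finsetSum]
    · refine Finset.sum_congr rfl fun j _ => ?_
      rw [integral_mul_const, mul_comm]
    · intro j _
      exact (int_of_bound (c2 j) fun z => (all_bd hl hlb hC z).2.2 i j).mul_const _
  · intro z x
    refine f1_deriv i (x := fun x => mv C (Function.update z k x)) (x' := fun j => C j k) fun j => ?_
    unfold mv
    have : ∀ k', HasDerivAt (fun x => C j k' * Function.update z k x k')
        (if k' = k then C j k' else 0) x := fun k' => by
      by_cases hk : k' = k
      · subst hk
        simpa using (hasDerivAt_id x).const_mul (C j k')
      · simpa [Function.update_of_ne hk, hk] using hasDerivAt_const x (C j k' * z k')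
    refine (HasDerivAt.fun_sum fun k' _ => this k').congr_deriv ?_
    simp
  · intro z
    refine ((all_bd hl hlb hC z).2.1 i).trans ?_
    gcongr
    nlinarith
  · intro z
    refine (Finset.abs_sum_le_sum_abs _ _).trans ?_
    calc _ ≤ ∑ j : ι, (2 * KK ι l b) * exp (2 * l * ∑ k, |z k|) := by
          refine Finset.sum_le_sum fun j _ => ?_
          rw [abs_mul]
          have := mul_le_mul ((all_bd hl hlb hC z).2.2 i j) (hC j k) (abs_nonneg _) (by positivity)
          linarith
      _ = _ := by simp; ring

lemma phi_deriv [Nonempty ι] [DecidableEq ι] {l b : ℝ} (hl : 0 < l) (hlb : l ≤ b)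
    {C C' : ℝ → ι → κ → ℝ} (hC : ∀ t i k, |C t i k| ≤ 2) (hC' : ∀ t i k, |C' t i k| ≤ 2)
    (hd : ∀ t i k, HasDerivAt (fun t => C t i k) (C' t i k) t) (t : ℝ) :
    HasDerivAt (fun t => ∫ z, f0 l b (mv (C t) z) ∂(gam κ))
      (∫ z, ∑ i, f1 l b i (mv (C t) z) * mv (C' t) z i ∂(gam κ)) t := by
  have hKK := KK_nonneg (ι := ι) hl hlb
  have c0 : ∀ t, Continuous fun z => f0 l b (mv (C t) z) :=
    fun t => (f0_cont l b).comp (mv_cont _)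
  have c1 : ∀ t i, Continuous fun z => f1 l b i (mv (C t) z) :=
    fun t i => (f1_cont l b i).comp (mv_cont _)
  have c3 : ∀ t i, Continuous fun z => mv (C' t) z i :=
    fun t i => (continuous_apply i).comp (mv_cont _)
  refine (hasDerivAt_integral_of_dominated_loc_of_deriv_le (s := Set.univ)
    (F := fun t z => f0 l b (mv (C t) z))
    (F' := fun t z => ∑ i, f1 l b i (mv (C t) z) * mv (C' t) z i)
    (bound := fun z => (Fintype.card ι * (2 * KK ι l b)) * exp ((2 * l + 1) * ∑ k, |z k|))
    Filter.univ_mem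
    (Filter.Eventually.of_forall fun t => (c0 t).aestronglyMeasurable)
    (int_of_bound (c0 t) fun z => (all_bd hl hlb (hC t) z).1)
    (Continuous.aestronglyMeasurable (by fun_prop))
    (Filter.Eventually.of_forall fun z t _ => ?_)
    ((int_exp_sum_abs _).const_mul _)
    (Filter.Eventually.of_forall fun z t _ => ?_)).2
  · rw [norm_eq_abs]
    refine (Finset.abs_sum_le_sum_abs _ _).trans ?_
    have hs : ∑ k, |z k| ≤ exp (∑ k, |z k|) := by linarith [add_one_le_exp (∑ k, |z k|)]
    calc _ ≤ ∑ j : ι, (2 * KK ι l b) * exp ((2 * l + 1) * ∑ k, |z k|) := by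
          refine Finset.sum_le_sum fun j _ => ?_
          rw [abs_mul, add_mul, exp_add, one_mul]
          have := mul_le_mul ((all_bd hl hlb (hC t) z).2.1 j)
            ((mv_bd (hC' t) z j).trans (mul_le_mul_of_nonneg_left hs zero_le_two))
            (abs_nonneg _) (by positivity)
          linarith
      _ = _ := by simp; ring
  · refine f0_deriv (hl.trans_le hlb) (x := fun t => mv (C t) z) fun i => ?_
    unfold mv
    exact HasDerivAt.fun_sum fun k _ => (hd t i k).mul_const _

lemma phi_deriv_eq [Nonempty ι] [DecidableEq ι] [DecidableEq κ] {l b : ℝ} (hl : 0 < l)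
    (hlb : l ≤ b)
    {C C' : ι → κ → ℝ} (hC : ∀ i k, |C i k| ≤ 2) :
    (∫ z, ∑ i, f1 l b i (mv C z) * mv C' z i ∂(gam κ))
      = ∫ z, ∑ i, ∑ j, (∑ k, C' i k * C j k) * f2 l b i j (mv C z) ∂(gam κ) := by
  have i2 : ∀ i j, Integrable (fun z => f2 l b i j (mv C z)) (gam κ) := fun i j =>
    int_of_bound ((f2_cont l b i j).comp (mv_cont C)) fun z => (all_bd hl hlb hC z).2.2 i j
  have i1 : ∀ i k, Integrable (fun z => z k * f1 l b i (mv C z)) (gam κ) := fun i k =>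
    int_mul_coord k ((f1_cont l b i).comp (mv_cont C)) fun z => (all_bd hl hlb hC z).2.1 i
  have e : ∀ z i, f1 l b i (mv C z) * mv C' z i = ∑ k, C' i k * (z k * f1 l b i (mv C z)) := by
    intro z i
    conv_lhs => rw [show mv C' z i = ∑ k, C' i k * z k from rfl]
    rw [Finset.mul_sum]
    exact Finset.sum_congr rfl fun k _ => by ring
  simp_rw [e]
  rw [integral_finsetSum _ fun i _ => integrable_finsetSum _ fun k _ => (i1 i k).const_mul _,
    integral_finsetSum _ fun i _ => integrable_finsetSum _ fun j _ => (i2 i j).const_mul _]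
  refine Finset.sum_congr rfl fun i _ => ?_
  rw [integral_finsetSum _ fun k _ => (i1 i k).const_mul _,
    integral_finsetSum _ fun j _ => (i2 i j).const_mul _]
  simp_rw [integral_const_mul, ibp hl hlb hC, Finset.mul_sum, Finset.sum_mul]
  rw [Finset.sum_comm]
  exact Finset.sum_congr rfl fun j _ => Finset.sum_congr rfl fun k _ => by ring

theorem comparison [Nonempty ι] [DecidableEq ι] [DecidableEq κ] {l b : ℝ} (hl : 0 < l)
    (hlb : l ≤ b) {A B : ι → κ → ℝ} (hA : ∀ i k, |A i k| ≤ 1) (hB : ∀ i k, |B i k| ≤ 1)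
    (orth : ∀ i j, ∑ k, A i k * B j k = 0)
    (hdiag : ∀ i, ∑ k, B i k * B i k - ∑ k, A i k * A i k = 1)
    (hoff : ∀ i j, ∑ k, B i k * B j k - ∑ k, A i k * A j k ≤ 1) :
    (∫ z, f0 l b (mv A z) ∂(gam κ)) * exp (l ^ 2 / 2) ≤ ∫ z, f0 l b (mv B z) ∂(gam κ) := by
  set C : ℝ → ι → κ → ℝ := fun t i k => cos t * A i k + sin t * B i k with hCdef
  set C' : ℝ → ι → κ → ℝ := fun t i k => -sin t * A i k + cos t * B i k with hC'def
  have aux : ∀ x y u v : ℝ, |x| ≤ 1 → |y| ≤ 1 → |u| ≤ 1 → |v| ≤ 1 → |x * u + y * v| ≤ 2 := by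
    intro x y u v hx hy hu hv
    refine (abs_add_le _ _).trans ?_
    rw [abs_mul, abs_mul]
    have h1 := mul_le_mul hx hu (abs_nonneg _) zero_le_one
    have h2 := mul_le_mul hy hv (abs_nonneg _) zero_le_one
    linarith
  have hC : ∀ t i k, |C t i k| ≤ 2 := fun t i k =>
    aux _ _ _ _ (abs_cos_le_one t) (abs_sin_le_one t) (hA i k) (hB i k)
  have hC' : ∀ t i k, |C' t i k| ≤ 2 := fun t i k =>
    aux _ _ _ _ (by rw [abs_neg]; exact abs_sin_le_one t) (abs_cos_le_one t) (hA i k) (hB i k)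
  have hd : ∀ t i k, HasDerivAt (fun t => C t i k) (C' t i k) t := fun t i k =>
    ((hasDerivAt_cos t).mul_const _).add ((hasDerivAt_sin t).mul_const _)
  set D : ι → ι → ℝ := fun i j => ∑ k, B i k * B j k - ∑ k, A i k * A j k with hD
  have hCC : ∀ t i j, ∑ k, C' t i k * C t j k = sin t * cos t * D i j := by
    intro t i j
    have e : ∀ k, C' t i k * C t j k = sin t * cos t * (B i k * B j k) - sin t * cos t * (A i k * A j k)
        - sin t ^ 2 * (A i k * B j k) + cos t ^ 2 * (A j k * B i k) := fun k => by
      simp only [hCdef, hC'def]; ring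
    simp_rw [e]
    rw [Finset.sum_add_distrib, Finset.sum_sub_distrib, Finset.sum_sub_distrib,
      ← Finset.mul_sum, ← Finset.mul_sum, ← Finset.mul_sum, ← Finset.mul_sum, orth, orth]
    simp only [hD]; ring
  set φ : ℝ → ℝ := fun t => ∫ z, f0 l b (mv (C t) z) ∂(gam κ) with hφ
  have hφ' := fun t => phi_deriv (κ := κ) hl hlb hC hC' hd t
  have hψ : ∀ t, HasDerivAt (fun t => φ t * exp (-(l ^ 2 * sin t ^ 2 / 2)))
      (((∫ z, ∑ i, f1 l b i (mv (C t) z) * mv (C' t) z i ∂(gam κ))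
        - l ^ 2 * (sin t * cos t) * φ t) * exp (-(l ^ 2 * sin t ^ 2 / 2))) t := by
    intro t
    have h1 : HasDerivAt (fun t => -(l ^ 2 * sin t ^ 2 / 2)) (-(l ^ 2 * (sin t * cos t))) t := by
      refine ((((hasDerivAt_sin t).fun_pow 2).const_mul (l ^ 2)).div_const 2).fun_neg.congr_deriv ?_
      push_cast
      ring
    refine ((hφ' t).mul h1.exp).congr_deriv ?_
    simp only [hφ]
    ring
  have hmono : MonotoneOn (fun t => φ t * exp (-(l ^ 2 * sin t ^ 2 / 2))) (Set.Icc 0 (π / 2)) := by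
    refine monotoneOn_of_deriv_nonneg (convex_Icc _ _)
      (fun t _ => (hψ t).continuousAt.continuousWithinAt)
      (fun t _ => (hψ t).differentiableAt.differentiableWithinAt) fun t ht => ?_
    rw [interior_Icc] at ht
    rw [(hψ t).deriv]
    refine mul_nonneg ?_ (exp_pos _).le
    rw [phi_deriv_eq hl hlb (hC t), sub_nonneg, hφ]
    simp only
    rw [← integral_const_mul]
    have hsc : 0 ≤ sin t * cos t :=
      mul_nonneg (sin_nonneg_of_nonneg_of_le_pi ht.1.le (by linarith [ht.2, pi_pos]))
        (cos_nonneg_of_neg_pi_div_two_le_of_le (by linarith [ht.1, pi_pos]) ht.2.le)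
    refine integral_mono ?_ ?_ fun z => ?_
    · exact (int_of_bound ((f0_cont l b).comp (mv_cont _))
        fun z => (all_bd hl hlb (hC t) z).1).const_mul _
    · exact integrable_finsetSum _ fun i _ => integrable_finsetSum _ fun j _ =>
        (int_of_bound ((f2_cont l b i j).comp (mv_cont _))
        fun z => (all_bd hl hlb (hC t) z).2.2 i j).const_mul _
    · simp only [hCC, mul_assoc (sin t * cos t), ← Finset.mul_sum]
      have := mul_le_mul_of_nonneg_left (f2_ge hl hlb (mv (C t) z) (D := D) hdiag hoff) hsc
      linarith
  have h := hmono (Set.left_mem_Icc.2 (by positivity)) (Set.right_mem_Icc.2 (by positivity))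
    (by positivity : (0 : ℝ) ≤ π / 2)
  have hC0 : C 0 = A := by funext i k; simp [hCdef]
  have hC1 : C (π / 2) = B := by funext i k; simp [hCdef]
  simp only [hφ, hC0, hC1, sin_zero, sin_pi_div_two] at h
  simp only [ne_eq, OfNat.ofNat_ne_zero, not_false_eq_true, zero_pow, mul_zero, zero_div, neg_zero,
    exp_zero, mul_one, one_pow, Real.exp_neg] at h
  rwa [← div_eq_mul_inv, le_div_iff₀ (exp_pos _)] at h

end cmp2

section final
variable {n p : ℕ}

abbrev KI (n p : ℕ) := (Fin n × Fin p) ⊕ (Fin n ⊕ Fin p)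

noncomputable def AA {ι : Type*} (u : ι → Fin n → ℝ) (v : ι → Fin p → ℝ) (i : ι) : KI n p → ℝ
  | Sum.inl q => u i q.1 * v i q.2
  | Sum.inr _ => 0

noncomputable def BB {ι : Type*} (u : ι → Fin n → ℝ) (v : ι → Fin p → ℝ) (i : ι) : KI n p → ℝ
  | Sum.inl _ => 0
  | Sum.inr (Sum.inl a) => u i a
  | Sum.inr (Sum.inr b) => v i b

lemma abs_le_one_of_sum {α : Type*} [Fintype α] {u : α → ℝ} (hu : ∑ a, u a ^ 2 = 1) (a : α) :
    |u a| ≤ 1 := by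
  have := Finset.single_le_sum (f := fun a => u a ^ 2) (fun _ _ => sq_nonneg _) (Finset.mem_univ a)
  rw [hu] at this
  exact (sq_le_one_iff_abs_le_one _).1 this

lemma inner_le_one {α : Type*} [Fintype α] {u w : α → ℝ} (hu : ∑ a, u a ^ 2 = 1)
    (hw : ∑ a, w a ^ 2 = 1) : ∑ a, u a * w a ≤ 1 := by
  have : ∑ a, u a * w a ≤ ∑ a, (u a ^ 2 / 2 + w a ^ 2 / 2) :=
    Finset.sum_le_sum fun a _ => by nlinarith [sq_nonneg (u a - w a)]
  rw [Finset.sum_add_distrib, ← Finset.sum_div, ← Finset.sum_div, hu, hw] at this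
  linarith

lemma chi_bd {n : ℕ} (hn : 0 < n) {l : ℝ} (hl : 0 < l) :
    √((1 - 2 * (l / (2 * (√n + l))))⁻¹) ^ n ≤ exp (l * √n / 2) := by
  have hs : 0 < √(n : ℝ) := Real.sqrt_pos.2 (by exact_mod_cast hn)
  have hsn : √(n : ℝ) * √n = n := Real.mul_self_sqrt (Nat.cast_nonneg n)
  have e : (1 - 2 * (l / (2 * (√n + l))))⁻¹ = 1 + l / √n := by
    have : 1 - 2 * (l / (2 * (√n + l))) = √n / (√n + l) := by field_simp; ring
    rw [this, inv_div]; field_simp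
  have h1 : √((1 - 2 * (l / (2 * (√n + l))))⁻¹) ≤ exp (l / √n / 2) := by
    rw [e]
    apply Real.sqrt_le_iff.2 ⟨(exp_pos _).le, ?_⟩
    rw [← exp_nat_mul]
    have := add_one_le_exp (l / √n)
    have e' : ((2 : ℕ) : ℝ) * (l / √n / 2) = l / √n := by push_cast; ring
    rw [e']; linarith
  calc _ ≤ exp (l / √n / 2) ^ n := pow_le_pow_left₀ (Real.sqrt_nonneg _) h1 n
    _ = _ := by
      rw [← exp_nat_mul]
      congr 1
      nth_rewrite 1 [← hsn]
      field_simp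

/-- coefficients -/
noncomputable def cc (n p : ℕ) (l : ℝ) : KI n p → ℝ
  | Sum.inl _ => 0
  | Sum.inr (Sum.inl _) => l / (2 * (√n + l))
  | Sum.inr (Sum.inr _) => l / (2 * (√p + l))

lemma cc_lt (hn : 0 < n) (hp : 0 < p) {l : ℝ} (hl : 0 < l) (k : KI n p) :
    cc n p l k < 1 / 2 := by
  have hs : 0 < √(n : ℝ) := Real.sqrt_pos.2 (by exact_mod_cast hn)
  have hs' : 0 < √(p : ℝ) := Real.sqrt_pos.2 (by exact_mod_cast hp)
  rcases k with _ | _ | _ <;> simp only [cc]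
  · norm_num
  · rw [div_lt_div_iff₀ (by positivity) (by norm_num)]; linarith
  · rw [div_lt_div_iff₀ (by positivity) (by norm_num)]; linarith

lemma Y_bd (hn : 0 < n) (hp : 0 < p) {ι : Type*} [Fintype ι] [Nonempty ι] {l b : ℝ} (hl : 0 < l)
    (hlb : l ≤ b) {u : ι → Fin n → ℝ} {v : ι → Fin p → ℝ}
    (hu : ∀ i, ∑ a, u i a ^ 2 = 1) (hv : ∀ i, ∑ a, v i a ^ 2 = 1) :
    ∫ z, f0 l b (mv (BB u v) z) ∂(gam (KI n p)) ≤
      (Fintype.card ι : ℝ) ^ (l / b) * exp (l * (√n + √p) + l ^ 2) := by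
  have hs : 0 < √(n : ℝ) := Real.sqrt_pos.2 (by exact_mod_cast hn)
  have hs' : 0 < √(p : ℝ) := Real.sqrt_pos.2 (by exact_mod_cast hp)
  have lin : ∀ {m : ℕ} (w z : Fin m → ℝ) (r : ℝ), 0 < r → ∑ a, w a ^ 2 = 1 →
      ∑ a, w a * z a ≤ r / 2 + ∑ a, 1 / (2 * r) * z a ^ 2 := by
    intro m w z r hr hw
    have : ∑ a, w a * z a ≤ ∑ a, (r / 2 * w a ^ 2 + 1 / (2 * r) * z a ^ 2) :=
      Finset.sum_le_sum fun a _ => by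
        have : r / 2 * w a ^ 2 + 1 / (2 * r) * z a ^ 2 - w a * z a
            = (r * w a - z a) ^ 2 / (2 * r) := by field_simp; ring
        have h2 : 0 ≤ (r * w a - z a) ^ 2 / (2 * r) := by positivity
        linarith
    rwa [Finset.sum_add_distrib, ← Finset.mul_sum, hw, mul_one] at this
  have hR : ∀ z : KI n p → ℝ, f0 l b (mv (BB u v) z) ≤
      ((Fintype.card ι : ℝ) ^ (l / b) * exp (l * ((√n + l) / 2 + (√p + l) / 2))) *
        ∏ k, exp (cc n p l k * z k ^ 2) := by
    intro z
    have := f0_bd hl hlb (x := mv (BB u v) z) (R := ((√n + l) / 2 +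
      ∑ a : Fin n, 1 / (2 * (√n + l)) * z (Sum.inr (Sum.inl a)) ^ 2) + ((√p + l) / 2 +
      ∑ a : Fin p, 1 / (2 * (√p + l)) * z (Sum.inr (Sum.inr a)) ^ 2)) (fun i => by
        unfold mv
        simp only [Fintype.sum_sum_type, BB, zero_mul, Finset.sum_const_zero, zero_add]
        exact add_le_add (lin (u i) _ _ (by positivity) (hu i))
          (lin (v i) _ _ (by positivity) (hv i)))
    refine this.trans (le_of_eq ?_)
    rw [mul_assoc, ← exp_sum, ← exp_add]
    congr 2
    simp only [Fintype.sum_sum_type, cc, zero_mul, Finset.sum_const_zero, zero_add,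
      ← Finset.mul_sum]
    ring
  have hint : Integrable (fun z : KI n p → ℝ => ∏ k, exp (cc n p l k * z k ^ 2)) (gam (KI n p)) :=
    Integrable.fintype_prod (μ := fun _ : KI n p => gaussianReal 0 1)
      (f := fun k x => exp (cc n p l k * x ^ 2)) fun k => gauss_sq_integrable (cc_lt hn hp hl k)
  calc _ ≤ ∫ z, ((Fintype.card ι : ℝ) ^ (l / b) * exp (l * ((√n + l) / 2 + (√p + l) / 2))) *
        ∏ k, exp (cc n p l k * z k ^ 2) ∂(gam (KI n p)) :=
        integral_mono_of_nonneg (Filter.Eventually.of_forall fun z => f0_nonneg _ _ _)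
          (hint.const_mul _) (Filter.Eventually.of_forall hR)
    _ = ((Fintype.card ι : ℝ) ^ (l / b) * exp (l * ((√n + l) / 2 + (√p + l) / 2))) *
        ∏ k, √((1 - 2 * cc n p l k)⁻¹) := by
        rw [integral_const_mul, integral_fintype_prod_eq_prod (fun k x => exp (cc n p l k * x ^ 2))]
        congr 1
        exact Finset.prod_congr rfl fun k _ => gauss_sq (cc_lt hn hp hl k)
    _ ≤ ((Fintype.card ι : ℝ) ^ (l / b) * exp (l * ((√n + l) / 2 + (√p + l) / 2))) *
        (exp (l * √n / 2) * exp (l * √p / 2)) := by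
        gcongr
        simp only [Fintype.prod_sum_type, cc]
        simp only [Finset.prod_const, Finset.card_univ, Fintype.card_fin, mul_zero, sub_zero, inv_one,
          Real.sqrt_one, one_pow, one_mul]
        exact mul_le_mul (chi_bd hn hl) (chi_bd hp hl) (by positivity) (exp_pos _).le
    _ = _ := by
        rw [mul_assoc, ← exp_add, ← exp_add]
        congr 2; ring

lemma cmp_XY {ι : Type*} [Fintype ι] [Nonempty ι] {l b : ℝ} (hl : 0 < l)
    (hlb : l ≤ b) {u : ι → Fin n → ℝ} {v : ι → Fin p → ℝ}
    (hu : ∀ i, ∑ a, u i a ^ 2 = 1) (hv : ∀ i, ∑ a, v i a ^ 2 = 1) :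
    (∫ z, f0 l b (mv (AA u v) z) ∂(gam (KI n p))) * exp (l ^ 2 / 2)
      ≤ ∫ z, f0 l b (mv (BB u v) z) ∂(gam (KI n p)) := by
  classical
  have hAA : ∀ i j, ∑ k, AA u v i k * AA u v j k
      = (∑ a, u i a * u j a) * (∑ a, v i a * v j a) := fun i j => by
    simp only [Fintype.sum_sum_type, Fintype.sum_prod_type, AA, mul_zero, Finset.sum_const_zero,
      add_zero]
    rw [Finset.sum_mul_sum]
    exact Finset.sum_congr rfl fun a _ => Finset.sum_congr rfl fun b _ => by ring
  have hBB : ∀ i j, ∑ k, BB u v i k * BB u v j k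
      = (∑ a, u i a * u j a) + (∑ a, v i a * v j a) := fun i j => by
    simp only [Fintype.sum_sum_type, BB, mul_zero, Finset.sum_const_zero, zero_add]
  refine comparison hl hlb ?_ ?_ ?_ ?_ ?_
  · rintro i (⟨a, c⟩ | k) <;> simp only [AA]
    · rw [abs_mul]
      exact mul_le_one₀ (abs_le_one_of_sum (hu i) a) (abs_nonneg _) (abs_le_one_of_sum (hv i) c)
    · simp
  · rintro i (q | a | a) <;> simp only [BB]
    · simp
    · exact abs_le_one_of_sum (hu i) a
    · exact abs_le_one_of_sum (hv i) a
  · intro i j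
    refine Finset.sum_eq_zero fun k _ => ?_
    rcases k with q | k <;> simp [AA, BB]
  · intro i
    rw [hAA, hBB]
    simp only [← pow_two, hu, hv]; norm_num
  · intro i j
    rw [hAA, hBB]
    nlinarith [inner_le_one (hu i) (hu j), inner_le_one (hv i) (hv j)]

/-- restriction to the matrix block -/
noncomputable def TT (n p : ℕ) (z : KI n p → ℝ) : Fin n → Fin p → ℝ := fun a c => z (Sum.inl (a, c))

lemma TT_mp (n p : ℕ) : MeasurePreserving (TT n p) (gam (KI n p))
    (Measure.pi fun _ : Fin n => Measure.pi fun _ : Fin p => (gaussianReal 0 1 : Measure ℝ)) := by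
  have h1 := measurePreserving_sumPiEquivProdPi (fun _ : KI n p => gaussianReal 0 1)
  have h2 := measurePreserving_fst (μ := gam (Fin n × Fin p)) (ν := gam (Fin n ⊕ Fin p))
  have h3 : MeasurePreserving (MeasurableEquiv.curry (Fin n) (Fin p) ℝ) (gam (Fin n × Fin p))
      (Measure.pi fun _ : Fin n => Measure.pi fun _ : Fin p => (gaussianReal 0 1 : Measure ℝ)) := by
    refine ⟨MeasurableEquiv.measurable _, ?_⟩
    have := Measure.infinitePi_map_curry (ι := Fin n) (κ := Fin p) 
      (fun _ _ => (gaussianReal 0 1 : Measure ℝ))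
    simpa only [Measure.infinitePi_eq_pi] using this
  exact h3.comp (h2.comp h1)

def EE {ι : Type*} (u : ι → Fin n → ℝ) (v : ι → Fin p → ℝ) (s : ℝ) : Set (Fin n → Fin p → ℝ) :=
  {X | ∃ i, s < ∑ a, ∑ c, u i a * v i c * X a c}

lemma tail (hn : 0 < n) (hp : 0 < p) {ι : Type*} [Fintype ι] [Nonempty ι] {l : ℝ} (hl : 0 < l)
    {u : ι → Fin n → ℝ} {v : ι → Fin p → ℝ}
    (hu : ∀ i, ∑ a, u i a ^ 2 = 1) (hv : ∀ i, ∑ a, v i a ^ 2 = 1) (s : ℝ) :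
    (Measure.pi fun _ : Fin n => Measure.pi fun _ : Fin p => (gaussianReal 0 1 : Measure ℝ))
      (EE u v s) ≤ ENNReal.ofReal (exp (l * (√n + √p) + l ^ 2 / 2 - l * s)) := by
  classical
  have hmeas : MeasurableSet (EE u v s) := by
    have : EE u v s = ⋃ i, {X | s < ∑ a, ∑ c, u i a * v i c * X a c} := by
      ext X; simp [EE]
    rw [this]
    exact MeasurableSet.iUnion fun i => (isOpen_lt (by fun_prop) (by fun_prop)).measurableSet
  rw [← (TT_mp n p).measure_preimage hmeas.nullMeasurableSet]
  have main : ∀ b, l ≤ b → (gam (KI n p)).real (TT n p ⁻¹' EE u v s) ≤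
      (Fintype.card ι : ℝ) ^ (l / b) * exp (l * (√n + √p) + l ^ 2 / 2 - l * s) := by
    intro b hlb
    have hb : 0 < b := hl.trans_le hlb
    have hAA : ∀ z i, mv (AA u v) z i = ∑ a, ∑ c, u i a * v i c * TT n p z a c := fun z i => by
      simp only [mv, Fintype.sum_sum_type, Fintype.sum_prod_type, AA, zero_mul,
        Finset.sum_const_zero, add_zero, TT]
    have hA1 : ∀ i k, |AA u v i k| ≤ 2 := by
      rintro i (⟨a, c⟩ | k) <;> simp only [AA]
      · rw [abs_mul]
        exact (mul_le_one₀ (abs_le_one_of_sum (hu i) a) (abs_nonneg _)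
          (abs_le_one_of_sum (hv i) c)).trans one_le_two
      · simp
    have hint : Integrable (fun z => f0 l b (mv (AA u v) z)) (gam (KI n p)) :=
      int_of_bound ((f0_cont l b).comp (mv_cont _)) fun z => (all_bd hl hlb hA1 z).1
    have mk := mul_meas_ge_le_integral_of_nonneg
      (Filter.Eventually.of_forall fun z => f0_nonneg l b (mv (AA u v) z)) hint (exp (l * s))
    have sub : TT n p ⁻¹' EE u v s ⊆ {z | exp (l * s) ≤ f0 l b (mv (AA u v) z)} := by
      rintro z ⟨i, hi⟩
      rw [← hAA] at hi
      have h1 : exp (b * s) ≤ S b (mv (AA u v) z) :=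
        (exp_le_exp.2 (mul_le_mul_of_nonneg_left hi.le hb.le)).trans (le_S b _ i)
      have h2 := rpow_le_rpow (exp_pos _).le h1 (by positivity : 0 ≤ l / b)
      rw [← exp_mul] at h2
      have e : b * s * (l / b) = l * s := by field_simp
      rwa [e] at h2
    have h3 := measureReal_mono (μ := gam (KI n p)) sub
    have h4 := cmp_XY (n := n) (p := p) hl hlb hu hv
    have h5 := Y_bd hn hp hl hlb hu hv
    have h6 : (gam (KI n p)).real (TT n p ⁻¹' EE u v s) * (exp (l * s) * exp (l ^ 2 / 2))
        ≤ (Fintype.card ι : ℝ) ^ (l / b) * exp (l * (√n + √p) + l ^ 2) := by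
      refine le_trans ?_ (h4.trans h5)
      rw [← mul_assoc]
      gcongr
      refine le_trans ?_ mk
      rw [mul_comm]
      gcongr
    rw [← exp_add, ← le_div_iff₀ (exp_pos _), mul_div_assoc, ← exp_sub] at h6
    refine h6.trans (le_of_eq ?_)
    congr 2; ring
  have lim : Filter.Tendsto (fun b : ℝ => (Fintype.card ι : ℝ) ^ (l / b) *
      exp (l * (√n + √p) + l ^ 2 / 2 - l * s)) Filter.atTop
      (nhds (1 * exp (l * (√n + √p) + l ^ 2 / 2 - l * s))) := by
    refine Filter.Tendsto.mul_const _ ?_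
    have h0 : Filter.Tendsto (fun b : ℝ => l / b) Filter.atTop (nhds 0) :=
      Filter.Tendsto.const_div_atTop Filter.tendsto_id l
    have hc : (Fintype.card ι : ℝ) ≠ 0 := by exact_mod_cast Fintype.card_ne_zero
    have := (Real.continuousAt_const_rpow hc (b := 0)).tendsto.comp h0
    simpa [Function.comp_def] using this
  rw [one_mul] at lim
  have := ge_of_tendsto lim (Filter.eventually_atTop.2 ⟨l, main⟩)
  rw [← ofReal_measureReal]
  exact ENNReal.ofReal_le_ofReal this

/-- pairs of unit vectors -/
abbrev UV (n p : ℕ) := {q : (Fin n → ℝ) × (Fin p → ℝ) // ∑ a, q.1 a ^ 2 = 1 ∧ ∑ a, q.2 a ^ 2 = 1}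

lemma tail_sup (hn : 0 < n) (hp : 0 < p) {l : ℝ} (hl : 0 < l) (s : ℝ) :
    (Measure.pi fun _ : Fin n => Measure.pi fun _ : Fin p => (gaussianReal 0 1 : Measure ℝ))
      {X | ∃ q : UV n p, s < ∑ a, ∑ c, q.1.1 a * q.1.2 c * X a c}
      ≤ ENNReal.ofReal (exp (l * (√n + √p) + l ^ 2 / 2 - l * s)) := by
  have : Nonempty (UV n p) := by
    refine ⟨⟨(fun a => if a = ⟨0, hn⟩ then 1 else 0, fun a => if a = ⟨0, hp⟩ then 1 else 0), ?_, ?_⟩⟩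
      <;> simp
  set d := TopologicalSpace.denseSeq (UV n p) with hd
  have hdense := TopologicalSpace.denseRange_denseSeq (UV n p)
  let E : ℕ → Set (Fin n → Fin p → ℝ) := fun N =>
    EE (fun i : Fin (N + 1) => (d i).1.1) (fun i : Fin (N + 1) => (d i).1.2) s
  have hE : Monotone E := by
    rintro N M hNM X ⟨i, hi⟩
    exact ⟨⟨i, by omega⟩, hi⟩
  have hsub : {X | ∃ q : UV n p, s < ∑ a, ∑ c, q.1.1 a * q.1.2 c * X a c} ⊆ ⋃ N, E N := by
    rintro X ⟨q, hq⟩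
    have ho : IsOpen {q : UV n p | s < ∑ a, ∑ c, q.1.1 a * q.1.2 c * X a c} :=
      isOpen_lt (by fun_prop) (by fun_prop)
    obtain ⟨k, hk⟩ := hdense.exists_mem_open ho ⟨q, hq⟩
    exact Set.mem_iUnion.2 ⟨k, ⟨⟨k, by omega⟩, hk⟩⟩
  refine (measure_mono hsub).trans ?_
  rw [hE.measure_iUnion]
  exact iSup_le fun N => tail hn hp hl (fun i : Fin (N + 1) => (d i).2.1)
    (fun i : Fin (N + 1) => (d i).2.2) s

lemma det_part (hn : 0 < n) (hnp : n ≤ p) (X : Fin n → Fin p → ℝ)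
    (h : ¬ specNorm ((n : ℝ)⁻¹ • ((Matrix.of X)ᵀ * Matrix.of X) - 1) ≤ 4 * (p : ℝ) / n) :
    ∃ q : UV n p, √((n : ℝ) + 4 * p) < ∑ a, ∑ c, q.1.1 a * q.1.2 c * X a c := by
  by_contra hcon
  push Not at hcon
  apply h
  have hn' : (0 : ℝ) < n := by exact_mod_cast hn
  have hnp' : (n : ℝ) ≤ p := by exact_mod_cast hnp
  unfold specNorm
  refine Real.sSup_le ?_ (by positivity)
  rintro _ ⟨μ, hμ, rfl⟩
  rw [← Matrix.spectrum_toLin', ← Module.End.hasEigenvalue_iff_mem_spectrum] at hμ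
  obtain ⟨w, hw⟩ := hμ.exists_hasEigenvector
  have hw0 := hw.2
  have hw1 := hw.apply_eq_smul
  rw [Matrix.toLin'_apply, Matrix.sub_mulVec, Matrix.one_mulVec, Matrix.smul_mulVec,
    ← Matrix.mulVec_mulVec] at hw1
  set y := (Matrix.of X) *ᵥ w with hy
  have hyy : y ⬝ᵥ y = n * (μ + 1) * (w ⬝ᵥ w) := by
    have h1 : (Matrix.of X)ᵀ *ᵥ y = (n * (μ + 1)) • w := by
      have h2 : (n : ℝ)⁻¹ • ((Matrix.of X)ᵀ *ᵥ y) = (μ + 1) • w := by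
        rw [add_smul, one_smul, ← hw1]; abel
      rw [mul_smul, ← h2, smul_smul, mul_inv_cancel₀ hn'.ne', one_smul]
    have h3 : w ⬝ᵥ ((Matrix.of X)ᵀ *ᵥ y) = y ⬝ᵥ y := by
      rw [Matrix.mulVec_transpose, dotProduct_comm, ← Matrix.dotProduct_mulVec]
    rw [← h3, h1, dotProduct_smul, smul_eq_mul]
  have hww : 0 < w ⬝ᵥ w := by
    have := dotProduct_self_eq_zero (v := w)
    have h2 : 0 ≤ w ⬝ᵥ w := Finset.sum_nonneg fun i _ => mul_self_nonneg _
    exact lt_of_le_of_ne h2 fun h => hw0 (this.1 h.symm)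
  have hyy0 : 0 ≤ y ⬝ᵥ y := Finset.sum_nonneg fun i _ => mul_self_nonneg _
  have hμ0 : 0 ≤ n * (μ + 1) := by
    rw [hyy] at hyy0
    exact nonneg_of_mul_nonneg_left hyy0 hww
  have hμ1 : -1 ≤ μ := by
    have := nonneg_of_mul_nonneg_right hμ0 hn'
    linarith
  have h1p : 1 ≤ 4 * (p : ℝ) / n := by rw [le_div_iff₀ hn']; linarith
  suffices hub : n * (μ + 1) ≤ n + 4 * p by
    rw [abs_le]
    refine ⟨by linarith, ?_⟩
    rw [le_div_iff₀ hn']; linarith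
  by_contra! hlt
  have hpos : 0 < n * (μ + 1) := by
    have : (0 : ℝ) ≤ n + 4 * p := by positivity
    linarith
  have hyy1 : 0 < y ⬝ᵥ y := by rw [hyy]; positivity
  have nrm : ∀ {m : ℕ} (x : Fin m → ℝ), 0 < x ⬝ᵥ x → ∑ a, ((√(x ⬝ᵥ x))⁻¹ * x a) ^ 2 = 1 := by
    intro m x hx
    simp_rw [mul_pow]
    rw [← Finset.mul_sum, inv_pow, Real.sq_sqrt hx.le]
    have : ∑ i, x i ^ 2 = x ⬝ᵥ x := Finset.sum_congr rfl fun i _ => pow_two _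
    rw [this, inv_mul_cancel₀ hx.ne']
  have := hcon ⟨(fun a => (√(y ⬝ᵥ y))⁻¹ * y a, fun a => (√(w ⬝ᵥ w))⁻¹ * w a), nrm y hyy1, nrm w hww⟩
  have e : ∑ a, ∑ c, (√(y ⬝ᵥ y))⁻¹ * y a * ((√(w ⬝ᵥ w))⁻¹ * w c) * X a c
      = (√(y ⬝ᵥ y))⁻¹ * (√(w ⬝ᵥ w))⁻¹ * (y ⬝ᵥ y) := by
    generalize (√(y ⬝ᵥ y))⁻¹ = r
    generalize (√(w ⬝ᵥ w))⁻¹ = r'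
    conv_rhs => rw [dotProduct, Finset.mul_sum]
    refine Finset.sum_congr rfl fun a _ => ?_
    have hya : y a = ∑ c, X a c * w c := rfl
    calc ∑ c, r * y a * (r' * w c) * X a c = ∑ c, (r * r' * y a) * (X a c * w c) :=
          Finset.sum_congr rfl fun c _ => by ring
      _ = (r * r' * y a) * y a := by rw [← Finset.mul_sum, ← hya]
      _ = _ := by ring
  simp only [e] at this
  have e2 : (√(y ⬝ᵥ y))⁻¹ * (√(w ⬝ᵥ w))⁻¹ * (y ⬝ᵥ y) = √(n * (μ + 1)) := by
    have hsy : 0 < √(y ⬝ᵥ y) := Real.sqrt_pos.2 hyy1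
    have hsw : 0 < √(w ⬝ᵥ w) := Real.sqrt_pos.2 hww
    have : √(y ⬝ᵥ y) = √(n * (μ + 1)) * √(w ⬝ᵥ w) := by rw [hyy, Real.sqrt_mul hpos.le]
    have h2 : y ⬝ᵥ y = √(y ⬝ᵥ y) * √(y ⬝ᵥ y) := (Real.mul_self_sqrt hyy1.le).symm
    calc _ = (√(y ⬝ᵥ y))⁻¹ * (√(w ⬝ᵥ w))⁻¹ * (√(y ⬝ᵥ y) * √(y ⬝ᵥ y)) := by rw [← h2]
      _ = (√(w ⬝ᵥ w))⁻¹ * √(y ⬝ᵥ y) := by field_simp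
      _ = _ := by rw [this]; field_simp
  rw [e2] at this
  have hh := Real.sqrt_lt_sqrt (by positivity) hlt
  linarith

lemma expo (hn : 0 < n) (hnp : n ≤ p) :
    (√5 - 2) * √p * (√n + √p) + ((√5 - 2) * √p) ^ 2 / 2 - (√5 - 2) * √p * √((n : ℝ) + 4 * p)
      ≤ -(p : ℝ) / (2 * (√5 + 2) ^ 2) := by
  have h5 : √5 * √5 = (5 : ℝ) := Real.mul_self_sqrt (by norm_num)
  have h52 : 2 < √(5 : ℝ) := by
    apply Real.lt_sqrt_of_sq_lt; norm_num
  have hsp : √(p : ℝ) * √p = p := Real.mul_self_sqrt (Nat.cast_nonneg p)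
  have hsn : √(n : ℝ) * √n = n := Real.mul_self_sqrt (Nat.cast_nonneg n)
  have hle : √(n : ℝ) ≤ √p := Real.sqrt_le_sqrt (by exact_mod_cast hnp)
  have hn0 := Real.sqrt_nonneg (n : ℝ)
  have hp0 := Real.sqrt_nonneg (p : ℝ)
  have key : √n + (√5 - 1) * √p ≤ √((n : ℝ) + 4 * p) := by
    apply Real.le_sqrt_of_sq_le
    have e : (√n + (√5 - 1) * √p) ^ 2 = √(n : ℝ) * √n + 2 * (√5 - 1) * (√n * √p)
        + (√5 * √5 - 2 * √5 + 1) * (√p * √p) := by ring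
    rw [e, h5, hsp, hsn]
    have : √n * √p ≤ (p : ℝ) := by
      have h0 := mul_le_mul_of_nonneg_right hle hp0
      rwa [hsp] at h0
    nlinarith
  have e : -(p : ℝ) / (2 * (√5 + 2) ^ 2) = -((√5 - 2) * √p) ^ 2 / 2 := by
    have h1 : (√5 - 2) * (√5 + 2) = (1 : ℝ) := by nlinarith
    have h2 : (√5 - 2 : ℝ) = (√5 + 2)⁻¹ := eq_inv_of_mul_eq_one_left h1
    rw [h2, mul_pow, pow_two (√(p : ℝ)), hsp]
    field_simp
  rw [e]
  have hl : 0 ≤ (√5 - 2) * √(p : ℝ) := mul_nonneg (by linarith) hp0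
  have := mul_le_mul_of_nonneg_left key hl
  nlinarith

end final
end WB

/-- **Lemma 2, (3.4)**: let `n ≤ p` and let `X` be an `n × p` random matrix with i.i.d.
`N(0,1)` entries, and `W = (1/n)XᵀX` the scaled Wishart matrix. Then with probability at
least `1 - exp(-p/(2(√5 + 2)²))`, the spectral norm of `W - I_p` is at most `4p/n`. -/
theorem wishart_centered_norm_bound
    (n p : ℕ) (hn : 0 < n) (hnp : n ≤ p) :
    1 - ENNReal.ofReal (Real.exp (-(p : ℝ) / (2 * (Real.sqrt 5 + 2) ^ 2)))
      ≤ (Measure.pi fun _ : Fin n => Measure.pi fun _ : Fin p =>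
          (gaussianReal 0 1 : Measure ℝ))
        {X : Fin n → Fin p → ℝ |
          specNorm ((n : ℝ)⁻¹ • ((Matrix.of X)ᵀ * Matrix.of X) - 1)
            ≤ 4 * (p : ℝ) / n} := by
  have hp : 0 < p := hn.trans_le hnp
  have hl : 0 < (Real.sqrt 5 - 2) * Real.sqrt (p : ℝ) := by
    have h52 : 2 < Real.sqrt (5 : ℝ) := by
      apply Real.lt_sqrt_of_sq_lt; norm_num
    have : 0 < Real.sqrt (p : ℝ) := Real.sqrt_pos.2 (by exact_mod_cast hp)
    exact mul_pos (by linarith) this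
  have h1 := (WB.tail_sup hn hp hl (Real.sqrt ((n : ℝ) + 4 * p))).trans
    (ENNReal.ofReal_le_ofReal (Real.exp_le_exp.2 (WB.expo hn hnp)))
  set P := (Measure.pi fun _ : Fin n => Measure.pi fun _ : Fin p =>
          (gaussianReal 0 1 : Measure ℝ)) with hP
  set G := {X : Fin n → Fin p → ℝ |
          specNorm ((n : ℝ)⁻¹ • ((Matrix.of X)ᵀ * Matrix.of X) - 1)
            ≤ 4 * (p : ℝ) / n} with hG
  have h2 : P Gᶜ ≤ ENNReal.ofReal (Real.exp (-(p : ℝ) / (2 * (Real.sqrt 5 + 2) ^ 2))) :=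
    (measure_mono fun X hX => WB.det_part hn hnp X hX).trans h1
  have h3 : (1 : ENNReal) ≤ P G + P Gᶜ := by
    have h4 := measure_union_le (μ := P) G Gᶜ
    rwa [Set.union_compl_self, measure_univ] at h4
  rw [tsub_le_iff_right]
  exact h3.trans (add_le_add le_rfl h2)
end
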